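/- Let n ≥ 2 be an integer, let Γ ∈ 𝒰, and let K be a homogeneous Calderón–Zygmund kernel on ℝ^n. Suppose 1 < p ≤ 2 and 2 ≤ r ≤ p′ (p′ = p/(p−1)). Then there exist constants 𝒞 ≥ 1 and C, depending only on n, Γ, K, p, r, such that for all integers l ≥ 1, m, and k with |k − m| ≤ 𝒞, and every Schwartz function f on ℝ^n, one has ‖𝓗_{j,l}P_{k−j_*}f‖_{w_{r,p}(j∈S_{l,m})} ≤ C · 2^{−n(m+l)/p′} ‖f‖_{L^p(ℝ^n)}, where 𝓗_{j,l}P_{k−j_*}f(u,x) := χ(u) H_{l+j_*}^{(2^j u)}(P_{k−j_*}f)(x), and C is independent of k, m, l. -/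

import Mathlib

open MeasureTheory Filter Set
open scoped ENNReal NNReal FourierTransform Topology

noncomputable section

/-- `ℝⁿ` as a Euclidean space. -/
abbrev Rn (n : ℕ) := EuclideanSpace ℝ (Fin n)

/-- The class `𝒰` of phase functions: `Γ` is continuous on `[0,∞)`, smooth on `(0,∞)`,
`Γ(0) = 0`, `Γ′ > 0` on `(0,∞)`, with the bounds `c_{1,j} ≤ |s^j Γ^{(j)}(s)/Γ(s)|` for
`j = 1, 2` and `|s^j Γ^{(j)}(s)/Γ(s)| ≤ c_{2,j}` for all `j ≥ 1`. -/
structure IsGammaU (Γ : ℝ → ℝ) : Prop where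
  continuousOn : ContinuousOn Γ (Set.Ici 0)
  smooth : ContDiffOn ℝ (⊤ : ℕ∞) Γ (Set.Ioi 0)
  map_zero : Γ 0 = 0
  deriv_pos : ∀ s > (0 : ℝ), 0 < deriv Γ s
  lower : ∀ j ∈ ({1, 2} : Set ℕ), ∃ c > (0 : ℝ), ∀ s > (0 : ℝ),
    c ≤ |s ^ j * iteratedDeriv j Γ s / Γ s|
  upper : ∀ j : ℕ, 1 ≤ j → ∃ c > (0 : ℝ), ∀ s > (0 : ℝ),
    |s ^ j * iteratedDeriv j Γ s / Γ s| ≤ c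

/-- `K` is a homogeneous Calderón–Zygmund kernel on `ℝⁿ`: `K(t) = Ω(t)/‖t‖ⁿ` with `Ω` smooth
away from the origin, homogeneous of degree `0`, and of mean value zero on the unit sphere. -/
def IsHomCZKernel (n : ℕ) (K : Rn n → ℝ) : Prop :=
  ∃ Ω : Rn n → ℝ,
    ContDiffOn ℝ (⊤ : ℕ∞) Ω {x : Rn n | x ≠ 0} ∧
    (∀ c : ℝ, 0 < c → ∀ t : Rn n, Ω (c • t) = Ω t) ∧
    (∫ θ : Metric.sphere (0 : Rn n) 1, Ω θ ∂((volume : Measure (Rn n)).toSphere) = 0) ∧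
    (∀ t : Rn n, t ≠ 0 → K t = Ω t / ‖t‖ ^ n)

/-- The `r`-variation of a family `(a_u)_{u ∈ 𝒦}`. -/
def variation {ι : Type*} [LinearOrder ι] (r : ℝ) (𝒦 : Set ι) (a : ι → ℂ) : ℝ≥0∞ :=
  ⨆ (J : ℕ) (u : Fin (J + 1) → ι) (_ : StrictMono u) (_ : ∀ i, u i ∈ 𝒦),
    (∑ i : Fin J, (‖a (u i.succ) - a (u i.castSucc)‖₊ : ℝ≥0∞) ^ r) ^ (1 / r)

/-- The `λ`-jump counting function of a family `(a_u)_{u ∈ 𝒦}`. -/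
def jumpCount {ι : Type*} [LinearOrder ι] (lam : ℝ) (𝒦 : Set ι) (a : ι → ℂ) : ℝ≥0∞ :=
  ⨆ (J : ℕ) (s : Fin J → ι) (t : Fin J → ι) (_ : ∀ i, s i ∈ 𝒦) (_ : ∀ i, t i ∈ 𝒦)
    (_ : ∀ i, s i < t i) (_ : ∀ i j : Fin J, i < j → t i < s j)
    (_ : ∀ i, lam < ‖a (t i) - a (s i)‖), (J : ℝ≥0∞)

/-- The `L^p` norm of an `ℝ≥0∞`-valued function. -/
def lpNormENN {α : Type*} [MeasurableSpace α] (p : ℝ) (g : α → ℝ≥0∞) (μ : Measure α) : ℝ≥0∞ :=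
  (∫⁻ x, g x ^ p ∂μ) ^ (1 / p)

/-- The fixed Littlewood–Paley cutoff `ψ : ℝ → [0,1]`, supported in `{1/2 ≤ |s| ≤ 2}`,
with `∑_{l ∈ ℤ} ψ(2^{-l} s) = 1` for `s ≠ 0`. -/
def IsLPCutoff (ψ : ℝ → ℝ) : Prop :=
  ContDiff ℝ (⊤ : ℕ∞) ψ ∧ (∀ s, ψ s ∈ Set.Icc (0 : ℝ) 1) ∧
    (∀ s, ψ s ≠ 0 → |s| ∈ Set.Icc (1/2 : ℝ) 2) ∧
    (∀ s : ℝ, s ≠ 0 → HasSum (fun l : ℤ => ψ ((2 : ℝ) ^ (-l) * s)) 1)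

/-- `k_* = sup{ m ∈ ℤ : 2^k Γ(2^m) ≤ 1 }`. -/
def kstar (Γ : ℝ → ℝ) (k : ℤ) : ℤ :=
  sSup {m : ℤ | (2 : ℝ) ^ k * Γ ((2 : ℝ) ^ m) ≤ 1}

/-- The localized modulated integral `H_l^{(u)} f(x) = ∫ f(x−t) e^{iuΓ(|t|)} ψ_l(t) K(t) dt`. -/
def Hloc {n : ℕ} (Γ : ℝ → ℝ) (K : Rn n → ℝ) (ψ : ℝ → ℝ) (u : ℝ) (l : ℤ)
    (f : Rn n → ℂ) (x : Rn n) : ℂ :=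
  ∫ t : Rn n, f (x - t) * Complex.exp (Complex.I * Complex.ofReal (u * Γ ‖t‖)) *
    Complex.ofReal (ψ ((2 : ℝ) ^ (-l) * ‖t‖) * K t)

/-- The fixed cutoff `χ : ℝ → [0,1]`, supported in `[1/2, 4]` and equal to `1` on `[1,2]`. -/
def IsChiCutoff (χ : ℝ → ℝ) : Prop :=
  ContDiff ℝ (⊤ : ℕ∞) χ ∧ (∀ u, χ u ∈ Set.Icc (0 : ℝ) 1) ∧
    (∀ u, χ u ≠ 0 → u ∈ Set.Icc (1/2 : ℝ) 4) ∧ (∀ u ∈ Set.Icc (1 : ℝ) 2, χ u = 1)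

/-- The Littlewood–Paley projection `P_j` on `ℝⁿ`, `(P_j f)^(ξ) = ψ(2^{-j}|ξ|) f̂(ξ)`. -/
def LPproj {n : ℕ} (ψ : ℝ → ℝ) (j : ℤ) (f : Rn n → ℂ) : Rn n → ℂ :=
  𝓕⁻ fun ξ : Rn n => Complex.ofReal (ψ ((2 : ℝ) ^ (-j) * ‖ξ‖)) * 𝓕 f ξ

/-- The index set `S_{l,m} = { j ∈ ℤ : 2^{m+l} ≤ Γ(2^{l+j_*})/Γ(2^{j_*}) < 2^{m+l+1} }`. -/
def Slm (Γ : ℝ → ℝ) (l m : ℤ) : Set ℤ :=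
  {j : ℤ | (2 : ℝ) ^ (m + l) ≤ Γ ((2 : ℝ) ^ (l + kstar Γ j)) / Γ ((2 : ℝ) ^ (kstar Γ j)) ∧
    Γ ((2 : ℝ) ^ (l + kstar Γ j)) / Γ ((2 : ℝ) ^ (kstar Γ j)) < (2 : ℝ) ^ (m + l + 1)}

/-- Cauchy–Schwarz for lower integrals. -/
lemma lintegral_mul_sq_le {α : Type*} [MeasurableSpace α] {μ : Measure α} {f g : α → ℝ≥0∞}
    (hf : AEMeasurable f μ) (hg : AEMeasurable g μ) :
    (∫⁻ x, f x * g x ∂μ) ^ 2 ≤ (∫⁻ x, f x ^ 2 ∂μ) * ∫⁻ x, g x ^ 2 ∂μ := by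
  have h := ENNReal.lintegral_mul_le_Lp_mul_Lq μ Real.HolderConjugate.two_two hf hg
  have h2 := pow_le_pow_left₀ (zero_le) h 2
  refine h2.trans (le_of_eq ?_)
  rw [mul_pow, ← ENNReal.rpow_natCast, ← ENNReal.rpow_natCast, ← ENNReal.rpow_mul,
    ← ENNReal.rpow_mul]
  norm_num

/-- Weighted Cauchy–Schwarz for lower integrals. -/
lemma lintegral_mul_sq_le' {α : Type*} [MeasurableSpace α] {μ : Measure α} {f g : α → ℝ≥0∞}
    (hf : AEMeasurable f μ) (hg : AEMeasurable g μ) :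
    (∫⁻ x, f x * g x ∂μ) ^ 2 ≤ (∫⁻ x, g x ∂μ) * ∫⁻ x, f x ^ 2 * g x ∂μ := by
  have hs : ∀ x, g x ^ (1/2 : ℝ) * g x ^ (1/2 : ℝ) = g x := fun x => by
    rw [← ENNReal.rpow_add_of_nonneg _ _ (by norm_num) (by norm_num)]; norm_num
  have h := lintegral_mul_sq_le (μ := μ) (hg.pow_const (1/2 : ℝ))
    (hf.mul (hg.pow_const (1/2 : ℝ)))
  calc _ = (∫⁻ x, g x ^ (1/2 : ℝ) * (f * fun x => g x ^ (1/2 : ℝ)) x ∂μ) ^ 2 := by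
        congr 2; ext x; simp only [Pi.mul_apply]; rw [mul_left_comm, hs]
    _ ≤ _ := h
    _ = _ := by
        congr 1
        · congr 1; ext x; rw [pow_two, hs]
        · congr 1; ext x; simp only [Pi.mul_apply]; rw [mul_pow, pow_two (_ ^ (1/2:ℝ)), hs]

section Conv
variable {n : ℕ}

/-- Convolution on `ℝⁿ`, with the kernel as the second factor. -/
def cv (a κ : Rn n → ℂ) (x : Rn n) : ℂ := ∫ t, a (x - t) * κ t

/-- Convolution of nonnegative functions. -/
def lcv (a κ : Rn n → ℝ≥0∞) (x : Rn n) : ℝ≥0∞ := ∫⁻ t, a (x - t) * κ t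

lemma measurable_cv {a κ : Rn n → ℂ} (ha : Measurable a) (hκ : Measurable κ) :
    Measurable (cv a κ) := by
  have : StronglyMeasurable (fun q : Rn n × Rn n => a (q.1 - q.2) * κ q.2) := by
    apply Measurable.stronglyMeasurable; fun_prop
  exact this.integral_prod_right.measurable

lemma measurable_lcv {a κ : Rn n → ℝ≥0∞} (ha : Measurable a) (hκ : Measurable κ) :
    Measurable (lcv a κ) := by
  have : Measurable (fun q : Rn n × Rn n => a (q.1 - q.2) * κ q.2) := by fun_prop
  exact this.lintegral_prod_right'

lemma enorm_cv_le (a κ : Rn n → ℂ) (x : Rn n) :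
    ‖cv a κ x‖ₑ ≤ lcv (fun y => ‖a y‖ₑ) (fun y => ‖κ y‖ₑ) x := by
  refine (enorm_integral_le_lintegral_enorm _).trans (le_of_eq ?_)
  simp [lcv, enorm_mul]

lemma lcv_eq (a κ : Rn n → ℝ≥0∞) (x : Rn n) : lcv a κ x = ∫⁻ y, a y * κ (x - y) := by
  rw [lcv, ← lintegral_sub_left_eq_self _ x]; simp

lemma cv_eq (a κ : Rn n → ℂ) (x : Rn n) : cv a κ x = ∫ y, a y * κ (x - y) := by
  rw [cv, ← integral_sub_left_eq_self _ _ x]; simp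

lemma lintegral_lcv {a κ : Rn n → ℝ≥0∞} (ha : Measurable a) (hκ : Measurable κ) :
    ∫⁻ x, lcv a κ x = (∫⁻ x, a x) * ∫⁻ x, κ x := by
  unfold lcv
  rw [lintegral_lintegral_swap (by fun_prop)]
  have : ∀ t, ∫⁻ x, a (x - t) * κ t = (∫⁻ x, a x) * κ t := fun t => by
    rw [lintegral_mul_const _ (by fun_prop), lintegral_sub_right_eq_self]
  simp_rw [this]
  rw [lintegral_const_mul _ hκ]

lemma lintegral_lcv_sq {a κ : Rn n → ℝ≥0∞} (ha : Measurable a) (hκ : Measurable κ) :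
    ∫⁻ x, lcv a κ x ^ 2 ≤ (∫⁻ x, κ x) ^ 2 * ∫⁻ x, a x ^ 2 := by
  calc ∫⁻ x, lcv a κ x ^ 2 ≤ ∫⁻ x, (∫⁻ x, κ x) * lcv (fun y => a y ^ 2) κ x := by
        refine lintegral_mono fun x => ?_
        exact lintegral_mul_sq_le' (by fun_prop) (by fun_prop)
    _ = _ := by
        rw [lintegral_const_mul _ (measurable_lcv (by fun_prop) hκ),
          lintegral_lcv (by fun_prop) hκ]; ring

/-- The `TT*` bound for convolution operators in terms of the autocorrelation of the kernel. -/
lemma lintegral_cv_sq_le {a κ : Rn n → ℂ} (ha : Measurable a) (hκ : Measurable κ)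
    (hai : Integrable a) (hκi : Integrable κ) {M : ℝ} (hM : ∀ x, ‖κ x‖ ≤ M) :
    ∫⁻ x, ‖cv a κ x‖ₑ ^ 2 ≤
      (∫⁻ h, ‖∫ s, κ (s + h) * (starRingEnd ℂ) (κ s)‖ₑ) * ∫⁻ x, ‖a x‖ₑ ^ 2 := by
  set G : Rn n → ℂ := fun h => ∫ s, κ (s + h) * (starRingEnd ℂ) (κ s) with hG
  have hGm : Measurable G := by
    have : StronglyMeasurable (fun q : Rn n × Rn n => κ (q.2 + q.1) * (starRingEnd ℂ) (κ q.2)) := by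
      apply Measurable.stronglyMeasurable
      exact (hκ.comp (by fun_prop)).mul (RCLike.continuous_conj.measurable.comp (by fun_prop))
    exact this.integral_prod_right.measurable
  have hcb : ∀ x, ‖cv a κ x‖ ≤ M * ∫ y, ‖a y‖ := fun x => by
    rw [cv_eq]
    calc _ ≤ ∫ y, ‖a y * κ (x - y)‖ := norm_integral_le_integral_norm _
      _ ≤ ∫ y, M * ‖a y‖ := by
        apply integral_mono_of_nonneg (Eventually.of_forall fun y => norm_nonneg _)
          (hai.norm.const_mul _)
        refine Eventually.of_forall fun y => ?_
        simp only [norm_mul]; rw [mul_comm]; gcongr; exact hM _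
      _ = _ := integral_const_mul _ _
  have hcm := measurable_cv ha hκ
  have hci : Integrable (cv a κ) := by
    refine ⟨hcm.aestronglyMeasurable, ?_⟩
    refine (lintegral_mono fun x => enorm_cv_le a κ x).trans_lt ?_
    rw [lintegral_lcv (by fun_prop) (by fun_prop)]
    exact ENNReal.mul_lt_top hai.2 hκi.2
  -- the square as an integral over pairs
  let F : Rn n × (Rn n × Rn n) → ℂ := fun q =>
    (a q.2.1 * (starRingEnd ℂ) (a q.2.2)) * (κ (q.1 - q.2.1) * (starRingEnd ℂ) (κ (q.1 - q.2.2)))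
  have hsq : ∀ x, cv a κ x * (starRingEnd ℂ) (cv a κ x) = ∫ q : Rn n × Rn n, F (x, q) := by
    intro x
    have h2 : (starRingEnd ℂ) (cv a κ x) = ∫ y, (starRingEnd ℂ) (a y) * (starRingEnd ℂ) (κ (x - y)) := by
      rw [cv_eq, ← integral_conj]; simp
    rw [h2, cv_eq, ← integral_prod_mul]
    congr 1; ext q; simp only [F]; ring
  have hmF : Measurable F := by
    have hc : Measurable (starRingEnd ℂ : ℂ → ℂ) := RCLike.continuous_conj.measurable
    exact ((ha.comp (by fun_prop)).mul (hc.comp (ha.comp (by fun_prop)))).mul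
      ((hκ.comp (by fun_prop)).mul (hc.comp (hκ.comp (by fun_prop))))
  have hM0 : 0 ≤ M := (norm_nonneg _).trans (hM 0)
  have hFi : Integrable F (volume.prod (volume.prod volume)) := by
    refine ⟨hmF.aestronglyMeasurable, ?_⟩
    rw [HasFiniteIntegral, lintegral_prod_symm _ (by fun_prop)]
    calc ∫⁻ q : Rn n × Rn n, ∫⁻ x, ‖F (x, q)‖ₑ ∂volume ∂(volume.prod volume)
        ≤ ∫⁻ q : Rn n × Rn n, (‖a q.1‖ₑ * ‖a q.2‖ₑ) * (ENNReal.ofReal M * ∫⁻ x, ‖κ x‖ₑ)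
            ∂(volume.prod volume) := by
          refine lintegral_mono fun q => ?_
          calc _ ≤ ∫⁻ x, (‖a q.1‖ₑ * ‖a q.2‖ₑ) * (ENNReal.ofReal M * ‖κ (x - q.1)‖ₑ) := by
                refine lintegral_mono fun x => ?_
                simp only [F, enorm_mul, RCLike.enorm_conj]
                rw [mul_comm ‖κ (x - q.1)‖ₑ]
                gcongr
                rw [← ofReal_norm]; exact ENNReal.ofReal_le_ofReal (hM _)
            _ = _ := by
                rw [lintegral_const_mul _ (by fun_prop), lintegral_const_mul _ (by fun_prop),
                  lintegral_sub_right_eq_self (fun x => ‖κ x‖ₑ)]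
      _ = (∫⁻ x, ‖a x‖ₑ) * (∫⁻ x, ‖a x‖ₑ) * (ENNReal.ofReal M * ∫⁻ x, ‖κ x‖ₑ) := by
          rw [lintegral_mul_const _ (by fun_prop), lintegral_prod_mul (f := fun y => ‖a y‖ₑ) (g := fun y => ‖a y‖ₑ)
            (by fun_prop) (by fun_prop)]
      _ < ⊤ := ENNReal.mul_lt_top (ENNReal.mul_lt_top hai.2 hai.2)
          (ENNReal.mul_lt_top ENNReal.ofReal_lt_top hκi.2)
  have hnn : ∀ x, cv a κ x * (starRingEnd ℂ) (cv a κ x) = ((‖cv a κ x‖ ^ 2 : ℝ) : ℂ) := fun x => by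
    rw [Complex.mul_conj, Complex.normSq_eq_norm_sq]
  have hkey : ((∫ x, ‖cv a κ x‖ ^ 2 : ℝ) : ℂ) =
      ∫ q : Rn n × Rn n, (a q.1 * (starRingEnd ℂ) (a q.2)) * G (q.2 - q.1) ∂(volume.prod volume) := by
    rw [← integral_complex_ofReal]
    simp_rw [← hnn, hsq]
    change ∫ x, ∫ q : Rn n × Rn n, F (x, q) ∂(volume.prod volume) = _
    rw [integral_integral_swap (f := fun x q => F (x, q)) hFi]
    congr 1; ext q
    simp only [F]
    rw [integral_const_mul]
    congr 1
    simp only [hG]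
    rw [← integral_sub_right_eq_self (fun s => κ (s + (q.2 - q.1)) * (starRingEnd ℂ) (κ s)) q.2]
    congr 1; ext s
    congr 2; abel_nf
  have hsq_int : Integrable fun x => ‖cv a κ x‖ ^ 2 := by
    have := hci.norm.bdd_mul (c := M * ∫ y, ‖a y‖) (f := fun x => ‖cv a κ x‖)
      hcm.norm.aestronglyMeasurable
      (Eventually.of_forall fun x => by simpa using hcb x)
    simpa [pow_two] using this
  calc ∫⁻ x, ‖cv a κ x‖ₑ ^ 2 = ∫⁻ x, ENNReal.ofReal (‖cv a κ x‖ ^ 2) := by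
        congr 1; ext x; rw [ENNReal.ofReal_pow (norm_nonneg _), ofReal_norm]
    _ = ENNReal.ofReal (∫ x, ‖cv a κ x‖ ^ 2) := by
        rw [ofReal_integral_eq_lintegral_ofReal hsq_int (Eventually.of_forall fun x => by positivity)]
    _ = ‖((∫ x, ‖cv a κ x‖ ^ 2 : ℝ) : ℂ)‖ₑ := by
        rw [← ofReal_norm, Complex.norm_real, Real.norm_of_nonneg (integral_nonneg fun x => by positivity)]
    _ ≤ ∫⁻ q : Rn n × Rn n, ‖a q.1‖ₑ * ‖a q.2‖ₑ * ‖G (q.2 - q.1)‖ₑ ∂(volume.prod volume) := by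
        rw [hkey]
        refine (enorm_integral_le_lintegral_enorm _).trans (le_of_eq ?_)
        simp [enorm_mul]
    _ = ∫⁻ x, ‖a x‖ₑ * ∫⁻ h, ‖a (x + h)‖ₑ * ‖G h‖ₑ := by
        rw [lintegral_prod _ (by fun_prop)]
        congr 1; ext x
        rw [← lintegral_const_mul _ (by fun_prop), ← lintegral_add_right_eq_self _ x]
        congr 1; ext y; simp [mul_assoc, add_comm]
    _ = ∫⁻ h, ‖G h‖ₑ * ∫⁻ x, ‖a x‖ₑ * ‖a (x + h)‖ₑ := by
        have : ∀ x, ‖a x‖ₑ * ∫⁻ h, ‖a (x + h)‖ₑ * ‖G h‖ₑ =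
            ∫⁻ h, ‖a x‖ₑ * (‖a (x + h)‖ₑ * ‖G h‖ₑ) := fun x =>
          (lintegral_const_mul _ (by fun_prop)).symm
        simp_rw [this]
        rw [lintegral_lintegral_swap (by fun_prop)]
        congr 1; ext h
        rw [← lintegral_const_mul _ (by fun_prop)]
        congr 1; ext x; ring
    _ ≤ ∫⁻ h, ‖G h‖ₑ * ∫⁻ x, ‖a x‖ₑ ^ 2 := by
        refine lintegral_mono fun h => ?_
        refine mul_le_mul_right ?_ _
        have := lintegral_mul_sq_le (μ := (volume : Measure (Rn n))) (f := fun x => ‖a x‖ₑ)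
          (g := fun x => ‖a (x + h)‖ₑ) (by fun_prop) (by fun_prop)
        rw [lintegral_add_right_eq_self (fun x => ‖a x‖ₑ ^ 2), ← pow_two] at this
        exact (ENNReal.pow_le_pow_left_iff two_ne_zero).1 this
    _ = _ := lintegral_mul_const _ (by fun_prop)

end Conv

/-- A family of functions on open sets, smooth with uniform bounds on all derivatives. -/
structure UnifSmooth {ι E F : Type*} [NormedAddCommGroup E] [NormedSpace ℝ E]
    [NormedAddCommGroup F] [NormedSpace ℝ F] (U : ι → Set E) (f : ι → E → F) : Prop where
  isOpen : ∀ i, IsOpen (U i)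
  contDiffOn : ∀ i, ContDiffOn ℝ (⊤ : ℕ∞) (f i) (U i)
  bound : ∀ k : ℕ, ∃ M : ℝ, ∀ i, ∀ x ∈ U i, ‖iteratedFDerivWithin ℝ k (f i) (U i) x‖ ≤ M

namespace UnifSmooth
variable {ι E F G : Type*} [NormedAddCommGroup E] [NormedSpace ℝ E]
    [NormedAddCommGroup F] [NormedSpace ℝ F] [NormedAddCommGroup G] [NormedSpace ℝ G]
    {U : ι → Set E}

lemma bound_le {f : ι → E → F} (hf : UnifSmooth U f) (k : ℕ) :
    ∃ M : ℝ, 1 ≤ M ∧ ∀ j ≤ k, ∀ i, ∀ x ∈ U i, ‖iteratedFDerivWithin ℝ j (f i) (U i) x‖ ≤ M := by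
  choose M hM using hf.bound
  refine ⟨1 + ∑ j ∈ Finset.range (k + 1), |M j|,
    le_add_of_nonneg_right (Finset.sum_nonneg fun _ _ => abs_nonneg _), fun j hj i x hx => ?_⟩
  have := Finset.single_le_sum (f := fun j => |M j|) (fun _ _ => abs_nonneg _)
    (Finset.mem_range.2 (Nat.lt_succ_of_le hj))
  linarith [hM j i x hx, le_abs_self (M j)]

lemma bound_zero {f : ι → E → F} (hf : UnifSmooth U f) :
    ∃ M : ℝ, ∀ i, ∀ x ∈ U i, ‖f i x‖ ≤ M := by
  obtain ⟨M, hM⟩ := hf.bound 0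
  exact ⟨M, fun i x hx => by simpa using hM i x hx⟩

lemma smul {f : ι → E → ℝ} {g : ι → E → F} (hf : UnifSmooth U f) (hg : UnifSmooth U g) :
    UnifSmooth U (fun i x => f i x • g i x) where
  isOpen := hf.isOpen
  contDiffOn i := (hf.contDiffOn i).smul (hg.contDiffOn i)
  bound k := by
    obtain ⟨M, hM1, hM⟩ := hf.bound_le k
    obtain ⟨N, hN1, hN⟩ := hg.bound_le k
    refine ⟨∑ i ∈ Finset.range (k + 1), (k.choose i : ℝ) * M * N, fun i x hx => ?_⟩
    refine (norm_iteratedFDerivWithin_smul_le (hf.contDiffOn i) (hg.contDiffOn i)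
      (hf.isOpen i).uniqueDiffOn hx (n := k) (by exact_mod_cast le_top)).trans ?_
    refine Finset.sum_le_sum fun j hj => ?_
    have hj' : j ≤ k := Nat.lt_succ_iff.1 (Finset.mem_range.1 hj)
    have h1 := hM j hj' i x hx
    have h2 := hN (k - j) (Nat.sub_le _ _) i x hx
    gcongr

lemma comp {V : ι → Set F} {g : ι → F → G} {f : ι → E → F} (hg : UnifSmooth V g)
    (hf : UnifSmooth U f) (h : ∀ i, MapsTo (f i) (U i) (V i)) :
    UnifSmooth U (fun i => g i ∘ f i) where
  isOpen := hf.isOpen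
  contDiffOn i := (hg.contDiffOn i).comp (hf.contDiffOn i) (h i)
  bound k := by
    obtain ⟨M, hM1, hM⟩ := hf.bound_le k
    obtain ⟨N, hN1, hN⟩ := hg.bound_le k
    refine ⟨k.factorial * N * M ^ k, fun i x hx => ?_⟩
    refine norm_iteratedFDerivWithin_comp_le (hg.contDiffOn i) (hf.contDiffOn i)
      (by exact_mod_cast le_top) (hg.isOpen i).uniqueDiffOn (hf.isOpen i).uniqueDiffOn (h i) hx
      (fun j hj => hN j hj i _ (h i hx)) fun j hj1 hj => ?_
    exact (hM j hj i x hx).trans (le_self_pow₀ hM1 (by omega))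

lemma congr {f g : ι → E → F} (hf : UnifSmooth U f) (h : ∀ i, EqOn (g i) (f i) (U i)) :
    UnifSmooth U g where
  isOpen := hf.isOpen
  contDiffOn i := (hf.contDiffOn i).congr (h i)
  bound k := by
    obtain ⟨M, hM⟩ := hf.bound k
    exact ⟨M, fun i x hx => by rw [iteratedFDerivWithin_congr (h i) hx]; exact hM i x hx⟩

lemma reindex {f : ι → E → F} (hf : UnifSmooth U f) {κ : Type*} (e : κ → ι) :
    UnifSmooth (fun k => U (e k)) (fun k => f (e k)) where
  isOpen k := hf.isOpen _
  contDiffOn k := hf.contDiffOn _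
  bound k := by
    obtain ⟨M, hM⟩ := hf.bound k
    exact ⟨M, fun i x hx => hM _ x hx⟩

lemma of_compact {f : E → F} {W K : Set E} (hW : IsOpen W) (hf : ContDiffOn ℝ (⊤ : ℕ∞) f W)
    (hK : IsCompact K) (hKW : K ⊆ W) (hU : ∀ i, IsOpen (U i)) (hUK : ∀ i, U i ⊆ K) :
    UnifSmooth U (fun _ => f) where
  isOpen := hU
  contDiffOn i := hf.mono ((hUK i).trans hKW)
  bound k := by
    have hc : ContinuousOn (iteratedFDerivWithin ℝ k f W) K :=
      (hf.continuousOn_iteratedFDerivWithin (by exact_mod_cast le_top) hW.uniqueDiffOn).mono hKW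
    obtain ⟨M, hM⟩ := hK.exists_bound_of_continuousOn hc
    refine ⟨M, fun i x hx => ?_⟩
    rw [iteratedFDerivWithin_of_isOpen k (hU i) hx,
      ← iteratedFDerivWithin_of_isOpen k hW (hKW (hUK i hx))]
    exact hM x (hUK i hx)

lemma fderiv_apply {f : ι → E → F} (hf : UnifSmooth U f) {v : ι → E} (hv : ∀ i, ‖v i‖ ≤ 1) :
    UnifSmooth U (fun i x => fderiv ℝ (f i) x (v i)) := by
  have key : UnifSmooth U (fun i x => fderivWithin ℝ (f i) (U i) x (v i)) :=
    { isOpen := hf.isOpen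
      contDiffOn := fun i => ((hf.contDiffOn i).fderivWithin (hf.isOpen i).uniqueDiffOn
        (m := (⊤ : ℕ∞)) (by simp)).clm_apply contDiffOn_const
      bound := fun k => by
        obtain ⟨M, hM⟩ := hf.bound (k + 1)
        refine ⟨M, fun i x hx => ?_⟩
        have hc := (hf.contDiffOn i).fderivWithin (hf.isOpen i).uniqueDiffOn
          (m := (⊤ : ℕ∞)) (by simp)
        refine (norm_iteratedFDerivWithin_clm_apply_const (hc x hx) (hf.isOpen i).uniqueDiffOn hx
          (n := k) (by exact_mod_cast le_top)).trans ?_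
        rw [norm_iteratedFDerivWithin_fderivWithin (hf.isOpen i).uniqueDiffOn hx]
        exact (mul_le_of_le_one_left (norm_nonneg _) (hv i)).trans (hM i x hx) }
  exact key.congr fun i x hx => by
    simp only [fderivWithin_of_isOpen (hf.isOpen i) hx]

lemma add {f g : ι → E → F} (hf : UnifSmooth U f) (hg : UnifSmooth U g) :
    UnifSmooth U (fun i x => f i x + g i x) where
  isOpen := hf.isOpen
  contDiffOn i := (hf.contDiffOn i).add (hg.contDiffOn i)
  bound k := by
    obtain ⟨M, hM⟩ := hf.bound k
    obtain ⟨N, hN⟩ := hg.bound k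
    refine ⟨M + N, fun i x hx => ?_⟩
    have := iteratedFDerivWithin_add_apply (i := k) (f := f i) (g := g i)
      (((hf.contDiffOn i) x hx).of_le (by exact_mod_cast le_top))
      (((hg.contDiffOn i) x hx).of_le (by exact_mod_cast le_top)) (hf.isOpen i).uniqueDiffOn hx
    change ‖iteratedFDerivWithin ℝ k (f i + g i) (U i) x‖ ≤ _
    rw [this]
    exact (norm_add_le _ _).trans (add_le_add (hM i x hx) (hN i x hx))

lemma const {c : ι → F} (hU : ∀ i, IsOpen (U i)) {M : ℝ} (hc : ∀ i, ‖c i‖ ≤ M) :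
    UnifSmooth U (fun i _ => c i) where
  isOpen := hU
  contDiffOn i := contDiffOn_const
  bound k := by
    refine ⟨|M|, fun i x hx => ?_⟩
    rcases Nat.eq_zero_or_pos k with rfl | hk
    · simpa using (hc i).trans (le_abs_self M)
    · rw [iteratedFDerivWithin_of_isOpen k (hU i) hx, iteratedFDeriv_const_of_ne hk.ne']
      simp

lemma inv {p : ι → E → ℝ} (hp : UnifSmooth U p) {c : ℝ} (hc : 0 < c)
    (h : ∀ i, ∀ x ∈ U i, c ≤ p i x) : UnifSmooth U (fun i x => (p i x)⁻¹) := by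
  obtain ⟨M, hM⟩ := hp.bound_zero
  have h1 : UnifSmooth (fun _ : ι => Ioo (c / 2) (M + 1)) (fun _ (t : ℝ) => t⁻¹) := by
    refine UnifSmooth.of_compact (W := Ioi 0) (K := Icc (c / 2) (M + 1)) isOpen_Ioi ?_
      isCompact_Icc (fun x hx => ?_) (fun _ => isOpen_Ioo) (fun _ => Ioo_subset_Icc_self)
    · exact contDiffOn_id.inv fun x hx => (ne_of_gt hx)
    · exact lt_of_lt_of_le (by positivity) hx.1
  refine h1.comp hp fun i x hx => ⟨?_, ?_⟩
  · linarith [h i x hx]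
  · have := hM i x hx
    rw [Real.norm_eq_abs] at this
    linarith [le_abs_self (p i x)]

/-- Difference quotients of a uniformly smooth family are uniformly smooth. -/
lemma diffQuot {f : ι → E → F} (hf : UnifSmooth U f) {V : ι → Set E} (hV : ∀ i, IsOpen (V i))
    {h : ι → E} (hh : ∀ i, h i ≠ 0) (hs : ∀ i, ∀ x ∈ V i, segment ℝ x (x + h i) ⊆ U i) :
    UnifSmooth V (fun i x => ‖h i‖⁻¹ • (f i (x + h i) - f i x)) := by
  have hc1 : ∀ i, ∀ x ∈ V i, ContDiffAt ℝ (⊤ : ℕ∞) (f i) x := fun i x hx =>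
    (hf.contDiffOn i).contDiffAt ((hf.isOpen i).mem_nhds (hs i x hx (left_mem_segment ℝ _ _)))
  have hc2 : ∀ i, ∀ x ∈ V i, ContDiffAt ℝ (⊤ : ℕ∞) (fun x => f i (x + h i)) x := fun i x hx =>
    ((hf.contDiffOn i).contDiffAt
      ((hf.isOpen i).mem_nhds (hs i x hx (right_mem_segment ℝ _ _)))).comp x
        (contDiffAt_id.add contDiffAt_const)
  refine ⟨hV, fun i x hx => ((contDiffAt_const (c := ‖h i‖⁻¹)).smul
    ((hc2 i x hx).sub (hc1 i x hx))).contDiffWithinAt, fun k => ?_⟩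
  obtain ⟨M, hM⟩ := hf.bound (k + 1)
  refine ⟨M, fun i x hx => ?_⟩
  have hpos : 0 < ‖h i‖ := norm_pos_iff.2 (hh i)
  have hk : ((k : ℕ∞) : WithTop ℕ∞) ≤ ((⊤ : ℕ∞) : WithTop ℕ∞) := by exact_mod_cast le_top
  have e1 : iteratedFDeriv ℝ k (fun x => ‖h i‖⁻¹ • (f i (x + h i) - f i x)) x =
      ‖h i‖⁻¹ • (iteratedFDeriv ℝ k (f i) (x + h i) - iteratedFDeriv ℝ k (f i) x) := by
    have := iteratedFDeriv_const_smul_apply' (i := k) (a := ‖h i‖⁻¹)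
      (f := fun x => f i (x + h i) - f i x) (x := x)
      (((hc2 i x hx).sub (hc1 i x hx)).of_le hk)
    rw [this]
    congr 1
    have h3 := iteratedFDeriv_sub_apply (i := k) (f := fun x => f i (x + h i)) (g := f i) (x := x)
      ((hc2 i x hx).of_le hk) ((hc1 i x hx).of_le hk)
    have h4 := iteratedFDeriv_comp_add_right (𝕜 := ℝ) (f := f i) k (h i) x
    rw [← h4]
    exact h3
  rw [iteratedFDerivWithin_of_isOpen k (hV i) hx, e1, norm_smul, norm_inv, norm_norm,
    inv_mul_le_iff₀ hpos]
  have h5 := Convex.norm_image_sub_le_of_norm_hasFDerivWithin_le (𝕜 := ℝ)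
    (f := iteratedFDeriv ℝ k (f i)) (f' := fun y => fderiv ℝ (iteratedFDeriv ℝ k (f i)) y)
    (s := segment ℝ x (x + h i)) (x := x) (y := x + h i) (C := M) (fun y hy => ?_) (fun y hy => ?_)
    (convex_segment _ _) (left_mem_segment ℝ _ _) (right_mem_segment ℝ _ _)
  · simpa [mul_comm] using h5
  · have hy' := hs i x hx hy
    have : ContDiffAt ℝ (⊤ : ℕ∞) (f i) y :=
      (hf.contDiffOn i).contDiffAt ((hf.isOpen i).mem_nhds hy')
    exact ((this.differentiableAt_iteratedFDeriv (m := k)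
      (by exact_mod_cast (WithTop.coe_lt_top _)))).hasFDerivAt.hasFDerivWithinAt
  · have hy' := hs i x hx hy
    rw [norm_fderiv_iteratedFDeriv, ← iteratedFDerivWithin_of_isOpen _ (hf.isOpen i) hy']
    exact hM i y hy'

end UnifSmooth

lemma contDiff_of_isOpen_of_tsupport {E F : Type*} [NormedAddCommGroup E] [NormedSpace ℝ E]
    [NormedAddCommGroup F] [NormedSpace ℝ F] {g : E → F} {U : Set E} (hU : IsOpen U)
    (hg : ContDiffOn ℝ (⊤ : ℕ∞) g U) (hs : tsupport g ⊆ U) : ContDiff ℝ (⊤ : ℕ∞) g := by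
  rw [contDiff_iff_contDiffAt]
  intro x
  by_cases hx : x ∈ tsupport g
  · exact hg.contDiffAt (hU.mem_nhds (hs hx))
  · have : g =ᶠ[𝓝 x] fun _ => 0 := notMem_tsupport_iff_eventuallyEq.1 hx
    exact contDiffAt_const.congr_of_eventuallyEq this

section Oscillatory
variable {ι E : Type*} [NormedAddCommGroup E] [NormedSpace ℝ E] [FiniteDimensional ℝ E]
  [MeasurableSpace E] [BorelSpace E] {μ : Measure E} [μ.IsAddHaarMeasure]

/-- Non-stationary phase: one integration by parts. -/
lemma oscillatory_ibp {U : Set E} (hU : IsOpen U) {Ψ p : E → ℝ} {b : E → ℂ} {v : E}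
    (hΨ : ContDiffOn ℝ (⊤ : ℕ∞) Ψ U) (hp : ContDiffOn ℝ (⊤ : ℕ∞) p U)
    (hb : ContDiffOn ℝ (⊤ : ℕ∞) b U) (hpΨ : ∀ x ∈ U, fderiv ℝ Ψ x v = p x)
    (hp0 : ∀ x ∈ U, p x ≠ 0) (hbc : HasCompactSupport b) (hbs : tsupport b ⊆ U) {t : ℝ}
    (ht : 0 < t) :
    ‖∫ x, Complex.exp (Complex.I * ((t * Ψ x : ℝ) : ℂ)) * b x ∂μ‖ =
      t⁻¹ * ‖∫ x, Complex.exp (Complex.I * ((t * Ψ x : ℝ) : ℂ)) *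
        fderiv ℝ (fun y => (p y)⁻¹ • b y) x v ∂μ‖ := by
  set g : E → ℂ := fun y => (p y)⁻¹ • b y with hgdef
  have hgsupp : tsupport g ⊆ tsupport b :=
    closure_mono fun x hx => by
      simp only [hgdef, Function.mem_support] at hx ⊢
      exact fun h => hx (by simp [h])
  have hgc : HasCompactSupport g := hbc.of_isClosed_subset (isClosed_tsupport _) hgsupp
  have hgU : ContDiffOn ℝ (⊤ : ℕ∞) g U := (hp.inv hp0).smul hb
  have hg : ContDiff ℝ (⊤ : ℕ∞) g := contDiff_of_isOpen_of_tsupport hU hgU (hgsupp.trans hbs)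
  set e : E → ℂ := fun x => Complex.exp (Complex.I * ((t * Ψ x : ℝ) : ℂ)) with hedef
  have he : ∀ x ∈ U, HasFDerivAt e ((Complex.I * t * e x) • (Complex.ofRealCLM.comp (fderiv ℝ Ψ x))) x := by
    intro x hx
    have hd : HasFDerivAt Ψ (fderiv ℝ Ψ x) x :=
      ((hΨ.contDiffAt (hU.mem_nhds hx)).differentiableAt (by simp)).hasFDerivAt
    have h1 : HasFDerivAt (fun x => ((Ψ x : ℝ) : ℂ)) (Complex.ofRealCLM.comp (fderiv ℝ Ψ x)) x :=
      Complex.ofRealCLM.hasFDerivAt.comp x hd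
    have h2 := (h1.const_mul (Complex.I * t)).cexp
    convert h2 using 1
    · ext x; simp [hedef]; ring_nf
    · simp only [hedef, smul_smul]; push_cast; ring_nf
  have hecd : ContinuousOn e U := fun x hx => (he x hx).continuousAt.continuousWithinAt
  have hcts : ∀ w : E → ℂ, Continuous w → tsupport w ⊆ U → HasCompactSupport w →
      Integrable (fun x => e x * w x) μ := by
    intro w hw hwU hwc
    refine Continuous.integrable_of_hasCompactSupport ?_ hwc.mul_left
    refine continuous_of_tsupport fun x hx => ?_
    have hxU : x ∈ U := hwU ((tsupport_mul_subset_right (f := e) (g := w)) hx)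
    exact ((he x hxU).continuousAt).mul hw.continuousAt
  have hbcont : Continuous b := (contDiff_of_isOpen_of_tsupport hU hb hbs).continuous
  have hDg : Continuous fun x => fderiv ℝ g x v :=
    (hg.continuous_fderiv (by simp)).clm_apply continuous_const
  have hDgs : tsupport (fun x => fderiv ℝ g x v) ⊆ tsupport g := by
    refine closure_minimal (fun x hx => ?_) (isClosed_tsupport _)
    by_contra hx'
    have : fderiv ℝ g x = 0 := by
      have := notMem_tsupport_iff_eventuallyEq.1 hx'
      rw [this.fderiv_eq]; simp
    simp [this] at hx
  have hmain : ∀ x, fderiv ℝ e x v * g x = Complex.I * t * (e x * b x) := by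
    intro x
    by_cases hx : x ∈ tsupport b
    · have hxU := hbs hx
      rw [(he x hxU).fderiv]
      have : (p x : ℂ) ≠ 0 := by exact_mod_cast hp0 x hxU
      simp only [_root_.smul_apply, ContinuousLinearMap.comp_apply, hpΨ x hxU,
        Complex.ofRealCLM_apply, smul_eq_mul, hgdef, Complex.real_smul, Complex.ofReal_inv]
      field_simp
    · have hb0 : b x = 0 := image_eq_zero_of_notMem_tsupport hx
      simp [hgdef, hb0]
  have hibp := integral_mul_fderiv_eq_neg_fderiv_mul_of_integrable (μ := μ) (f := e) (g := g) (v := v)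
    (by simp_rw [hmain]; exact (hcts b hbcont hbs hbc).const_mul _)
    (hcts _ hDg (hDgs.trans (hgsupp.trans hbs)) (hgc.of_isClosed_subset (isClosed_tsupport _) hDgs))
    (hcts g hg.continuous (hgsupp.trans hbs) hgc)
    (fun x hx => (he x (hbs (hgsupp hx))).differentiableAt)
    (fun x _ => hg.differentiable (by simp) x)
  simp_rw [hmain] at hibp
  rw [integral_const_mul] at hibp
  change ‖∫ x, e x * b x ∂μ‖ = t⁻¹ * ‖∫ x, e x * fderiv ℝ g x v ∂μ‖
  rw [hibp, norm_neg, norm_mul, norm_mul, Complex.norm_I, one_mul, Complex.norm_real,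
    Real.norm_of_nonneg ht.le, inv_mul_cancel_left₀ ht.ne']

/-- Non-stationary phase, uniformly over a family of phases and amplitudes. -/
lemma oscillatory_bound {U : ι → Set E} {Ψ p : ι → E → ℝ} {v : ι → E} (hv : ∀ i, ‖v i‖ ≤ 1)
    (hΨ : ∀ i, ContDiffOn ℝ (⊤ : ℕ∞) (Ψ i) (U i)) (hp : UnifSmooth U p)
    (hpΨ : ∀ i, ∀ x ∈ U i, fderiv ℝ (Ψ i) x (v i) = p i x) {c : ℝ} (hc : 0 < c)
    (hpc : ∀ i, ∀ x ∈ U i, c ≤ p i x) {Vol : ℝ} (hVol : ∀ i, μ.real (U i) ≤ Vol)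
    (hfin : ∀ i, μ (U i) < ⊤) (N : ℕ) :
    ∀ b : ι → E → ℂ, UnifSmooth U b → (∀ i, HasCompactSupport (b i)) →
      (∀ i, tsupport (b i) ⊆ U i) → ∃ C : ℝ, 0 ≤ C ∧ ∀ i, ∀ t : ℝ, 0 < t →
        ‖∫ x, Complex.exp (Complex.I * ((t * Ψ i x : ℝ) : ℂ)) * b i x ∂μ‖ ≤ C * t⁻¹ ^ N := by
  induction N with
  | zero =>
    intro b hb hbc hbs
    obtain ⟨M, hM⟩ := hb.bound_zero
    refine ⟨|M| * |Vol|, by positivity, fun i t ht => ?_⟩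
    have h1 : ∫ x, Complex.exp (Complex.I * ((t * Ψ i x : ℝ) : ℂ)) * b i x ∂μ =
        ∫ x in U i, Complex.exp (Complex.I * ((t * Ψ i x : ℝ) : ℂ)) * b i x ∂μ := by
      refine (setIntegral_eq_integral_of_forall_compl_eq_zero fun x hx => ?_).symm
      rw [image_eq_zero_of_notMem_tsupport fun h => hx (hbs i h), mul_zero]
    rw [h1, pow_zero, mul_one]
    refine (norm_setIntegral_le_of_norm_le_const (hfin i) fun x hx => ?_).trans
      (mul_le_mul_of_nonneg_left ((hVol i).trans (le_abs_self _)) (abs_nonneg M))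
    rw [norm_mul, mul_comm Complex.I, Complex.norm_exp_ofReal_mul_I, one_mul]
    exact (hM i x hx).trans (le_abs_self _)
  | succ N ih =>
    intro b hb hbc hbs
    have hb' : UnifSmooth U (fun i x => fderiv ℝ (fun y => (p i y)⁻¹ • b i y) x (v i)) :=
      ((hp.inv hc hpc).smul hb).fderiv_apply hv
    have hts : ∀ i, tsupport (fun x => fderiv ℝ (fun y => (p i y)⁻¹ • b i y) x (v i)) ⊆
        tsupport (b i) := by
      intro i
      refine closure_minimal (fun x hx => ?_) (isClosed_tsupport _)
      by_contra hx'
      have : fderiv ℝ (fun y => (p i y)⁻¹ • b i y) x = 0 := by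
        have h0 := notMem_tsupport_iff_eventuallyEq.1 hx'
        have h2 : (fun y => (p i y)⁻¹ • b i y) =ᶠ[𝓝 x] fun _ => 0 := by
          filter_upwards [h0] with y hy
          simp [hy]
        rw [h2.fderiv_eq]; simp
      exact hx (by change (fderiv ℝ (fun y => (p i y)⁻¹ • b i y) x) (v i) = 0; rw [this]; rfl)
    obtain ⟨C, hC0, hC⟩ := ih _ hb'
      (fun i => (hbc i).of_isClosed_subset (isClosed_tsupport _) (hts i))
      (fun i => (hts i).trans (hbs i))
    refine ⟨C, hC0, fun i t ht => ?_⟩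
    rw [oscillatory_ibp (hp.isOpen i) (hΨ i) (hp.contDiffOn i) (hb.contDiffOn i) (hpΨ i)
      (fun x hx => (hc.trans_le (hpc i x hx)).ne') (hbc i) (hbs i) ht]
    calc _ ≤ t⁻¹ * (C * t⁻¹ ^ N) := by gcongr; exact hC i t ht
      _ = _ := by ring

end Oscillatory

namespace IsGammaU
variable {Γ : ℝ → ℝ}

lemma strictMonoOn (hΓ : IsGammaU Γ) : StrictMonoOn Γ (Ici 0) :=
  strictMonoOn_of_deriv_pos (convex_Ici 0) hΓ.continuousOn
    (fun x hx => hΓ.deriv_pos x (by simpa using hx))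

lemma pos (hΓ : IsGammaU Γ) {s : ℝ} (hs : 0 < s) : 0 < Γ s := by
  have := hΓ.strictMonoOn (by simp) (show s ∈ Ici 0 from hs.le) hs
  rwa [hΓ.map_zero] at this

lemma contDiffAt (hΓ : IsGammaU Γ) {s : ℝ} (hs : 0 < s) : ContDiffAt ℝ (⊤ : ℕ∞) Γ s :=
  hΓ.smooth.contDiffAt (Ioi_mem_nhds hs)

lemma hasDerivAt (hΓ : IsGammaU Γ) {s : ℝ} (hs : 0 < s) : HasDerivAt Γ (deriv Γ s) s :=
  ((hΓ.contDiffAt hs).differentiableAt (by simp)).hasDerivAt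

lemma exists_deriv_bounds (hΓ : IsGammaU Γ) : ∃ c > 0, ∃ C > 0, ∀ s > 0, c * Γ s ≤ s * deriv Γ s ∧
    s * deriv Γ s ≤ C * Γ s := by
  obtain ⟨c, hc, h1⟩ := hΓ.lower 1 (by simp)
  obtain ⟨C, hC, h2⟩ := hΓ.upper 1 le_rfl
  refine ⟨c, hc, C, hC, fun s hs => ?_⟩
  have hp := hΓ.pos hs
  have hd := hΓ.deriv_pos s hs
  have e : |s ^ 1 * iteratedDeriv 1 Γ s / Γ s| = s * deriv Γ s / Γ s := by
    rw [iteratedDeriv_one, pow_one, abs_of_pos (by positivity)]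
  have h1 := h1 s hs
  have h2 := h2 s hs
  rw [e] at h1 h2
  exact ⟨(le_div_iff₀ hp).1 h1, (div_le_iff₀ hp).1 h2⟩

lemma exists_doubling (hΓ : IsGammaU Γ) : ∃ D : ℝ, 1 ≤ D ∧ ∀ s > 0, Γ (2 * s) ≤ D * Γ s := by
  obtain ⟨c, hc, C, hC, h⟩ := hΓ.exists_deriv_bounds
  have hanti : AntitoneOn (fun s => Γ s * s ^ (-C)) (Ioi 0) := by
    have hd : ∀ s > 0, HasDerivAt (fun s => Γ s * s ^ (-C))
        (deriv Γ s * s ^ (-C) + Γ s * (-C * s ^ (-C - 1))) s := fun s hs =>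
      (hΓ.hasDerivAt hs).mul (Real.hasDerivAt_rpow_const (Or.inl hs.ne'))
    refine antitoneOn_of_deriv_nonpos (convex_Ioi 0)
      (fun s hs => (hd s hs).continuousAt.continuousWithinAt)
      (fun s hs => (hd s (by simpa using hs)).differentiableAt.differentiableWithinAt)
      fun s hs => ?_
    have hs : 0 < s := by simpa using hs
    rw [(hd s hs).deriv]
    have e : s ^ (-C) = s * s ^ (-C - 1) := by
      rw [← Real.rpow_one_add' hs.le (by linarith)]; congr 1; ring
    have : deriv Γ s * s ^ (-C) + Γ s * (-C * s ^ (-C - 1)) =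
        (s * deriv Γ s - C * Γ s) * s ^ (-C - 1) := by rw [e]; ring
    rw [this]
    exact mul_nonpos_of_nonpos_of_nonneg (by linarith [(h s hs).2]) (by positivity)
  refine ⟨2 ^ C, Real.one_le_rpow (by norm_num) hC.le, fun s hs => ?_⟩
  have := hanti (show s ∈ Ioi 0 from hs) (show 2 * s ∈ Ioi 0 from by simpa using hs) (by linarith)
  simp only at this
  rw [Real.mul_rpow (by norm_num) hs.le, ← mul_assoc] at this
  have h2 := le_of_mul_le_mul_right this (Real.rpow_pos_of_pos hs _)
  rw [Real.rpow_neg (by norm_num), ← div_eq_mul_inv, div_le_iff₀ (by positivity)] at h2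
  linarith

lemma exists_growth (hΓ : IsGammaU Γ) : ∃ c > 0, ∀ s > 0, (1 + c) * Γ s ≤ Γ (2 * s) := by
  obtain ⟨c, hc, C, hC, h⟩ := hΓ.exists_deriv_bounds
  refine ⟨c / 2, by positivity, fun s hs => ?_⟩
  have hmv := (convex_Icc s (2 * s)).mul_sub_le_image_sub_of_le_deriv (f := Γ)
    (C := c * Γ s / (2 * s))
    (fun x hx => (hΓ.hasDerivAt (hs.trans_le hx.1)).continuousAt.continuousWithinAt)
    (fun x hx => by
      rw [interior_Icc] at hx
      exact (hΓ.hasDerivAt (hs.trans hx.1)).differentiableAt.differentiableWithinAt)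
    (fun x hx => by
      rw [interior_Icc] at hx
      have hx0 : 0 < x := hs.trans hx.1
      have h1 := (h x hx0).1
      have h2 : Γ s ≤ Γ x := hΓ.strictMonoOn.monotoneOn hs.le hx0.le hx.1.le
      rw [div_le_iff₀ (by positivity)]
      have h3 := hΓ.deriv_pos x hx0
      nlinarith [hx.2])
    s (by constructor <;> linarith) (2 * s) (by constructor <;> linarith) (by linarith)
  have : c * Γ s / (2 * s) * (2 * s - s) = c / 2 * Γ s := by field_simp; ring
  rw [this] at hmv
  linarith

lemma exists_sign (hΓ : IsGammaU Γ) : ∃ σ : ℝ, |σ| = 1 ∧ ∃ c > 0, ∀ s > 0,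
    c * Γ s ≤ σ * (s ^ 2 * iteratedDeriv 2 Γ s) := by
  obtain ⟨c, hc, h⟩ := hΓ.lower 2 (by simp)
  have hcont : ContinuousOn (iteratedDeriv 2 Γ) (Ioi 0) := by
    have := hΓ.smooth.continuousOn_iteratedDerivWithin (m := 2)
      (by norm_cast) (uniqueDiffOn_Ioi 0)
    exact this.congr fun x hx => (iteratedDerivWithin_of_isOpen isOpen_Ioi hx).symm
  have hne : ∀ s > 0, c * Γ s ≤ |s ^ 2 * iteratedDeriv 2 Γ s| := fun s hs => by
    have := h s hs
    rwa [abs_div, abs_of_pos (hΓ.pos hs), le_div_iff₀ (hΓ.pos hs)] at this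
  have hne0 : ∀ s > 0, iteratedDeriv 2 Γ s ≠ 0 := fun s hs h0 => by
    have h1 := hne s hs
    rw [h0, mul_zero, abs_zero] at h1
    nlinarith [hΓ.pos hs]
  have hpc : IsPreconnected (Ioi (0:ℝ)) := isPreconnected_Ioi
  by_cases h1 : 0 < iteratedDeriv 2 Γ 1
  · refine ⟨1, abs_one, c, hc, fun s hs => ?_⟩
    have hpos : 0 < iteratedDeriv 2 Γ s := by
      by_contra hneg
      obtain ⟨x, hx, hx0⟩ := hpc.intermediate_value (show s ∈ Ioi 0 from hs)
        (show (1:ℝ) ∈ Ioi 0 by simp) hcont ⟨not_lt.1 hneg, h1.le⟩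
      exact hne0 x hx hx0
    have := hne s hs
    rw [abs_of_pos (by positivity)] at this
    linarith
  · refine ⟨-1, by simp, c, hc, fun s hs => ?_⟩
    have hpos : iteratedDeriv 2 Γ s < 0 := by
      by_contra hneg
      obtain ⟨x, hx, hx0⟩ := hpc.intermediate_value (show (1:ℝ) ∈ Ioi 0 by simp)
        (show s ∈ Ioi 0 from hs) hcont ⟨not_lt.1 h1, not_lt.1 hneg⟩
      exact hne0 x hx hx0
    have := hne s hs
    rw [abs_of_neg (mul_neg_of_pos_of_neg (by positivity) hpos)] at this
    linarith

lemma kstar_spec (hΓ : IsGammaU Γ) (j : ℤ) : (2 : ℝ) ^ j * Γ ((2 : ℝ) ^ kstar Γ j) ≤ 1 ∧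
    1 < (2 : ℝ) ^ j * Γ ((2 : ℝ) ^ (kstar Γ j + 1)) := by
  obtain ⟨c, hc, hg⟩ := hΓ.exists_growth
  have h2 : (0 : ℝ) < 2 ^ j := by positivity
  have hΓ1 : 0 < Γ 1 := hΓ.pos one_pos
  have hup : ∀ k : ℕ, (1 + c) ^ k * Γ 1 ≤ Γ ((2 : ℝ) ^ (k : ℤ)) := by
    intro k
    induction k with
    | zero => simp
    | succ k ih =>
      have := hg ((2 : ℝ) ^ (k : ℤ)) (by positivity)
      rw [Nat.cast_succ, zpow_add_one₀ (by norm_num), mul_comm ((2:ℝ) ^ (k:ℤ)), pow_succ]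
      nlinarith
  have hdown : ∀ k : ℕ, (1 + c) ^ k * Γ ((2 : ℝ) ^ (-(k : ℤ))) ≤ Γ 1 := by
    intro k
    induction k with
    | zero => simp
    | succ k ih =>
      have := hg ((2 : ℝ) ^ (-((k + 1 : ℕ) : ℤ))) (by positivity)
      have e : (2 : ℝ) * 2 ^ (-((k + 1 : ℕ) : ℤ)) = 2 ^ (-(k : ℤ)) := by
        rw [← zpow_one_add₀ (by norm_num)]; congr 1; push_cast; ring
      rw [e] at this
      have h3 : (0:ℝ) < (1 + c) ^ k := by positivity
      rw [pow_succ]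
      nlinarith
  have hne : {m : ℤ | (2 : ℝ) ^ j * Γ ((2 : ℝ) ^ m) ≤ 1}.Nonempty := by
    obtain ⟨k, hk⟩ := pow_unbounded_of_one_lt ((2 : ℝ) ^ j * Γ 1) (show 1 < 1 + c by linarith)
    refine ⟨-(k : ℤ), ?_⟩
    have h3 : (0:ℝ) < (1 + c) ^ k := by positivity
    have h4 := mul_le_mul_of_nonneg_left (hdown k) h2.le
    have : (1 + c) ^ k * ((2 : ℝ) ^ j * Γ ((2 : ℝ) ^ (-(k : ℤ)))) ≤ (1 + c) ^ k * 1 := by linarith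
    exact le_of_mul_le_mul_left this h3
  have hmono : ∀ a b : ℤ, a ≤ b → (2 : ℝ) ^ j * Γ ((2 : ℝ) ^ a) ≤ (2 : ℝ) ^ j * Γ ((2 : ℝ) ^ b) :=
    fun a b hab => by
      refine mul_le_mul_of_nonneg_left (hΓ.strictMonoOn.monotoneOn ?_ ?_ ?_) h2.le
      · show (0 : ℝ) ≤ _; positivity
      · show (0 : ℝ) ≤ _; positivity
      · exact zpow_le_zpow_right₀ (by norm_num) hab
  have hbdd : BddAbove {m : ℤ | (2 : ℝ) ^ j * Γ ((2 : ℝ) ^ m) ≤ 1} := by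
    obtain ⟨k, hk⟩ := pow_unbounded_of_one_lt (((2 : ℝ) ^ j * Γ 1)⁻¹) (show 1 < 1 + c by linarith)
    refine ⟨k, fun m hm => ?_⟩
    by_contra hlt
    have h3 := hmono k m (not_le.1 hlt).le
    have h4 := mul_le_mul_of_nonneg_left (hup k) h2.le
    rw [inv_lt_iff_one_lt_mul₀ (by positivity)] at hk
    have : (2 : ℝ) ^ j * Γ ((2 : ℝ) ^ m) ≤ 1 := hm
    linarith
  refine ⟨Int.csSup_mem hne hbdd, ?_⟩
  by_contra hle
  have := le_csSup hbdd (show kstar Γ j + 1 ∈ {m : ℤ | (2 : ℝ) ^ j * Γ ((2 : ℝ) ^ m) ≤ 1} from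
    not_lt.1 hle)
  unfold kstar at this
  linarith

/-- The fibres of `j ↦ j_*` are uniformly finite. -/
lemma exists_tsum_kstar_le (hΓ : IsGammaU Γ) : ∃ N : ℕ, ∀ g : ℤ → ℝ≥0∞,
    ∑' j, g (kstar Γ j) ≤ N * ∑' a, g a := by
  obtain ⟨D, hD1, hD⟩ := hΓ.exists_doubling
  obtain ⟨N, hN⟩ := pow_unbounded_of_one_lt D (show (1:ℝ) < 2 by norm_num)
  have hlt : ∀ j j' : ℤ, kstar Γ j = kstar Γ j' → j - j' < N := by
    intro j j' h
    have h1 := (hΓ.kstar_spec j).1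
    have h2 := (hΓ.kstar_spec j').2
    rw [← h, zpow_add_one₀ (by norm_num), mul_comm ((2:ℝ) ^ kstar Γ j)] at h2
    set G := Γ ((2 : ℝ) ^ kstar Γ j)
    have hG : 0 < G := hΓ.pos (by positivity)
    have h3 := hD ((2 : ℝ) ^ kstar Γ j) (by positivity)
    have h5 : (2 : ℝ) ^ j * G < 2 ^ ((N : ℤ) + j') * G := by
      rw [zpow_add₀ (by norm_num), zpow_natCast]
      calc _ ≤ 1 := h1
        _ < (2 : ℝ) ^ j' * Γ (2 * 2 ^ kstar Γ j) := h2
        _ ≤ (2 : ℝ) ^ j' * (D * G) := by gcongr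
        _ ≤ _ := by
          have : (0:ℝ) < 2 ^ j' * G := by positivity
          nlinarith
    have h6 := lt_of_mul_lt_mul_right h5 hG.le
    have := (zpow_lt_zpow_iff_right₀ (show (1:ℝ) < 2 by norm_num)).1 h6
    linarith
  have hN0 : (0 : ℤ) < N := by
    have := hlt 0 0 rfl; simpa using this
  have : NeZero N := ⟨by omega⟩
  refine ⟨N, fun g => ?_⟩
  have hinj : Function.Injective (fun j : ℤ => (kstar Γ j, (j : ZMod N))) := by
    intro j j' h
    simp only [Prod.mk.injEq] at h
    obtain ⟨h1, h2⟩ := h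
    have h3 := (ZMod.intCast_eq_intCast_iff_dvd_sub j j' N).1 h2
    have h4 := hlt j j' h1
    have h5 := hlt j' j h1.symm
    have := Int.eq_zero_of_abs_lt_dvd h3 (by rw [abs_lt]; constructor <;> linarith)
    linarith
  calc ∑' j, g (kstar Γ j) = ∑' j, (fun q : ℤ × ZMod N => g q.1) (kstar Γ j, (j : ZMod N)) := rfl
    _ ≤ ∑' q : ℤ × ZMod N, g q.1 := ENNReal.tsum_comp_le_tsum_of_injective hinj _
    _ = N * ∑' a, g a := by
      rw [ENNReal.tsum_prod']
      simp only
      rw [← ENNReal.tsum_mul_left]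
      congr 1; ext a
      rw [tsum_fintype]
      simp [ZMod.card]

lemma iteratedDeriv_scaled (hΓ : IsGammaU Γ) {R s : ℝ} (hR : 0 < R) (hs : 0 < s) (k : ℕ) :
    iteratedDeriv k (fun s => Γ (R * s) / Γ R) s = R ^ k * iteratedDeriv k Γ (R * s) / Γ R := by
  have h := iteratedDerivWithin_comp_const_smul (n := k) (x := s) (f := Γ) (s := Ioi 0) hs
    (uniqueDiffOn_Ioi 0) (hΓ.smooth.of_le (by exact_mod_cast le_top)) R
    (fun x hx => mul_pos hR hx)
  rw [iteratedDerivWithin_of_isOpen isOpen_Ioi (show R * s ∈ Ioi 0 from mul_pos hR hs),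
    iteratedDerivWithin_of_isOpen isOpen_Ioi (show s ∈ Ioi 0 from hs)] at h
  rw [iteratedDeriv_div_const, h, smul_eq_mul]

/-- The rescaled phases are comparable to `1` on a fixed annulus. -/
lemma exists_scaled_bounds (hΓ : IsGammaU Γ) : ∃ c > 0, ∃ C > 0, ∀ R > 0, ∀ s ∈ Ioo (1/16 : ℝ) 16,
    c ≤ Γ (R * s) / Γ R ∧ Γ (R * s) / Γ R ≤ C := by
  obtain ⟨D, hD1, hD⟩ := hΓ.exists_doubling
  have h16 : ∀ s > 0, Γ (16 * s) ≤ D ^ 4 * Γ s := fun s hs => by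
    have h1 := hD (8 * s) (by positivity)
    have h2 := hD (4 * s) (by positivity)
    have h3 := hD (2 * s) (by positivity)
    have h4 := hD s hs
    have e1 : 2 * (8 * s) = 16 * s := by ring
    have e2 : 2 * (4 * s) = 8 * s := by ring
    have e3 : 2 * (2 * s) = 4 * s := by ring
    rw [e1] at h1; rw [e2] at h2; rw [e3] at h3
    calc _ ≤ D * Γ (8 * s) := h1
      _ ≤ D * (D * (D * (D * Γ s))) := by gcongr; exact h2.trans (by gcongr; exact h3.trans (by gcongr))
      _ = _ := by ring
  have hD0 : 0 < D := by linarith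
  refine ⟨(D ^ 4)⁻¹, by positivity, D ^ 4, by positivity, fun R hR s hs => ⟨?_, ?_⟩⟩
  · rw [le_div_iff₀ (hΓ.pos hR), inv_mul_le_iff₀ (by positivity)]
    refine le_trans ?_ (h16 (R * s) (mul_pos hR (by linarith [hs.1])))
    exact hΓ.strictMonoOn.monotoneOn hR.le (by simp; nlinarith [hs.1]) (by nlinarith [hs.1])
  · rw [div_le_iff₀ (hΓ.pos hR)]
    refine le_trans ?_ (h16 R hR)
    exact hΓ.strictMonoOn.monotoneOn (by simp; nlinarith [hs.1]) (by simp; nlinarith [hs.1])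
      (by nlinarith [hs.2])

lemma unifSmooth_scaled (hΓ : IsGammaU Γ) : UnifSmooth (fun _ : {R : ℝ // 0 < R} => Ioo (1/16 : ℝ) 16)
    (fun R s => Γ (R * s) / Γ R) where
  isOpen _ := isOpen_Ioo
  contDiffOn R := by
    intro s hs
    have hs0 : 0 < s := by linarith [hs.1]
    exact (((hΓ.contDiffAt (mul_pos R.2 hs0)).comp s (contDiffAt_const.mul contDiffAt_id)).div_const
      _).contDiffWithinAt
  bound k := by
    obtain ⟨c, hc, C, hC, h⟩ := hΓ.exists_scaled_bounds
    have hk : ∃ A ≥ 0, ∀ s > 0, |s ^ k * iteratedDeriv k Γ s| ≤ A * Γ s := by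
      rcases Nat.eq_zero_or_pos k with rfl | hk
      · exact ⟨1, by simp, fun s hs => by simp [abs_of_pos (hΓ.pos hs)]⟩
      · obtain ⟨A, hA, h'⟩ := hΓ.upper k hk
        refine ⟨A, hA.le, fun s hs => ?_⟩
        have := h' s hs
        rwa [abs_div, abs_of_pos (hΓ.pos hs), div_le_iff₀ (hΓ.pos hs)] at this
    obtain ⟨A, hA, h'⟩ := hk
    refine ⟨16 ^ k * (A * C), fun R s hs => ?_⟩
    have hs0 : 0 < s := by linarith [hs.1]
    have hR := R.2
    rw [iteratedFDerivWithin_of_isOpen k isOpen_Ioo hs, norm_iteratedFDeriv_eq_norm_iteratedDeriv,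
      hΓ.iteratedDeriv_scaled hR hs0]
    have e : (R : ℝ) ^ k * iteratedDeriv k Γ (R * s) / Γ R =
        (s⁻¹) ^ k * (((R * s) ^ k * iteratedDeriv k Γ (R * s)) / Γ R) := by
      rw [mul_pow, inv_pow]; field_simp
    rw [e, Real.norm_eq_abs, abs_mul, abs_div, abs_of_pos (hΓ.pos hR),
      abs_of_pos (by positivity : 0 < (s⁻¹) ^ k)]
    have h1 : s⁻¹ ≤ 16 := by
      rw [inv_le_comm₀ hs0 (by norm_num)]; linarith [hs.1]
    have h2 := (h R hR s hs).2
    rw [div_le_iff₀ (hΓ.pos hR)] at h2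
    have h3 := h' (R * s) (mul_pos hR hs0)
    have : |(R * s) ^ k * iteratedDeriv k Γ (R * s)| / Γ R ≤ A * C := by
      rw [div_le_iff₀ (hΓ.pos hR)]
      calc _ ≤ A * Γ (R * s) := h3
        _ ≤ A * (C * Γ R) := by gcongr
        _ = _ := by ring
    have hΓR := hΓ.pos hR
    gcongr

/-- Nondegeneracy of the rescaled phases. -/
lemma exists_scaled_lower (hΓ : IsGammaU Γ) : ∃ σ : ℝ, |σ| = 1 ∧ ∃ c > 0, ∀ R > 0, ∀ s ∈ Ioo (1/16 : ℝ) 16,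
    c ≤ deriv (fun s => Γ (R * s) / Γ R) s ∧
    c ≤ σ * deriv (deriv (fun s => Γ (R * s) / Γ R)) s := by
  obtain ⟨c, hc, C, hC, h⟩ := hΓ.exists_scaled_bounds
  obtain ⟨σ, hσ, c2, hc2, h2⟩ := hΓ.exists_sign
  obtain ⟨c1, hc1, C1, hC1, h1⟩ := hΓ.exists_deriv_bounds
  refine ⟨σ, hσ, min (c1 * c / 16) (c2 * c / 16 ^ 2), by positivity, fun R hR s hs => ?_⟩
  have hs0 : 0 < s := by linarith [hs.1]
  have hΓR := hΓ.pos hR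
  have hl := (h R hR s hs).1
  rw [le_div_iff₀ hΓR] at hl
  have hsi : (1:ℝ) / 16 ≤ s⁻¹ := by
    rw [one_div]; exact (inv_le_inv₀ (by norm_num) hs0).2 hs.2.le
  constructor
  · refine (min_le_left _ _).trans ?_
    rw [← iteratedDeriv_one, hΓ.iteratedDeriv_scaled hR hs0, iteratedDeriv_one, pow_one,
      le_div_iff₀ hΓR]
    have h3 := (h1 (R * s) (mul_pos hR hs0)).1
    have e : R * deriv Γ (R * s) = s⁻¹ * (R * s * deriv Γ (R * s)) := by field_simp
    rw [e]
    calc c1 * c / 16 * Γ R = 1/16 * (c1 * (c * Γ R)) := by ring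
      _ ≤ s⁻¹ * (R * s * deriv Γ (R * s)) := by
        have h4 : c1 * (c * Γ R) ≤ c1 * Γ (R * s) := by gcongr
        exact mul_le_mul hsi (h4.trans h3) (by positivity) (by positivity)
  · refine (min_le_right _ _).trans ?_
    have e0 : deriv (deriv (fun s => Γ (R * s) / Γ R)) s =
        iteratedDeriv 2 (fun s => Γ (R * s) / Γ R) s := by
      rw [iteratedDeriv_succ, iteratedDeriv_one]
    rw [e0, hΓ.iteratedDeriv_scaled hR hs0, ← mul_div_assoc, le_div_iff₀ hΓR]
    have h3 := h2 (R * s) (mul_pos hR hs0)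
    have e : σ * (R ^ 2 * iteratedDeriv 2 Γ (R * s)) =
        s⁻¹ ^ 2 * (σ * ((R * s) ^ 2 * iteratedDeriv 2 Γ (R * s))) := by field_simp
    rw [e]
    calc c2 * c / 16 ^ 2 * Γ R = (1/16) ^ 2 * (c2 * (c * Γ R)) := by ring
      _ ≤ s⁻¹ ^ 2 * (σ * ((R * s) ^ 2 * iteratedDeriv 2 Γ (R * s))) := by
        have h4 : c2 * (c * Γ R) ≤ c2 * Γ (R * s) := by gcongr
        exact mul_le_mul (by gcongr) (h4.trans h3) (by positivity) (by positivity)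

end IsGammaU

lemma hasDerivAt_norm_line {E : Type*} [NormedAddCommGroup E] [InnerProductSpace ℝ E] {s w : E}
    {t : ℝ} (h : s + t • w ≠ 0) :
    HasDerivAt (fun τ : ℝ => ‖s + τ • w‖) (inner ℝ (s + t • w) w / ‖s + t • w‖) t := by
  have h1 : HasDerivAt (fun τ : ℝ => s + τ • w) w t := by
    simpa using ((hasDerivAt_id t).smul_const w).const_add s
  have h2 := h1.norm_sq
  have h3 := h2.sqrt (by simpa using h)
  have e : (fun τ : ℝ => √(‖s + τ • w‖ ^ 2)) = fun τ => ‖s + τ • w‖ := by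
    ext τ; rw [Real.sqrt_sq (norm_nonneg _)]
  rw [e, Real.sqrt_sq (norm_nonneg _)] at h3
  convert h3 using 1
  have : ‖s + t • w‖ ≠ 0 := norm_ne_zero_iff.2 h
  field_simp

/-- The derivative of a radial function. -/
lemma fderiv_radial {E : Type*} [NormedAddCommGroup E] [InnerProductSpace ℝ E] {θ : ℝ → ℝ} {y : E}
    (hy : y ≠ 0) (hθ : DifferentiableAt ℝ θ ‖y‖) (w : E) :
    fderiv ℝ (fun x : E => θ ‖x‖) y w = deriv θ ‖y‖ * (inner ℝ y w / ‖y‖) := by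
  have hd : DifferentiableAt ℝ (fun x : E => θ ‖x‖) y :=
    hθ.comp y ((contDiffAt_norm ℝ hy).differentiableAt (n := 1) (by simp))
  have h0 : HasDerivAt (fun τ : ℝ => y + τ • w) w 0 := by
    simpa using ((hasDerivAt_id (0:ℝ)).smul_const w).const_add y
  have h1 : HasDerivAt (fun τ : ℝ => θ ‖y + τ • w‖) (fderiv ℝ (fun x : E => θ ‖x‖) y w) 0 := by
    have h2 : HasFDerivAt (fun x : E => θ ‖x‖) (fderiv ℝ (fun x : E => θ ‖x‖) y)
      (y + (0:ℝ) • w) := by simpa using hd.hasFDerivAt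
    exact h2.comp_hasDerivAt 0 h0
  have h3 := hasDerivAt_norm_line (s := y) (w := w) (t := 0) (by simpa using hy)
  simp only [zero_smul, add_zero] at h3
  have h4 : HasDerivAt θ (deriv θ ‖y‖) ‖y + (0:ℝ) • w‖ := by simpa using hθ.hasDerivAt
  have h5 := h4.comp 0 h3
  exact h1.unique h5

lemma norm_normalize_sub_le {E : Type*} [NormedAddCommGroup E] [InnerProductSpace ℝ E] {y z : E}
    (hy : y ≠ 0) (hz : z ≠ 0) : ‖(‖y‖⁻¹ • y) - (‖z‖⁻¹ • z)‖ ≤ 2 * ‖y - z‖ / ‖z‖ := by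
  have hy' : 0 < ‖y‖ := norm_pos_iff.2 hy
  have hz' : 0 < ‖z‖ := norm_pos_iff.2 hz
  have e : (‖y‖⁻¹ • y) - (‖z‖⁻¹ • z) = ((‖z‖ - ‖y‖) * (‖y‖⁻¹ * ‖z‖⁻¹)) • y + ‖z‖⁻¹ • (y - z) := by
    have : (‖z‖ - ‖y‖) * (‖y‖⁻¹ * ‖z‖⁻¹) = ‖y‖⁻¹ - ‖z‖⁻¹ := by field_simp
    rw [this, smul_sub, sub_smul]; abel
  rw [e]
  refine (norm_add_le _ _).trans ?_
  rw [norm_smul, norm_smul, norm_mul, norm_mul, norm_inv, norm_inv, norm_norm, norm_norm]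
  have h1 : ‖‖z‖ - ‖y‖‖ ≤ ‖y - z‖ := by
    rw [norm_sub_rev]; exact abs_norm_sub_norm_le y z
  have : ‖‖z‖ - ‖y‖‖ * (‖y‖⁻¹ * ‖z‖⁻¹) * ‖y‖ = ‖‖z‖ - ‖y‖‖ / ‖z‖ := by field_simp
  rw [this]
  have h2 : ‖‖z‖ - ‖y‖‖ / ‖z‖ ≤ ‖y - z‖ / ‖z‖ := by gcongr
  calc _ ≤ ‖y - z‖ / ‖z‖ + ‖z‖⁻¹ * ‖y - z‖ := by gcongr
    _ = _ := by field_simp; ring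

/-- The direction, adapted to the sign of `θ''`, in which the phase difference is monotone. -/
def twist {E : Type*} [NormedAddCommGroup E] [InnerProductSpace ℝ E] (σ : ℝ) (e w : E) : E :=
  (σ * inner ℝ e w) • e + (w - (inner ℝ e w : ℝ) • e)

section twist
variable {E : Type*} [NormedAddCommGroup E] [InnerProductSpace ℝ E] {σ : ℝ} {e w : E}

lemma inner_twist (he : ‖e‖ = 1) : inner ℝ e (twist σ e w) = σ * inner ℝ e w := by
  rw [twist, inner_add_right, inner_sub_right, real_inner_smul_right, real_inner_smul_right,
    real_inner_self_eq_norm_sq, he]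
  ring

lemma inner_twist_self (hw : ‖w‖ = 1) :
    inner ℝ (twist σ e w) w = σ * (inner ℝ e w) ^ 2 + (1 - (inner ℝ e w) ^ 2) := by
  rw [twist, inner_add_left, inner_sub_left, real_inner_smul_left, real_inner_smul_left,
    real_inner_self_eq_norm_sq, hw]
  ring

lemma norm_twist (hσ : |σ| = 1) (he : ‖e‖ = 1) (hw : ‖w‖ = 1) : ‖twist σ e w‖ = 1 := by
  have hσ2 : σ ^ 2 = 1 := by rw [← sq_abs, hσ]; norm_num
  have : ‖twist σ e w‖ ^ 2 = 1 := by
    rw [← real_inner_self_eq_norm_sq]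
    nth_rw 2 [twist]
    rw [inner_add_right, inner_sub_right, real_inner_smul_right, real_inner_smul_right,
      real_inner_comm e (twist σ e w), inner_twist he, inner_twist_self hw]
    linear_combination (inner ℝ e w) ^ 2 * hσ2
  exact (sq_eq_sq₀ (norm_nonneg _) (by norm_num)).1 (by rw [this]; norm_num)

lemma hessian_lower {A B M c : ℝ} (hσ : |σ| = 1) (he : ‖e‖ = 1) (hw : ‖w‖ = 1)
    (hA : c ≤ σ * A) (hB : c ≤ B) (hAM : |A| ≤ M) (hBM : |B| ≤ M) {y : E} (hy : ‖y‖ = 1)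
    (hye : 4 * M * ‖y - e‖ ≤ c / 2) :
    c / 2 ≤ A * (inner ℝ y (twist σ e w) * inner ℝ y w) +
      B * (inner ℝ (twist σ e w) w - inner ℝ y (twist σ e w) * inner ℝ y w) := by
  set v := twist σ e w with hv
  have hvn : ‖v‖ = 1 := norm_twist hσ he hw
  have h1 : |inner ℝ y v * inner ℝ y w - inner ℝ e v * inner ℝ e w| ≤ 2 * ‖y - e‖ := by
    have e1 : inner ℝ y v * inner ℝ y w - inner ℝ e v * inner ℝ e w =
      inner ℝ (y - e) v * inner ℝ y w + inner ℝ e v * inner ℝ (y - e) w := by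
      rw [inner_sub_left, inner_sub_left]; ring
    rw [e1]
    refine (abs_add_le _ _).trans ?_
    rw [abs_mul, abs_mul]
    have a1 := abs_real_inner_le_norm (y - e) v
    have a2 := abs_real_inner_le_norm y w
    have a3 := abs_real_inner_le_norm e v
    have a4 := abs_real_inner_le_norm (y - e) w
    rw [hvn] at a1 a3; rw [hw] at a2 a4; rw [hy] at a2; rw [he] at a3
    have := mul_le_mul a1 a2 (abs_nonneg _) (by positivity)
    have := mul_le_mul a3 a4 (abs_nonneg _) (by positivity)
    linarith
  have hle : (inner ℝ e w : ℝ) ^ 2 ≤ 1 := by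
    have := abs_real_inner_le_norm e w
    rw [he, hw] at this
    rw [← sq_abs]
    exact pow_le_one₀ (abs_nonneg _) (by linarith)
  have hmain : c ≤ A * (inner ℝ e v * inner ℝ e w) +
      B * (inner ℝ v w - inner ℝ e v * inner ℝ e w) := by
    rw [hv, inner_twist he, inner_twist_self hw]
    have : A * (σ * inner ℝ e w * inner ℝ e w) + B * (σ * (inner ℝ e w) ^ 2 +
      (1 - (inner ℝ e w) ^ 2) - σ * inner ℝ e w * inner ℝ e w) =
      (σ * A) * (inner ℝ e w) ^ 2 + B * (1 - (inner ℝ e w) ^ 2) := by ring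
    rw [this]
    nlinarith [sq_nonneg (inner ℝ e w : ℝ)]
  set X := inner ℝ y v * inner ℝ y w
  set Y := inner ℝ e v * inner ℝ e w
  have h2 : |(A - B) * (X - Y)| ≤ 2 * M * (2 * ‖y - e‖) := by
    rw [abs_mul]
    refine mul_le_mul ?_ h1 (abs_nonneg _) ?_
    · exact (abs_sub _ _).trans (by linarith)
    · linarith [abs_nonneg A]
  have h3 := neg_le_of_abs_le h2
  nlinarith

end twist

namespace IsGammaU
variable {Γ : ℝ → ℝ}

lemma exists_scaled_upper (hΓ : IsGammaU Γ) : ∃ M > 0, ∀ R > 0, ∀ s ∈ Ioo (1/16 : ℝ) 16,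
    |deriv (fun s => Γ (R * s) / Γ R) s| ≤ M ∧
    |deriv (deriv (fun s => Γ (R * s) / Γ R)) s| ≤ M := by
  obtain ⟨M, hM1, hM⟩ := hΓ.unifSmooth_scaled.bound_le 2
  refine ⟨M, by linarith, fun R hR s hs => ⟨?_, ?_⟩⟩
  · have := hM 1 (by norm_num) ⟨R, hR⟩ s hs
    rw [iteratedFDerivWithin_of_isOpen 1 isOpen_Ioo hs, norm_iteratedFDeriv_eq_norm_iteratedDeriv,
      iteratedDeriv_one] at this
    exact this
  · have := hM 2 le_rfl ⟨R, hR⟩ s hs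
    rw [iteratedFDerivWithin_of_isOpen 2 isOpen_Ioo hs, norm_iteratedFDeriv_eq_norm_iteratedDeriv,
      iteratedDeriv_succ, iteratedDeriv_one] at this
    exact this

lemma contDiffAt_scaled (hΓ : IsGammaU Γ) {R s : ℝ} (hR : 0 < R) (hs : 0 < s) :
    ContDiffAt ℝ (⊤ : ℕ∞) (fun s => Γ (R * s) / Γ R) s :=
  ((hΓ.contDiffAt (mul_pos hR hs)).comp s (contDiffAt_const.mul contDiffAt_id)).div_const _

/-- Lower bound for the differences of directional derivatives of the rescaled radial phase. -/
lemma exists_diff_lower (hΓ : IsGammaU Γ) {n : ℕ} : ∃ σ : ℝ, |σ| = 1 ∧ ∃ c > 0, ∃ δ₀ > 0, δ₀ ≤ 1/16 ∧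
    ∀ z : Rn n, ‖z‖ ∈ Icc (1/2:ℝ) 2 → ∀ R > 0, ∀ s h : Rn n, h ≠ 0 →
      (∀ y ∈ segment ℝ s (s + h), ‖y - z‖ ≤ δ₀) →
      c ≤ ‖h‖⁻¹ * (fderiv ℝ (fun y : Rn n => Γ (R * ‖y‖) / Γ R) (s + h)
          (twist σ (‖z‖⁻¹ • z) (‖h‖⁻¹ • h)) -
        fderiv ℝ (fun y : Rn n => Γ (R * ‖y‖) / Γ R) s (twist σ (‖z‖⁻¹ • z) (‖h‖⁻¹ • h))) := by
  obtain ⟨σ, hσ, c, hc, hl⟩ := hΓ.exists_scaled_lower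
  obtain ⟨M, hM, hu⟩ := hΓ.exists_scaled_upper
  refine ⟨σ, hσ, (c / 16) / 2, by positivity, min (1/16) (c / (16 * (16 * (16 * 16 * M)))),
    by positivity, min_le_left _ _, fun z hz R hR s h hh hseg => ?_⟩
  set θ : ℝ → ℝ := fun s => Γ (R * s) / Γ R with hθ
  have hz0 : z ≠ 0 := norm_pos_iff.1 (by linarith [hz.1])
  set e := ‖z‖⁻¹ • z with he
  set w := ‖h‖⁻¹ • h with hw
  have hh' : 0 < ‖h‖ := norm_pos_iff.2 hh
  have hen : ‖e‖ = 1 := by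
    rw [he, norm_smul, norm_inv, norm_norm, inv_mul_cancel₀ (norm_ne_zero_iff.2 hz0)]
  have hwn : ‖w‖ = 1 := by
    rw [hw, norm_smul, norm_inv, norm_norm, inv_mul_cancel₀ hh'.ne']
  set v := twist σ e w with hv
  have hline : ∀ τ ∈ Icc (0:ℝ) ‖h‖, ‖(s + τ • w) - z‖ ≤ min (1/16) (c / (16 * (16 * (16 * 16 * M)))) := by
    intro τ hτ
    apply hseg
    rw [segment_eq_image']
    refine ⟨τ / ‖h‖, ⟨by have := hτ.1; positivity, (div_le_one hh').2 hτ.2⟩, ?_⟩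
    simp only [add_sub_cancel_left, hw, smul_smul, div_eq_mul_inv]
  have hann : ∀ y : Rn n, ‖y - z‖ ≤ min (1/16) (c / (16 * (16 * (16 * 16 * M)))) →
      ‖y‖ ∈ Ioo (1/4:ℝ) 4 := by
    intro y hy
    have h1 := (hy.trans (min_le_left _ _))
    have h2 := abs_norm_sub_norm_le y z
    rw [abs_le] at h2
    constructor <;> linarith [hz.1, hz.2]
  have hann' : ∀ τ ∈ Icc (0:ℝ) ‖h‖, ‖s + τ • w‖ ∈ Ioo (1/4:ℝ) 4 := fun τ hτ => hann _ (hline τ hτ)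
  set Q : ℝ → ℝ := fun τ => deriv θ ‖s + τ • w‖ * (inner ℝ (s + τ • w) v / ‖s + τ • w‖) with hQ
  have hsmooth : ∀ r > 0, ContDiffAt ℝ (⊤ : ℕ∞) θ r := fun r hr => hΓ.contDiffAt_scaled hR hr
  have hQf : ∀ τ ∈ Icc (0:ℝ) ‖h‖, fderiv ℝ (fun y : Rn n => Γ (R * ‖y‖) / Γ R) (s + τ • w) v = Q τ := by
    intro τ hτ
    have h1 := hann' τ hτ
    exact fderiv_radial (θ := θ) (norm_pos_iff.1 (by linarith [h1.1]))
      ((hsmooth _ (by linarith [h1.1])).differentiableAt (by simp)) v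
  have hQd : ∀ τ ∈ Icc (0:ℝ) ‖h‖, ∃ q ≥ (c / 16) / 2, HasDerivAt Q q τ := by
    intro τ hτ
    have h1 := hann' τ hτ
    set y := s + τ • w with hy
    have hy0 : 0 < ‖y‖ := by linarith [h1.1]
    have hyne : y ≠ 0 := norm_pos_iff.1 hy0
    have hd1 : HasDerivAt (fun τ : ℝ => ‖s + τ • w‖) (inner ℝ y w / ‖y‖) τ := hasDerivAt_norm_line hyne
    have hdθ : HasDerivAt (deriv θ) (deriv (deriv θ) ‖y‖) ‖s + τ • w‖ := by
      have h1 : ContDiffOn ℝ (⊤ : ℕ∞) θ (Ioi 0) := fun r hr => (hsmooth r hr).contDiffWithinAt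
      have h2 : ContDiffOn ℝ 1 (deriv θ) (Ioi 0) :=
        h1.deriv_of_isOpen isOpen_Ioi (by norm_cast)
      exact ((h2.contDiffAt (Ioi_mem_nhds hy0)).differentiableAt (by simp)).hasDerivAt
    have hd2 := hdθ.comp τ hd1
    have hd3 : HasDerivAt (fun τ : ℝ => inner ℝ (s + τ • w) v) (inner ℝ w v) τ := by
      have h1 : HasDerivAt (fun τ : ℝ => s + τ • w) w τ := by
        simpa using ((hasDerivAt_id τ).smul_const w).const_add s
      simpa using h1.inner ℝ (hasDerivAt_const τ v)
    have hd4 := hd2.mul (hd3.div hd1 hy0.ne')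
    refine ⟨_, ?_, hd4⟩
    have hy16 : ‖y‖ ∈ Ioo (1/16:ℝ) 16 := ⟨by linarith [h1.1], by linarith [h1.2]⟩
    obtain ⟨l1, l2⟩ := hl R hR _ hy16
    obtain ⟨u1, u2⟩ := hu R hR _ hy16
    rw [← hθ] at l1 l2 u1 u2
    have hyi : ‖y‖⁻¹ ≤ 16 := by rw [inv_le_comm₀ hy0 (by norm_num)]; linarith [h1.1]
    have hyi' : (1:ℝ)/16 ≤ ‖y‖⁻¹ := by rw [le_inv_comm₀ (by norm_num) hy0]; norm_num; linarith [h1.2]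
    have key := hessian_lower (A := deriv (deriv θ) ‖y‖) (B := deriv θ ‖y‖ / ‖y‖) (M := 16 * M)
      (c := c / 16) (y := ‖y‖⁻¹ • y) hσ hen hwn (by linarith) (by
        rw [div_eq_mul_inv (deriv θ ‖y‖)]
        have : c * (1/16) ≤ deriv θ ‖y‖ * ‖y‖⁻¹ :=
          mul_le_mul l1 hyi' (by norm_num) (hc.le.trans l1)
        linarith) (by linarith) (by
        rw [abs_div, abs_norm, div_eq_mul_inv]
        have : |deriv θ ‖y‖| * ‖y‖⁻¹ ≤ M * 16 := by gcongr
        linarith) (by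
        rw [norm_smul, norm_inv, norm_norm, inv_mul_cancel₀ hy0.ne']) (by
        have h2 := norm_normalize_sub_le hyne hz0
        have h3 : 2 * ‖y - z‖ / ‖z‖ ≤ 4 * ‖y - z‖ := by
          rw [div_le_iff₀ (by linarith [hz.1])]
          nlinarith [hz.1, norm_nonneg (y - z)]
        have h4 : ‖y - z‖ ≤ c / (16 * (16 * (16 * 16 * M))) := (hline τ hτ).trans (min_le_right _ _)
        rw [le_div_iff₀ (by positivity)] at h4
        have : 4 * (16 * M) * ‖‖y‖⁻¹ • y - e‖ ≤ 4 * (16 * M) * (4 * ‖y - z‖) := by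
          gcongr; exact h2.trans h3
        nlinarith [mul_nonneg hM.le (norm_nonneg (y - z))])
    refine key.trans (le_of_eq ?_)
    rw [real_inner_smul_left, real_inner_smul_left, ← hv, ← real_inner_comm v w]
    simp only [Function.comp, Pi.div_apply, ← hy]
    generalize (inner ℝ y v : ℝ) = X
    generalize (inner ℝ y w : ℝ) = Y
    generalize (inner ℝ w v : ℝ) = Z
    generalize deriv (deriv θ) ‖y‖ = A
    generalize deriv θ ‖y‖ = B
    field_simp
  have hmv := (convex_Icc 0 ‖h‖).mul_sub_le_image_sub_of_le_deriv (f := Q) (C := (c / 16) / 2)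
    (fun x hx => by
      obtain ⟨q, _, hq⟩ := hQd x hx
      exact hq.continuousAt.continuousWithinAt)
    (fun x hx => by
      obtain ⟨q, _, hq⟩ := hQd x (interior_subset hx)
      exact hq.differentiableAt.differentiableWithinAt)
    (fun x hx => by
      obtain ⟨q, hq', hq⟩ := hQd x (interior_subset hx)
      rw [hq.deriv]; exact hq')
    0 (left_mem_Icc.2 hh'.le) ‖h‖ (right_mem_Icc.2 hh'.le) hh'.le
  rw [← hQf 0 (left_mem_Icc.2 hh'.le), ← hQf ‖h‖ (right_mem_Icc.2 hh'.le), zero_smul, add_zero,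
    hw, smul_smul, mul_inv_cancel₀ hh'.ne', one_smul, sub_zero] at hmv
  rw [inv_mul_eq_div, le_div_iff₀ hh']
  exact hmv

end IsGammaU

/-- The oscillatory kernel `e^{iΛΓ(R|s|)/Γ(R)} η(s)`. -/
def oscKernel {n : ℕ} (Γ : ℝ → ℝ) (η : Rn n → ℝ) (R Λ : ℝ) (s : Rn n) : ℂ :=
  Complex.exp (Complex.I * ((Λ * (Γ (R * ‖s‖) / Γ R) : ℝ) : ℂ)) * (η s : ℂ)

lemma norm_oscKernel {n : ℕ} (Γ : ℝ → ℝ) (η : Rn n → ℝ) (R Λ : ℝ) (s : Rn n) :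
    ‖oscKernel Γ η R Λ s‖ = |η s| := by
  rw [oscKernel, norm_mul, mul_comm Complex.I, Complex.norm_exp_ofReal_mul_I, one_mul,
    Complex.norm_real, Real.norm_eq_abs]

namespace IsGammaU
variable {Γ : ℝ → ℝ}

/-- Rapid decay of the autocorrelation of an oscillatory kernel with localized amplitude. -/
lemma exists_autocorr_decay (hΓ : IsGammaU Γ) {n : ℕ} : ∃ δ > 0, ∀ z : Rn n, ‖z‖ ∈ Icc (1/2:ℝ) 2 →
    ∀ η : Rn n → ℝ, ContDiff ℝ (⊤ : ℕ∞) η → tsupport η ⊆ Metric.closedBall z δ → ∀ N : ℕ,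
    ∃ C : ℝ, 0 ≤ C ∧ ∀ R > 0, ∀ Λ > 0, ∀ h : Rn n, h ≠ 0 →
      ‖∫ s, oscKernel Γ η R Λ (s + h) * (starRingEnd ℂ) (oscKernel Γ η R Λ s)‖ ≤
        C * (Λ * ‖h‖)⁻¹ ^ N := by
  obtain ⟨σ, hσ, c, hc, δ₀, hδ0, hδ16, hlow⟩ := hΓ.exists_diff_lower (n := n)
  refine ⟨δ₀ / 8, by positivity, fun z hz η hη hηs N => ?_⟩
  set δ := δ₀ / 8 with hδ
  have hδpos : 0 < δ := by positivity
  have hηc : HasCompactSupport η := (isCompact_closedBall z δ).of_isClosed_subset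
    (isClosed_tsupport η) hηs
  let ι := {q : {R : ℝ // 0 < R} × Rn n // q.2 ≠ 0 ∧ ‖q.2‖ ≤ 2 * δ}
  let U : ι → Set (Rn n) := fun _ => Metric.ball z (2 * δ)
  have hnorm : UnifSmooth (fun _ : ι => Metric.ball z (4 * δ)) (fun _ => fun x : Rn n => ‖x‖) := by
    have hsub : Metric.closedBall z (4 * δ) ⊆ {x : Rn n | x ≠ 0} := by
      intro x hx h0
      rw [h0, mem_closedBall_iff_norm, zero_sub, norm_neg] at hx
      linarith [hz.1]
    refine UnifSmooth.of_compact (W := {x : Rn n | x ≠ 0}) (K := Metric.closedBall z (4 * δ))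
      isOpen_ne (fun x hx => (contDiffAt_norm ℝ hx).contDiffWithinAt)
      (isCompact_closedBall _ _) hsub (fun _ => Metric.isOpen_ball)
      (fun _ => Metric.ball_subset_closedBall)
  have hφ : UnifSmooth (fun _ : ι => Metric.ball z (4 * δ))
      (fun i => fun x : Rn n => Γ ((i.1.1 : ℝ) * ‖x‖) / Γ (i.1.1 : ℝ)) := by
    refine UnifSmooth.comp (hΓ.unifSmooth_scaled.reindex (fun i : ι => i.1.1)) hnorm ?_
    intro i x hx
    have h1 := mem_ball_iff_norm.1 hx
    have h2 := abs_norm_sub_norm_le x z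
    rw [abs_le] at h2
    constructor <;> linarith [hz.1, hz.2]
  let v : ι → Rn n := fun i => twist σ (‖z‖⁻¹ • z) (‖i.1.2‖⁻¹ • i.1.2)
  have hz0 : ‖z‖ ≠ 0 := by linarith [hz.1]
  have hv : ∀ i, ‖v i‖ ≤ 1 := fun i => (norm_twist hσ
    (by rw [norm_smul, norm_inv, norm_norm, inv_mul_cancel₀ hz0])
    (by rw [norm_smul, norm_inv, norm_norm, inv_mul_cancel₀ (norm_ne_zero_iff.2 i.2.1)])).le
  have hseg : ∀ i : ι, ∀ x ∈ Metric.ball z (2 * δ),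
      segment ℝ x (x + i.1.2) ⊆ Metric.ball z (4 * δ) := by
    intro i x hx
    refine (convex_ball z (4 * δ)).segment_subset (Metric.ball_subset_ball (by linarith) hx) ?_
    rw [mem_ball_iff_norm] at hx ⊢
    have : x + i.1.2 - z = (x - z) + i.1.2 := by abel
    rw [this]
    exact (norm_add_le _ _).trans_lt (by linarith [i.2.2])
  have hΨ := hφ.diffQuot (V := U) (fun _ => Metric.isOpen_ball) (fun i => i.2.1) hseg
  have hp := (hφ.fderiv_apply hv).diffQuot (V := U) (fun _ => Metric.isOpen_ball)
    (fun i => i.2.1) hseg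
  have hηx : ∀ x, η x ≠ 0 → x ∈ Metric.closedBall z δ := fun x hx => hηs (subset_tsupport η hx)
  have hb1 : UnifSmooth U (fun _ => fun s => (η s : ℂ)) :=
    UnifSmooth.of_compact isOpen_univ (Complex.ofRealCLM.contDiff.comp hη).contDiffOn
      (isCompact_closedBall z (2 * δ)) (subset_univ _) (fun _ => Metric.isOpen_ball)
      (fun _ => Metric.ball_subset_closedBall)
  have htr : UnifSmooth U (fun i => fun s : Rn n => s + i.1.2) := by
    refine UnifSmooth.add (UnifSmooth.of_compact isOpen_univ contDiff_id.contDiffOn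
      (isCompact_closedBall z (2 * δ)) (subset_univ _) (fun _ => Metric.isOpen_ball)
      (fun _ => Metric.ball_subset_closedBall))
      (UnifSmooth.const (fun _ => Metric.isOpen_ball) (fun i => i.2.2))
  have hb2 : UnifSmooth U (fun i => fun s => η (s + i.1.2)) := by
    refine UnifSmooth.comp (V := fun _ => Metric.ball z (4 * δ)) (g := fun _ => η)
      (UnifSmooth.of_compact isOpen_univ hη.contDiffOn
      (isCompact_closedBall z (4 * δ)) (subset_univ _) (fun _ => Metric.isOpen_ball)
      (fun _ => Metric.ball_subset_closedBall)) htr ?_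
    intro i x hx
    exact hseg i x hx (right_mem_segment ℝ _ _)
  have hb := hb2.smul hb1
  have hbsupp : ∀ i : ι, tsupport (fun s => η (s + i.1.2) • (η s : ℂ)) ⊆ Metric.closedBall z δ := by
    intro i
    refine closure_minimal (fun x hx => hηx x fun h0 => hx ?_) Metric.isClosed_closedBall
    simp [h0]
  obtain ⟨C, hC0, hC⟩ := oscillatory_bound (μ := volume) hv hΨ.contDiffOn hp (by
      intro i x hx
      have hd : ∀ y ∈ Metric.ball z (4 * δ), DifferentiableAt ℝ
          (fun x : Rn n => Γ ((i.1.1 : ℝ) * ‖x‖) / Γ (i.1.1 : ℝ)) y := fun y hy =>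
        ((hφ.contDiffOn i).contDiffAt (Metric.isOpen_ball.mem_nhds hy)).differentiableAt (by simp)
      have d1 := hd x (hseg i x hx (left_mem_segment ℝ _ _))
      have d2 := hd _ (hseg i x hx (right_mem_segment ℝ _ _))
      have d3 : HasFDerivAt (fun x : Rn n => Γ ((i.1.1 : ℝ) * ‖x + i.1.2‖) / Γ (i.1.1 : ℝ))
          (fderiv ℝ (fun x : Rn n => Γ ((i.1.1 : ℝ) * ‖x‖) / Γ (i.1.1 : ℝ)) (x + i.1.2)) x := by
        exact (hasFDerivAt_comp_add_right i.1.2).2 d2.hasFDerivAt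
      have d4 := (d3.sub d1.hasFDerivAt).const_smul ‖i.1.2‖⁻¹
      have := d4.fderiv
      exact (congrArg (fun L : Rn n →L[ℝ] ℝ => L (v i)) this)) hc (by
      intro i x hx
      refine hlow z hz _ i.1.1.2 x i.1.2 i.2.1 fun y hy => ?_
      have := mem_ball_iff_norm.1 (hseg i x hx hy)
      linarith) (Vol := volume.real (Metric.ball z (2 * δ))) (fun i => le_rfl) (fun i => measure_ball_lt_top) N _ hb
      (fun i => (isCompact_closedBall z δ).of_isClosed_subset (isClosed_tsupport _) (hbsupp i))
      (fun i => (hbsupp i).trans (Metric.closedBall_subset_ball (by linarith)))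
  refine ⟨C, hC0, fun R hR Λ hΛ h hh => ?_⟩
  have hh' : 0 < ‖h‖ := norm_pos_iff.2 hh
  by_cases hle : ‖h‖ ≤ 2 * δ
  · have := hC ⟨⟨⟨R, hR⟩, h⟩, hh, hle⟩ (Λ * ‖h‖) (by positivity)
    refine le_trans (le_of_eq ?_) this
    congr 2
    ext s
    simp only [oscKernel, map_mul, ← Complex.exp_conj, Complex.conj_I, Complex.conj_ofReal,
      smul_eq_mul]
    rw [show ∀ a b c d : ℂ, a * b * (c * d) = (a * c) * (b * d) by intros; ring, ← Complex.exp_add,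
      Complex.real_smul]
    congr 2
    push_cast
    have : (‖h‖ : ℂ) ≠ 0 := by exact_mod_cast hh'.ne'
    field_simp
    ring
  · have hzero : ∀ s, oscKernel Γ η R Λ (s + h) * (starRingEnd ℂ) (oscKernel Γ η R Λ s) = 0 := by
      intro s
      by_contra hne
      have h1 : η (s + h) ≠ 0 := fun h0 => hne (by simp [oscKernel, h0])
      have h2 : η s ≠ 0 := fun h0 => hne (by simp [oscKernel, h0])
      have h3 := mem_closedBall_iff_norm.1 (hηx _ h1)
      have h4 := mem_closedBall_iff_norm.1 (hηx _ h2)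
      apply hle
      have : h = (s + h - z) - (s - z) := by abel
      rw [this]
      exact (norm_sub_le _ _).trans (by linarith)
    simp only [hzero, integral_zero, norm_zero]
    positivity

end IsGammaU

section
variable {n : ℕ}

/-- Scaling in lower Lebesgue integrals. -/
lemma lintegral_smul_arg (g : Rn n → ℝ≥0∞) (hg : Measurable g) {Λ : ℝ} (hΛ : 0 < Λ) :
    ∫⁻ x, g (Λ • x) = ENNReal.ofReal (Λ⁻¹ ^ n) * ∫⁻ x, g x := by
  have h := Measure.map_addHaar_smul (volume : Measure (Rn n)) hΛ.ne'
  have h2 : ∫⁻ x, g (Λ • x) = ∫⁻ x, g x ∂(Measure.map (Λ • ·) volume) :=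
    (lintegral_map hg (measurable_const_smul Λ)).symm
  rw [h2, h, lintegral_smul_measure, finrank_euclideanSpace, Fintype.card_fin,
    abs_of_pos (by positivity), inv_pow, smul_eq_mul]

lemma lintegral_bracket_scaled {Λ : ℝ} (hΛ : 0 < Λ) :
    ∫⁻ h : Rn n, ENNReal.ofReal ((1 + Λ * ‖h‖)⁻¹ ^ (n + 1)) =
      ENNReal.ofReal (Λ⁻¹ ^ n) * ∫⁻ h : Rn n, ENNReal.ofReal ((1 + ‖h‖)⁻¹ ^ (n + 1)) := by
  rw [← lintegral_smul_arg _ (by fun_prop) hΛ]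
  simp_rw [norm_smul, Real.norm_eq_abs, abs_of_pos hΛ]

lemma lintegral_bracket_lt_top :
    ∫⁻ h : Rn n, ENNReal.ofReal ((1 + ‖h‖)⁻¹ ^ (n + 1)) < ∞ := by
  have := finite_integral_one_add_norm (E := Rn n) (μ := volume) (r := n + 1) (by simp)
  refine lt_of_le_of_lt (le_of_eq ?_) this
  congr 1; ext h
  rw [Real.rpow_neg (by positivity), inv_pow]
  norm_cast

end

section
variable {n : ℕ}

lemma IsGammaU.continuous_comp_norm {Γ : ℝ → ℝ} (hΓ : IsGammaU Γ) {R : ℝ} (hR : 0 ≤ R) :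
    Continuous fun s : Rn n => Γ (R * ‖s‖) :=
  hΓ.continuousOn.comp_continuous (by fun_prop) fun s => mul_nonneg hR (norm_nonneg s)

lemma IsGammaU.continuous_oscKernel {Γ : ℝ → ℝ} (hΓ : IsGammaU Γ) {η : Rn n → ℝ}
    (hη : Continuous η) {R : ℝ} (hR : 0 ≤ R) (Λ : ℝ) : Continuous (oscKernel Γ η R Λ) := by
  have := hΓ.continuous_comp_norm (n := n) hR
  exact (Complex.continuous_exp.comp (continuous_const.mul (Complex.continuous_ofReal.comp
    (continuous_const.mul (this.div_const _))))).mul (Complex.continuous_ofReal.comp hη)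

/-- The amplitude `η` is admissible for the `L²` bound of oscillatory convolutions. -/
def HasOscBound (Γ : ℝ → ℝ) (η : Rn n → ℝ) : Prop :=
  Continuous η ∧ (∃ M : ℝ, ∀ x, |η x| ≤ M) ∧ ∃ C : ℝ≥0, ∀ R > 0, ∀ Λ > 0, ∀ a : Rn n → ℂ,
    Measurable a → Integrable a →
      ∫⁻ x, ‖cv a (oscKernel Γ η R Λ) x‖ₑ ^ 2 ≤
        C * ENNReal.ofReal (Λ⁻¹ ^ n) * ∫⁻ x, ‖a x‖ₑ ^ 2

lemma integrable_cv_integrand {a κ : Rn n → ℂ} (ha : Integrable a) (hκ : Measurable κ) {M : ℝ}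
    (hM : ∀ x, ‖κ x‖ ≤ M) (x : Rn n) : Integrable fun t => a (x - t) * κ t :=
  (ha.comp_sub_left x).mul_bdd hκ.aestronglyMeasurable (ae_of_all _ hM)

lemma enorm_add_sq_le (z w : ℂ) : ‖z + w‖ₑ ^ 2 ≤ 2 * ‖z‖ₑ ^ 2 + 2 * ‖w‖ₑ ^ 2 := by
  have h1 : ‖z + w‖ ^ 2 ≤ 2 * ‖z‖ ^ 2 + 2 * ‖w‖ ^ 2 := by
    have := norm_add_le z w
    nlinarith [sq_nonneg (‖z‖ - ‖w‖), norm_nonneg (z + w)]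
  simp only [← ofReal_norm]
  rw [← ENNReal.ofReal_pow (norm_nonneg _), ← ENNReal.ofReal_pow (norm_nonneg _),
    ← ENNReal.ofReal_pow (norm_nonneg _), show (2:ℝ≥0∞) = ENNReal.ofReal 2 by simp,
    ← ENNReal.ofReal_mul (by norm_num), ← ENNReal.ofReal_mul (by norm_num),
    ← ENNReal.ofReal_add (by positivity) (by positivity)]
  exact ENNReal.ofReal_le_ofReal h1

lemma HasOscBound.add {Γ : ℝ → ℝ} (hΓ : IsGammaU Γ) {η₁ η₂ : Rn n → ℝ} (h₁ : HasOscBound Γ η₁)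
    (h₂ : HasOscBound Γ η₂) : HasOscBound Γ (fun x => η₁ x + η₂ x) := by
  obtain ⟨c1, ⟨M1, hM1⟩, C1, hC1⟩ := h₁
  obtain ⟨c2, ⟨M2, hM2⟩, C2, hC2⟩ := h₂
  refine ⟨c1.add c2, ⟨M1 + M2, fun x => (abs_add_le _ _).trans (add_le_add (hM1 x) (hM2 x))⟩,
    2 * C1 + 2 * C2, fun R hR Λ hΛ a ha hai => ?_⟩
  have m1 := (hΓ.continuous_oscKernel c1 hR.le Λ).measurable
  have m2 := (hΓ.continuous_oscKernel c2 hR.le Λ).measurable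
  have key : ∀ x, cv a (oscKernel Γ (fun x => η₁ x + η₂ x) R Λ) x =
      cv a (oscKernel Γ η₁ R Λ) x + cv a (oscKernel Γ η₂ R Λ) x := fun x => by
    unfold cv
    rw [← integral_add (integrable_cv_integrand hai m1 (fun y => (norm_oscKernel Γ η₁ R Λ y).le.trans
      (hM1 y)) x) (integrable_cv_integrand hai m2 (fun y => (norm_oscKernel Γ η₂ R Λ y).le.trans
      (hM2 y)) x)]
    congr 1; ext t
    simp only [oscKernel]; push_cast; ring
  simp_rw [key]
  calc _ ≤ ∫⁻ x, (2 * ‖cv a (oscKernel Γ η₁ R Λ) x‖ₑ ^ 2 + 2 * ‖cv a (oscKernel Γ η₂ R Λ) x‖ₑ ^ 2) :=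
        lintegral_mono fun x => enorm_add_sq_le _ _
    _ = 2 * (∫⁻ x, ‖cv a (oscKernel Γ η₁ R Λ) x‖ₑ ^ 2) +
        2 * ∫⁻ x, ‖cv a (oscKernel Γ η₂ R Λ) x‖ₑ ^ 2 := by
        rw [lintegral_add_left, lintegral_const_mul, lintegral_const_mul]
        · exact (measurable_cv ha m2).enorm.pow_const _
        · exact (measurable_cv ha m1).enorm.pow_const _
        · exact ((measurable_cv ha m1).enorm.pow_const _).const_mul _
    _ ≤ 2 * (C1 * ENNReal.ofReal (Λ⁻¹ ^ n) * ∫⁻ x, ‖a x‖ₑ ^ 2) +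
        2 * (C2 * ENNReal.ofReal (Λ⁻¹ ^ n) * ∫⁻ x, ‖a x‖ₑ ^ 2) := by
        gcongr
        · exact hC1 R hR Λ hΛ a ha hai
        · exact hC2 R hR Λ hΛ a ha hai
    _ = _ := by push_cast; ring

lemma IsGammaU.exists_hasOscBound_local {Γ : ℝ → ℝ} (hΓ : IsGammaU Γ) : ∃ δ > 0, ∀ z : Rn n,
    ‖z‖ ∈ Icc (1/2:ℝ) 2 → ∀ η : Rn n → ℝ, ContDiff ℝ (⊤ : ℕ∞) η →
      tsupport η ⊆ Metric.closedBall z δ → HasOscBound Γ η := by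
  obtain ⟨δ, hδ, h⟩ := hΓ.exists_autocorr_decay (n := n)
  refine ⟨δ, hδ, fun z hz η hη hηs => ?_⟩
  have hηc : HasCompactSupport η := (isCompact_closedBall z δ).of_isClosed_subset
    (isClosed_tsupport η) hηs
  obtain ⟨M, hM⟩ := hηc.exists_bound_of_continuous hη.continuous
  obtain ⟨C0, hC0, h0⟩ := h z hz η hη hηs 0
  obtain ⟨C1, hC1, h1⟩ := h z hz η hη hηs (n + 1)
  set I := ∫ s, |η s| ^ 2 with hI
  have hI0 : 0 ≤ I := by positivity
  set B := 2 ^ (n + 1) * (C0 + C1) + I with hB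
  have hdecay : ∀ R > 0, ∀ Λ > 0, ∀ h : Rn n,
      ‖∫ s, oscKernel Γ η R Λ (s + h) * (starRingEnd ℂ) (oscKernel Γ η R Λ s)‖ ≤
        B * (1 + Λ * ‖h‖)⁻¹ ^ (n + 1) := by
    intro R hR Λ hΛ w
    by_cases hw : w = 0
    · subst hw
      simp only [norm_zero, mul_zero, add_zero, inv_one, one_pow, mul_one]
      refine (norm_integral_le_integral_norm _).trans ?_
      simp only [norm_mul, RCLike.norm_conj, norm_oscKernel, ← pow_two]
      rw [hB]
      have : (0:ℝ) ≤ 2 ^ (n + 1) * (C0 + C1) := by positivity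
      linarith
    · have hw' : 0 < ‖w‖ := norm_pos_iff.2 hw
      have a0 := h0 R hR Λ hΛ w hw
      have a1 := h1 R hR Λ hΛ w hw
      rw [pow_zero, mul_one] at a0
      set t := Λ * ‖w‖ with ht
      have ht0 : 0 < t := by positivity
      by_cases hle : t ≤ 1
      · refine a0.trans ?_
        have : (1:ℝ) ≤ 2 ^ (n + 1) * (1 + t)⁻¹ ^ (n + 1) := by
          rw [← mul_pow]
          apply one_le_pow₀
          rw [← div_eq_mul_inv, le_div_iff₀ (by positivity)]; linarith
        have h3 : (0:ℝ) ≤ (1 + t)⁻¹ ^ (n + 1) := by positivity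
        calc C0 = C0 * 1 := by ring
          _ ≤ C0 * (2 ^ (n + 1) * (1 + t)⁻¹ ^ (n + 1)) := by gcongr
          _ ≤ B * (1 + t)⁻¹ ^ (n + 1) := by
            rw [hB, ← mul_assoc]
            gcongr
            have : (0:ℝ) ≤ 2 ^ (n + 1) * C1 := by positivity
            linarith
      · refine a1.trans ?_
        have : t⁻¹ ^ (n + 1) ≤ 2 ^ (n + 1) * (1 + t)⁻¹ ^ (n + 1) := by
          rw [← mul_pow]
          gcongr
          rw [← div_eq_mul_inv, le_div_iff₀ (by positivity), inv_mul_le_iff₀ ht0]; linarith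
        calc _ ≤ C1 * (2 ^ (n + 1) * (1 + t)⁻¹ ^ (n + 1)) := by gcongr
          _ ≤ B * (1 + t)⁻¹ ^ (n + 1) := by
            rw [hB, ← mul_assoc]
            gcongr
            have : (0:ℝ) ≤ 2 ^ (n + 1) * C0 := by positivity
            linarith
  have hB0 : 0 ≤ B := by positivity
  refine ⟨hη.continuous, ⟨M, hM⟩, (ENNReal.ofReal B *
    ∫⁻ h : Rn n, ENNReal.ofReal ((1 + ‖h‖)⁻¹ ^ (n + 1))).toNNReal, fun R hR Λ hΛ a ha hai => ?_⟩
  rw [ENNReal.coe_toNNReal (ENNReal.mul_ne_top ENNReal.ofReal_ne_top lintegral_bracket_lt_top.ne)]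
  have hc := hΓ.continuous_oscKernel hη.continuous hR.le Λ
  have hκc : HasCompactSupport (oscKernel Γ η R Λ) := by
    refine hηc.mono fun x hx => ?_
    intro h0; exact hx (by simp [oscKernel, h0])
  refine (lintegral_cv_sq_le ha hc.measurable hai (hc.integrable_of_hasCompactSupport hκc)
    (M := M) (fun x => (norm_oscKernel Γ η R Λ x).le.trans (hM x))).trans ?_
  gcongr
  calc _ ≤ ∫⁻ h : Rn n, ENNReal.ofReal (B * (1 + Λ * ‖h‖)⁻¹ ^ (n + 1)) := by
        refine lintegral_mono fun w => ?_
        rw [← ofReal_norm]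
        exact ENNReal.ofReal_le_ofReal (hdecay R hR Λ hΛ w)
    _ = ENNReal.ofReal B * ∫⁻ h : Rn n, ENNReal.ofReal ((1 + Λ * ‖h‖)⁻¹ ^ (n + 1)) := by
        rw [← lintegral_const_mul _ (by fun_prop)]
        congr 1; ext w; rw [ENNReal.ofReal_mul hB0]
    _ ≤ _ := by rw [lintegral_bracket_scaled hΛ]; apply le_of_eq; ring

/-- The `L²` bound for oscillatory convolutions with amplitude supported in an annulus. -/
theorem IsGammaU.hasOscBound {Γ : ℝ → ℝ} (hΓ : IsGammaU Γ) {η : Rn n → ℝ}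
    (hη : ContDiff ℝ (⊤ : ℕ∞) η) (hs : ∀ x, η x ≠ 0 → ‖x‖ ∈ Icc (1/2:ℝ) 2) : HasOscBound Γ η := by
  obtain ⟨δ, hδ, hloc⟩ := hΓ.exists_hasOscBound_local (n := n)
  have hA : IsCompact {z : Rn n | ‖z‖ ∈ Icc (1/2:ℝ) 2} := by
    refine (isCompact_closedBall (0 : Rn n) 2).of_isClosed_subset
      (isClosed_Icc.preimage continuous_norm) fun z hz => ?_
    rw [mem_closedBall_zero_iff]; exact hz.2
  have hzero : HasOscBound Γ (fun _ : Rn n => (0:ℝ)) :=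
    ⟨continuous_const, ⟨0, fun x => by simp⟩, 0, fun R hR Λ hΛ a ha hai => by simp [cv, oscKernel]⟩
  obtain ⟨ζ, hζ, h1, h2⟩ := hA.induction_on (p := fun s => ∃ ζ : Rn n → ℝ, ContDiff ℝ (⊤ : ℕ∞) ζ ∧
    (∀ x ∈ s, ζ x = 1) ∧ ∀ η : Rn n → ℝ, ContDiff ℝ (⊤ : ℕ∞) η → HasOscBound Γ (fun x => η x * ζ x))
    ⟨fun _ => 0, contDiff_const, by simp, fun η _ => by simpa using hzero⟩
    (fun s t hst ⟨ζ, h1, h2, h3⟩ => ⟨ζ, h1, fun x hx => h2 x (hst hx), h3⟩)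
    (fun s t ⟨ζ, h1, h2, h3⟩ ⟨ξ, g1, g2, g3⟩ => by
      refine ⟨fun x => ζ x + ξ x - ζ x * ξ x, (h1.add g1).sub (h1.mul g1), ?_, fun η hη => ?_⟩
      · rintro x (hx | hx)
        · simp [h2 x hx]
        · simp [g2 x hx]
      · have := (h3 η hη).add hΓ (g3 (fun x => η x * (1 - ζ x)) (hη.mul (contDiff_const.sub h1)))
        convert this using 2
        ring)
    (fun z hz => by
      let f : ContDiffBump z := ⟨δ / 2, δ, by positivity, by linarith⟩
      refine ⟨Metric.ball z (δ / 2), mem_nhdsWithin_of_mem_nhds (Metric.ball_mem_nhds z (by positivity)),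
        f, f.contDiff, fun x hx => f.one_of_mem_closedBall (Metric.ball_subset_closedBall hx),
        fun η hη => hloc z hz _ (hη.mul f.contDiff) ?_⟩
      exact (tsupport_mul_subset_right).trans f.tsupport_eq.le)
  have := h2 η hη
  convert this using 2 with x
  by_cases hx : η x = 0
  · simp [hx]
  · rw [h1 x (hs x hx), mul_one]

end

section Kernel
variable {n : ℕ} {Γ : ℝ → ℝ} {K : Rn n → ℝ} {ψ : ℝ → ℝ}

/-- The convolution kernel of `H_l^{(u)}`. -/
def hker (Γ : ℝ → ℝ) (K : Rn n → ℝ) (ψ : ℝ → ℝ) (u : ℝ) (l : ℤ) (t : Rn n) : ℂ :=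
  Complex.exp (Complex.I * Complex.ofReal (u * Γ ‖t‖)) *
    Complex.ofReal (ψ ((2 : ℝ) ^ (-l) * ‖t‖) * K t)

lemma Hloc_eq_cv (u : ℝ) (l : ℤ) (f : Rn n → ℂ) (x : Rn n) :
    Hloc Γ K ψ u l f x = cv f (hker Γ K ψ u l) x := by
  simp only [Hloc, cv, hker, mul_assoc]

lemma IsLPCutoff.eq_zero (hψ : IsLPCutoff ψ) {s : ℝ} (hs : |s| ∉ Icc (1/2 : ℝ) 2) : ψ s = 0 := by
  by_contra h; exact hs (hψ.2.2.1 s h)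

lemma exists_amplitude (hK : IsHomCZKernel n K) (hψ : IsLPCutoff ψ) :
    ∃ η : Rn n → ℝ, ContDiff ℝ (⊤ : ℕ∞) η ∧ (∀ x, η x ≠ 0 → ‖x‖ ∈ Icc (1/2:ℝ) 2) ∧
      ∀ R > 0, ∀ t : Rn n, ψ (R⁻¹ * ‖t‖) * K t = R⁻¹ ^ n * η (R⁻¹ • t) := by
  obtain ⟨Ω, hΩ, hhom, -, hKΩ⟩ := hK
  refine ⟨fun x => ψ ‖x‖ * (Ω x / ‖x‖ ^ n), ?_, ?_, ?_⟩
  · rw [contDiff_iff_contDiffAt]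
    intro x
    by_cases hx : x = 0
    · have : (fun x : Rn n => ψ ‖x‖ * (Ω x / ‖x‖ ^ n)) =ᶠ[𝓝 x] fun _ => 0 := by
        filter_upwards [Metric.ball_mem_nhds x (show (0:ℝ) < 1/2 by norm_num)] with y hy
        rw [hx, mem_ball_zero_iff] at hy
        rw [hψ.eq_zero, zero_mul]
        rw [abs_norm]; exact fun h => absurd h.1 (not_le.2 hy)
      exact contDiffAt_const.congr_of_eventuallyEq this
    · have h1 : ContDiffAt ℝ (⊤ : ℕ∞) (fun x : Rn n => ‖x‖) x := contDiffAt_norm ℝ hx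
      have h2 : ContDiffAt ℝ (⊤ : ℕ∞) Ω x := hΩ.contDiffAt (isOpen_ne.mem_nhds hx)
      exact (hψ.1.contDiffAt.comp x h1).mul (h2.div (h1.pow n) (pow_ne_zero _ (norm_ne_zero_iff.2 hx)))
  · intro x hx
    have : ψ ‖x‖ ≠ 0 := left_ne_zero_of_mul hx
    simpa using hψ.2.2.1 _ this
  · intro R hR t
    have hn : ‖R⁻¹ • t‖ = R⁻¹ * ‖t‖ := by
      rw [norm_smul, norm_inv, Real.norm_eq_abs, abs_of_pos hR]
    by_cases ht : t = 0
    · have : ψ 0 = 0 := hψ.eq_zero (by simp)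
      simp [ht, this]
    · have ht' : ‖t‖ ≠ 0 := norm_ne_zero_iff.2 ht
      simp only [hn, hhom R⁻¹ (by positivity) t, hKΩ t ht]
      rw [mul_pow, inv_pow]
      field_simp

lemma hker_eq {η : Rn n → ℝ} (hη : ∀ R > 0, ∀ t : Rn n, ψ (R⁻¹ * ‖t‖) * K t = R⁻¹ ^ n * η (R⁻¹ • t))
    (hΓ : IsGammaU Γ) (u : ℝ) (l : ℤ) (t : Rn n) :
    hker Γ K ψ u l t = (((2:ℝ) ^ l)⁻¹ ^ n : ℝ) *
      oscKernel Γ η ((2:ℝ) ^ l) (u * Γ ((2:ℝ) ^ l)) (((2:ℝ) ^ l)⁻¹ • t) := by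
  have hR : (0:ℝ) < 2 ^ l := by positivity
  have hΓR := hΓ.pos hR
  have e1 : (2:ℝ) ^ l * ‖((2:ℝ) ^ l)⁻¹ • t‖ = ‖t‖ := by
    rw [norm_smul, norm_inv, Real.norm_eq_abs, abs_of_pos hR, mul_inv_cancel_left₀ hR.ne']
  have e2 : u * Γ ((2:ℝ) ^ l) * (Γ ‖t‖ / Γ ((2:ℝ) ^ l)) = u * Γ ‖t‖ := by field_simp
  rw [hker, oscKernel, e1, e2, zpow_neg, hη _ hR]
  push_cast; ring

/-- The averaging kernel at scale `R`. -/
def avgKer (n : ℕ) (R : ℝ) (t : Rn n) : ℝ≥0∞ :=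
  (Metric.closedBall (0 : Rn n) (2 * R)).indicator (fun _ => ENNReal.ofReal (R⁻¹ ^ n)) t

lemma measurable_avgKer (R : ℝ) : Measurable (avgKer n R) :=
  measurable_const.indicator Metric.isClosed_closedBall.measurableSet

lemma lintegral_avgKer {R : ℝ} (hR : 0 < R) :
    ∫⁻ t, avgKer n R t = volume (Metric.closedBall (0 : Rn n) 2) := by
  unfold avgKer
  rw [lintegral_indicator_const Metric.isClosed_closedBall.measurableSet,
    mul_comm (2:ℝ) R, Measure.addHaar_closedBall_mul _ _ hR.le (by norm_num),
    finrank_euclideanSpace, Fintype.card_fin, ← mul_assoc, ← ENNReal.ofReal_mul (by positivity),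
    ← mul_pow, inv_mul_cancel₀ hR.ne']
  simp

/-- The kernel is supported in the annulus `R/2 ≤ |t| ≤ 2R`. -/
lemma hker_ne_zero (hψ : IsLPCutoff ψ) {u : ℝ} {l : ℤ} {t : Rn n} (h : hker Γ K ψ u l t ≠ 0) :
    ‖t‖ ∈ Icc ((2:ℝ) ^ l / 2) (2 * 2 ^ l) := by
  have h1 : ψ ((2:ℝ) ^ (-l) * ‖t‖) ≠ 0 := fun h0 => h (by rw [hker, h0, zero_mul]; simp)
  have h2 := hψ.2.2.1 _ h1
  have hR : (0:ℝ) < 2 ^ l := by positivity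
  rw [abs_of_nonneg (by positivity), zpow_neg, inv_mul_eq_div] at h2
  exact ⟨by have := (le_div_iff₀ hR).1 h2.1; linarith, (div_le_iff₀ hR).1 h2.2⟩

lemma exists_hker_le (hΓ : IsGammaU Γ) (hK : IsHomCZKernel n K) (hψ : IsLPCutoff ψ) :
    ∃ M : ℝ≥0, ∀ (u : ℝ) (l : ℤ) (t : Rn n), ‖hker Γ K ψ u l t‖ₑ ≤ M * avgKer n ((2:ℝ) ^ l) t := by
  obtain ⟨η, hη, hηs, hηK⟩ := exists_amplitude hK hψ
  obtain ⟨-, ⟨M, hM⟩, -⟩ := hΓ.hasOscBound hη hηs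
  refine ⟨M.toNNReal, fun u l t => ?_⟩
  by_cases h : hker Γ K ψ u l t = 0
  · simp [h]
  · have h1 := hker_ne_zero hψ h
    have hR : (0:ℝ) < 2 ^ l := by positivity
    rw [avgKer, indicator_of_mem (by rw [mem_closedBall_zero_iff]; exact h1.2), ← ofReal_norm,
      hker_eq hηK hΓ, norm_mul, norm_oscKernel, Complex.norm_real, Real.norm_eq_abs,
      abs_of_pos (by positivity), mul_comm, ENNReal.ofReal_mul (abs_nonneg _)]
    gcongr
    exact ENNReal.ofReal_le_ofReal (hM _)

lemma continuous_hker (hΓ : IsGammaU Γ) (hK : IsHomCZKernel n K) (hψ : IsLPCutoff ψ) (l : ℤ) :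
    Continuous fun q : ℝ × Rn n => hker Γ K ψ q.1 l q.2 := by
  obtain ⟨η, hη, hηs, hηK⟩ := exists_amplitude hK hψ
  have h1 : Continuous fun q : ℝ × Rn n => Γ ‖q.2‖ := by
    have := (hΓ.continuous_comp_norm (n := n) zero_le_one).comp
      (continuous_snd : Continuous fun q : ℝ × Rn n => q.2)
    simpa [Function.comp_def] using this
  have hR : (0:ℝ) < 2 ^ l := by positivity
  have h2 : (fun q : ℝ × Rn n => hker Γ K ψ q.1 l q.2) = fun q => Complex.exp (Complex.I *
      Complex.ofReal (q.1 * Γ ‖q.2‖)) *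
        Complex.ofReal (((2:ℝ) ^ l)⁻¹ ^ n * η (((2:ℝ) ^ l)⁻¹ • q.2)) := by
    ext q
    rw [hker, zpow_neg, hηK _ hR]
  rw [h2]
  have h3 := hη.continuous
  exact (Complex.continuous_exp.comp (continuous_const.mul (Complex.continuous_ofReal.comp
    (continuous_fst.mul h1)))).mul (Complex.continuous_ofReal.comp (by fun_prop))

lemma measurable_hker (hΓ : IsGammaU Γ) (hK : IsHomCZKernel n K) (hψ : IsLPCutoff ψ) (u : ℝ)
    (l : ℤ) : Measurable (hker Γ K ψ u l) :=
  ((continuous_hker hΓ hK hψ l).comp (by fun_prop : Continuous fun t : Rn n => (u, t))).measurable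

/-- The `L²` bound for `H_l^{(u)}`. -/
theorem exists_hker_sq_le (hΓ : IsGammaU Γ) (hK : IsHomCZKernel n K) (hψ : IsLPCutoff ψ) :
    ∃ C : ℝ≥0, ∀ u > 0, ∀ l : ℤ, ∀ a : Rn n → ℂ, Measurable a → Integrable a →
      ∫⁻ x, ‖cv a (hker Γ K ψ u l) x‖ₑ ^ 2 ≤
        C * ENNReal.ofReal ((u * Γ ((2:ℝ) ^ l))⁻¹ ^ n) * ∫⁻ x, ‖a x‖ₑ ^ 2 := by
  obtain ⟨η, hη, hηs, hηK⟩ := exists_amplitude hK hψ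
  obtain ⟨hηc, -, C, hC⟩ := hΓ.hasOscBound hη hηs
  refine ⟨C, fun u hu l a ha hai => ?_⟩
  set R := (2:ℝ) ^ l with hRdef
  have hR : (0:ℝ) < R := by positivity
  set κ := oscKernel Γ η R (u * Γ R) with hκ
  have hκm : Measurable κ := (hΓ.continuous_oscKernel hηc hR.le _).measurable
  have ham : Measurable fun y => a (R • y) := ha.comp (measurable_const_smul R)
  have e : ∀ x, cv a (hker Γ K ψ u l) x = cv (fun y => a (R • y)) κ (R⁻¹ • x) := by
    intro x
    have h1 := Measure.integral_comp_smul_of_nonneg (volume : Measure (Rn n))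
      (fun t => a (x - t) * κ (R⁻¹ • t)) R (hR := hR.le)
    simp only [cv]
    calc ∫ t, a (x - t) * hker Γ K ψ u l t
        = ((R⁻¹ ^ n : ℝ) : ℂ) * ∫ t, a (x - t) * κ (R⁻¹ • t) := by
          rw [← integral_const_mul]; congr 1; ext t; rw [hker_eq hηK hΓ]; ring
      _ = ∫ t, a (x - R • t) * κ (R⁻¹ • R • t) := by
          rw [h1, finrank_euclideanSpace, Fintype.card_fin, Complex.real_smul, inv_pow]
      _ = _ := by
          congr 1; ext t
          rw [smul_smul, inv_mul_cancel₀ hR.ne', one_smul, smul_sub, smul_smul, mul_inv_cancel₀ hR.ne',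
            one_smul]
  simp_rw [e]
  have s1 := lintegral_smul_arg (fun y => ‖cv (fun y => a (R • y)) κ y‖ₑ ^ 2)
    ((measurable_cv ham hκm).enorm.pow_const 2) (inv_pos.2 hR)
  have s2 := lintegral_smul_arg (fun y => ‖a y‖ₑ ^ 2) (ha.enorm.pow_const 2) hR
  rw [s1, inv_inv]
  have h2 := hC R hR (u * Γ R) (mul_pos hu (hΓ.pos hR)) _ ham (hai.comp_smul hR.ne')
  rw [s2] at h2
  calc _ ≤ ENNReal.ofReal (R ^ n) * (C * ENNReal.ofReal ((u * Γ R)⁻¹ ^ n) *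
          (ENNReal.ofReal (R⁻¹ ^ n) * ∫⁻ x, ‖a x‖ₑ ^ 2)) := by gcongr
    _ = (ENNReal.ofReal (R ^ n) * ENNReal.ofReal (R⁻¹ ^ n)) *
        (C * ENNReal.ofReal ((u * Γ R)⁻¹ ^ n) * ∫⁻ x, ‖a x‖ₑ ^ 2) := by ring
    _ = _ := by
        rw [← ENNReal.ofReal_mul (by positivity), ← mul_pow, mul_inv_cancel₀ hR.ne']; simp

lemma enorm_cv_hker_le {M : ℝ≥0} (hM : ∀ (u : ℝ) (l : ℤ) (t : Rn n),
      ‖hker Γ K ψ u l t‖ₑ ≤ M * avgKer n ((2:ℝ) ^ l) t) (a : Rn n → ℂ) (u : ℝ) (l : ℤ)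
    (x : Rn n) :
    ‖cv a (hker Γ K ψ u l) x‖ₑ ≤ M * lcv (fun y => ‖a y‖ₑ) (avgKer n ((2:ℝ) ^ l)) x := by
  refine (enorm_cv_le _ _ _).trans ?_
  unfold lcv
  rw [← lintegral_const_mul' _ _ ENNReal.coe_ne_top]
  refine lintegral_mono fun t => ?_
  calc _ ≤ ‖a (x - t)‖ₑ * (M * avgKer n ((2:ℝ) ^ l) t) := by gcongr; exact hM u l t
    _ = _ := by ring

end Kernel

section KernelDifference
variable {n : ℕ} {Γ : ℝ → ℝ} {K : Rn n → ℝ} {ψ : ℝ → ℝ}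

/-- Lipschitz bound for `Γ` at unit scale around `R`. -/
lemma IsGammaU.exists_lipschitz (hΓ : IsGammaU Γ) : ∃ C : ℝ, 0 ≤ C ∧ ∀ R > 0,
    ∀ s ∈ Icc (R / 4) (3 * R), ∀ s' ∈ Icc (R / 4) (3 * R), |Γ s - Γ s'| ≤ C * Γ R / R * |s - s'| := by
  obtain ⟨c, hc, C, hC, h⟩ := hΓ.exists_deriv_bounds
  obtain ⟨D, hD1, hD⟩ := hΓ.exists_doubling
  refine ⟨4 * C * D ^ 2, by positivity, fun R hR s hs s' hs' => ?_⟩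
  have hb : ∀ σ ∈ Icc (R / 4) (3 * R), ‖deriv Γ σ‖ ≤ 4 * C * D ^ 2 * Γ R / R := by
    intro σ hσ
    have hσ0 : 0 < σ := lt_of_lt_of_le (by positivity) hσ.1
    rw [Real.norm_eq_abs, abs_of_pos (hΓ.deriv_pos σ hσ0)]
    have h1 : Γ σ ≤ D ^ 2 * Γ R := by
      calc Γ σ ≤ Γ (2 * (2 * R)) := hΓ.strictMonoOn.monotoneOn (mem_Ici.2 hσ0.le)
            (mem_Ici.2 (by positivity)) (by linarith [hσ.2])
        _ ≤ D * (D * Γ R) := (hD _ (by positivity)).trans (by gcongr; exact hD _ hR)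
        _ = _ := by ring
    have h2 := (h σ hσ0).2
    rw [le_div_iff₀ hR]
    have h3 := hΓ.deriv_pos σ hσ0
    nlinarith [hσ.1, mul_le_mul_of_nonneg_left h1 hC.le]
  have := (convex_Icc (R / 4) (3 * R)).norm_image_sub_le_of_norm_hasDerivWithin_le
    (f := Γ) (f' := deriv Γ) (fun x hx => (hΓ.hasDerivAt (lt_of_lt_of_le (by positivity) hx.1)).hasDerivWithinAt)
    hb hs' hs
  simpa [Real.norm_eq_abs] using this

lemma norm_exp_sub_exp_le (a b : ℝ) :
    ‖Complex.exp (Complex.I * a) - Complex.exp (Complex.I * b)‖ ≤ |a - b| := by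
  have h : Complex.exp (Complex.I * a) - Complex.exp (Complex.I * b) =
      Complex.exp (Complex.I * b) * (Complex.exp (Complex.I * ((a - b : ℝ) : ℂ)) - 1) := by
    rw [mul_sub, ← Complex.exp_add]; push_cast; ring_nf
  rw [h, norm_mul, mul_comm Complex.I (b : ℂ), Complex.norm_exp_ofReal_mul_I, one_mul]
  exact Real.norm_exp_I_mul_ofReal_sub_one_le

/-- Moving the modulation parameter: on functions supported in a small ball, the kernels for two
parameters agree up to a unimodular factor and a small error. -/
theorem exists_cv_hker_diff_le (hΓ : IsGammaU Γ) (hK : IsHomCZKernel n K) (hψ : IsLPCutoff ψ) :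
    ∃ C : ℝ, 0 ≤ C ∧ ∀ (v v' : ℝ) (l : ℤ) (a : Rn n → ℂ), Integrable a →
      ∀ (c : Rn n) (w : ℝ), 0 ≤ w → w ≤ 2 ^ l / 8 → (∀ y, a y ≠ 0 → ‖y - c‖ ≤ w) → ∀ x,
      ‖cv a (hker Γ K ψ v l) x‖ₑ ≤ ‖cv a (hker Γ K ψ v' l) x‖ₑ +
        ENNReal.ofReal (C * |v - v'| * Γ (2 ^ l) * (w / 2 ^ l)) *
          lcv (fun y => ‖a y‖ₑ) (avgKer n ((2:ℝ) ^ l)) x := by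
  obtain ⟨M, hM⟩ := exists_hker_le hΓ hK hψ
  obtain ⟨C, hC, hL⟩ := hΓ.exists_lipschitz
  refine ⟨C * M, by positivity, fun v v' l a ha c w hw0 hw hs x => ?_⟩
  set R := (2:ℝ) ^ l with hR
  have hR0 : 0 < R := by positivity
  have hbd : ∀ u t, ‖hker Γ K ψ u l t‖ ≤ M * (R⁻¹ ^ n) := by
    intro u t
    have h1 : ‖hker Γ K ψ u l t‖ₑ ≤ ENNReal.ofReal (M * R⁻¹ ^ n) := by
      refine (hM u l t).trans ?_
      rw [ENNReal.ofReal_mul (by positivity), ENNReal.ofReal_coe_nnreal]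
      gcongr
      exact indicator_le_self' (fun _ _ => zero_le) _
    rw [← ofReal_norm] at h1
    exact (ENNReal.ofReal_le_ofReal_iff (by positivity)).1 h1
  have hi : ∀ u, Integrable fun t => a (x - t) * hker Γ K ψ u l t := fun u =>
    integrable_cv_integrand ha (measurable_hker hΓ hK hψ u l) (hbd u) x
  set θ : ℝ := (v - v') * Γ ‖x - c‖ with hθ
  have hrel : ∀ t, hker Γ K ψ v l t =
      Complex.exp (Complex.I * (((v - v') * Γ ‖t‖ : ℝ) : ℂ)) * hker Γ K ψ v' l t := by
    intro t
    rw [hker, hker, ← mul_assoc, ← Complex.exp_add]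
    congr 2; push_cast; ring
  have hdiff : cv a (hker Γ K ψ v l) x = Complex.exp (Complex.I * θ) * cv a (hker Γ K ψ v' l) x +
      ∫ t, a (x - t) * ((Complex.exp (Complex.I * (((v - v') * Γ ‖t‖ : ℝ) : ℂ)) -
        Complex.exp (Complex.I * θ)) * hker Γ K ψ v' l t) := by
    rw [cv, cv, ← integral_const_mul, ← integral_add ((hi v').const_mul _)]
    · congr 1; ext t; rw [hrel]; ring
    · refine ((hi v).sub ((hi v').const_mul (Complex.exp (Complex.I * θ)))).congr (ae_of_all _ fun t => ?_)
      simp only [Pi.sub_apply]; rw [hrel]; ring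
  rw [hdiff]
  refine (enorm_add_le _ _).trans ?_
  refine add_le_add ?_ ?_
  · rw [enorm_mul, ← ofReal_norm (Complex.exp _), mul_comm Complex.I, Complex.norm_exp_ofReal_mul_I]
    simp
  refine (enorm_integral_le_lintegral_enorm _).trans ?_
  rw [lcv, ← lintegral_const_mul' _ _ ENNReal.ofReal_ne_top]
  refine lintegral_mono fun t => ?_
  by_cases hz : a (x - t) = 0
  · simp [hz]
  by_cases hk : hker Γ K ψ v' l t = 0
  · simp [hk]
  have h1 := hker_ne_zero hψ hk
  have h2 := hs _ hz
  have h3 : |‖t‖ - ‖x - c‖| ≤ w := by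
    refine (abs_norm_sub_norm_le _ _).trans ?_
    rw [show t - (x - c) = -(x - t - c) by abel, norm_neg]; exact h2
  have h4 := abs_le.1 h3
  have h5 := hL R hR0 ‖t‖ ⟨by linarith [h1.1], by linarith [h1.2]⟩ ‖x - c‖
    ⟨by linarith [h1.1, h4.2], by linarith [h1.2, h4.1]⟩
  have h6 : ‖Complex.exp (Complex.I * (((v - v') * Γ ‖t‖ : ℝ) : ℂ)) -
        Complex.exp (Complex.I * θ)‖ ≤ |v - v'| * (C * Γ R / R * w) := by
    refine (norm_exp_sub_exp_le _ _).trans ?_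
    rw [hθ, ← mul_sub, abs_mul]
    have := hΓ.pos hR0
    gcongr
    exact h5.trans (by gcongr)
  rw [enorm_mul, enorm_mul, mul_left_comm]
  have h7 : ‖Complex.exp (Complex.I * (((v - v') * Γ ‖t‖ : ℝ) : ℂ)) -
        Complex.exp (Complex.I * θ)‖ₑ ≤ ENNReal.ofReal (|v - v'| * (C * Γ R / R * w)) := by
    rw [← ofReal_norm]; exact ENNReal.ofReal_le_ofReal h6
  calc _ ≤ ENNReal.ofReal (|v - v'| * (C * Γ R / R * w)) * (‖a (x - t)‖ₑ * (M * avgKer n R t)) := by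
        gcongr; exact hM _ _ _
    _ = ENNReal.ofReal (|v - v'| * (C * Γ R / R * w)) * ENNReal.ofReal M *
          (‖a (x - t)‖ₑ * avgKer n R t) := by rw [ENNReal.ofReal_coe_nnreal]; ring
    _ = _ := by
        rw [← ENNReal.ofReal_mul (by have := hΓ.pos hR0; positivity)]
        congr 2; ring

end KernelDifference

section LittlewoodPaley
variable {n : ℕ} {ψ : ℝ → ℝ}

/-- The convolution kernel of the Littlewood–Paley projection `P_j`. -/
def lpk (n : ℕ) (ψ : ℝ → ℝ) (j : ℤ) : Rn n → ℂ :=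
  𝓕⁻ fun ξ : Rn n => Complex.ofReal (ψ ((2 : ℝ) ^ (-j) * ‖ξ‖))

lemma IsLPCutoff.exists_schwartz_symbol (hψ : IsLPCutoff ψ) (j : ℤ) :
    ∃ Ψ : SchwartzMap (Rn n) ℂ, ∀ ξ, Ψ ξ = Complex.ofReal (ψ ((2 : ℝ) ^ (-j) * ‖ξ‖)) := by
  have h2 : (0:ℝ) < 2 ^ (-j) := by positivity
  have hsm : ContDiff ℝ (⊤ : ℕ∞) fun ξ : Rn n => Complex.ofReal (ψ ((2 : ℝ) ^ (-j) * ‖ξ‖)) := by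
    refine Complex.ofRealCLM.contDiff.comp ?_
    rw [contDiff_iff_contDiffAt]
    intro x
    by_cases hx : x = 0
    · have : (fun x : Rn n => ψ (2 ^ (-j) * ‖x‖)) =ᶠ[𝓝 x] fun _ => 0 := by
        filter_upwards [Metric.ball_mem_nhds x (show (0:ℝ) < 1 / 2 / 2 ^ (-j) by positivity)] with y hy
        rw [hx, mem_ball_zero_iff, lt_div_iff₀ h2] at hy
        rw [hψ.eq_zero]
        rw [abs_of_nonneg (by positivity)]; exact fun h => absurd h.1 (not_le.2 (by linarith))
      exact contDiffAt_const.congr_of_eventuallyEq this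
    · exact hψ.1.contDiffAt.comp x (contDiffAt_const.mul (contDiffAt_norm ℝ hx))
  have hcs : HasCompactSupport fun ξ : Rn n => Complex.ofReal (ψ ((2 : ℝ) ^ (-j) * ‖ξ‖)) := by
    refine HasCompactSupport.of_support_subset_isCompact
      (isCompact_closedBall (0 : Rn n) (2 / 2 ^ (-j))) fun x hx => ?_
    have h3 : ψ ((2 : ℝ) ^ (-j) * ‖x‖) ≠ 0 := by simpa using hx
    have h4 := hψ.2.2.1 _ h3
    rw [abs_of_nonneg (by positivity)] at h4
    rw [mem_closedBall_zero_iff, le_div_iff₀ h2]; linarith [h4.2]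
  exact ⟨hcs.toSchwartzMap hsm, fun ξ => rfl⟩

lemma IsLPCutoff.exists_schwartz_lpk (hψ : IsLPCutoff ψ) (j : ℤ) :
    ∃ φ : SchwartzMap (Rn n) ℂ, (⇑φ = lpk n ψ j) ∧
      ∀ ξ, 𝓕 φ ξ = Complex.ofReal (ψ ((2 : ℝ) ^ (-j) * ‖ξ‖)) := by
  obtain ⟨Ψ, hΨ⟩ := hψ.exists_schwartz_symbol (n := n) j
  refine ⟨𝓕⁻ Ψ, ?_, fun ξ => ?_⟩
  · rw [SchwartzMap.fourierInv_coe, lpk]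
    congr 1; ext ξ; exact hΨ ξ
  · rw [FourierTransform.fourier_fourierInv_eq, hΨ]

lemma cv_eq_convolution (f g : SchwartzMap (Rn n) ℂ) :
    cv f g = SchwartzMap.convolution (ContinuousLinearMap.mul ℂ ℂ) f g := by
  ext x
  rw [SchwartzMap.convolution_apply, cv_eq]; rfl

lemma LPproj_eq_cv (hψ : IsLPCutoff ψ) (j : ℤ) (f : SchwartzMap (Rn n) ℂ) :
    LPproj ψ j f = cv f (lpk n ψ j) := by
  obtain ⟨φ, hφ, hF⟩ := hψ.exists_schwartz_lpk (n := n) j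
  rw [← hφ, cv_eq_convolution]
  have h1 : SchwartzMap.convolution (ContinuousLinearMap.mul ℂ ℂ) f φ =
      𝓕⁻ (SchwartzMap.pairing (ContinuousLinearMap.mul ℂ ℂ) (𝓕 f) (𝓕 φ)) := by
    rw [← SchwartzMap.fourier_convolution, FourierTransform.fourierInv_fourier_eq]
  rw [h1, SchwartzMap.fourierInv_coe, LPproj]
  congr 1; ext ξ
  rw [SchwartzMap.pairing_apply_apply, hF, ← SchwartzMap.fourier_coe, mul_comm]
  rfl

lemma lpk_scale (j : ℤ) (x : Rn n) :
    lpk n ψ j x = (((2:ℝ) ^ j) ^ n : ℝ) * lpk n ψ 0 ((2:ℝ) ^ j • x) := by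
  have h2 : (0:ℝ) < 2 ^ j := by positivity
  have h := Measure.integral_comp_inv_smul_of_nonneg (volume : Measure (Rn n))
    (fun v => Real.fourierChar (inner ℝ v ((2:ℝ) ^ j • x)) • Complex.ofReal (ψ ((2 : ℝ) ^ (-0 : ℤ) * ‖v‖)))
    (R := (2:ℝ) ^ j) h2.le
  simp only [lpk, Real.fourierInv_eq]
  rw [finrank_euclideanSpace, Fintype.card_fin, Complex.real_smul] at h
  rw [← h]
  congr 1; ext v
  congr 2
  · rw [inner_smul_left, inner_smul_right]; simp [h2.ne']
  · rw [norm_smul, norm_inv, Real.norm_eq_abs, abs_of_pos h2, zpow_neg]; simp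

lemma continuous_lpk (hψ : IsLPCutoff ψ) (j : ℤ) : Continuous (lpk n ψ j) := by
  obtain ⟨φ, hφ, -⟩ := hψ.exists_schwartz_lpk (n := n) j
  rw [← hφ]; exact φ.continuous

lemma integrable_lpk (hψ : IsLPCutoff ψ) (j : ℤ) : Integrable (lpk n ψ j) := by
  obtain ⟨φ, hφ, -⟩ := hψ.exists_schwartz_lpk (n := n) j
  rw [← hφ]; exact φ.integrable

lemma exists_norm_lpk_le (hψ : IsLPCutoff ψ) (j : ℤ) : ∃ M : ℝ, ∀ x, ‖lpk n ψ j x‖ ≤ M := by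
  obtain ⟨φ, hφ, -⟩ := hψ.exists_schwartz_lpk (n := n) j
  rw [← hφ]; exact ⟨_, φ.norm_le_seminorm ℝ⟩

/-- Rescaling integrals of the Littlewood–Paley kernels. -/
lemma lintegral_lpk_scale (j : ℤ) (g : Rn n → ℝ≥0∞) (hg : Measurable g) :
    ∫⁻ x, ENNReal.ofReal (((2:ℝ) ^ j) ^ n) * g ((2:ℝ) ^ j • x) = ∫⁻ x, g x := by
  have h2 : (0:ℝ) < 2 ^ j := by positivity
  rw [lintegral_const_mul _ (by fun_prop), lintegral_smul_arg g hg h2, ← mul_assoc,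
    ← ENNReal.ofReal_mul (by positivity), ← mul_pow, mul_inv_cancel₀ h2.ne']
  simp

lemma enorm_lpk_scale (j : ℤ) (x : Rn n) :
    ‖lpk n ψ j x‖ₑ = ENNReal.ofReal (((2:ℝ) ^ j) ^ n) * ‖lpk n ψ 0 ((2:ℝ) ^ j • x)‖ₑ := by
  rw [lpk_scale, enorm_mul, ← ofReal_norm, Complex.norm_real, Real.norm_of_nonneg (by positivity)]

lemma exists_lintegral_lpk_le (hψ : IsLPCutoff ψ) : ∃ C : ℝ≥0, ∀ j, ∫⁻ x, ‖lpk n ψ j x‖ₑ ≤ C := by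
  refine ⟨(∫⁻ x, ‖lpk n ψ 0 x‖ₑ).toNNReal, fun j => ?_⟩
  rw [ENNReal.coe_toNNReal (integrable_lpk hψ 0).2.ne]
  simp_rw [enorm_lpk_scale j]
  rw [lintegral_lpk_scale j (fun x => ‖lpk n ψ 0 x‖ₑ) (continuous_lpk hψ 0).measurable.enorm]

lemma exists_lintegral_lpk_tail_le (hψ : IsLPCutoff ψ) : ∃ C : ℝ≥0, ∀ j, ∀ s > 0,
    ∫⁻ x in {x | s < ‖x‖}, ‖lpk n ψ j x‖ₑ ≤ C * ENNReal.ofReal ((2 ^ j * s)⁻¹) := by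
  obtain ⟨φ, hφ, -⟩ := hψ.exists_schwartz_lpk (n := n) 0
  have hfin : ∫⁻ x : Rn n, ENNReal.ofReal ‖x‖ * ‖lpk n ψ 0 x‖ₑ < ∞ := by
    have := (φ.integrable_pow_mul volume 1).2
    refine lt_of_le_of_lt (lintegral_mono fun x => ?_) this
    simp only [pow_one, enorm_mul, enorm_norm, ofReal_norm, hφ]; exact le_rfl
  refine ⟨(∫⁻ x : Rn n, ENNReal.ofReal ‖x‖ * ‖lpk n ψ 0 x‖ₑ).toNNReal, fun j s hs => ?_⟩
  rw [ENNReal.coe_toNNReal hfin.ne]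
  have h2 : (0:ℝ) < 2 ^ j := by positivity
  have hm : Measurable fun x : Rn n => ENNReal.ofReal ‖x‖ * ‖lpk n ψ 0 x‖ₑ := by
    have := (continuous_lpk (n := n) hψ 0).measurable; fun_prop
  rw [← lintegral_lpk_scale j _ hm, ← lintegral_mul_const' _ _ ENNReal.ofReal_ne_top]
  rw [← lintegral_indicator (measurableSet_lt measurable_const measurable_norm)]
  refine lintegral_mono fun x => ?_
  by_cases hx : s < ‖x‖
  · rw [indicator_of_mem (show x ∈ {x | s < ‖x‖} from hx), enorm_lpk_scale j]
    have h3 : 1 ≤ ENNReal.ofReal ‖(2:ℝ) ^ j • x‖ * ENNReal.ofReal ((2 ^ j * s)⁻¹) := by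
      rw [← ENNReal.ofReal_mul (norm_nonneg _), ENNReal.one_le_ofReal, norm_smul,
        Real.norm_of_nonneg h2.le, ← div_eq_mul_inv, one_le_div (by positivity)]
      gcongr
    calc _ ≤ ENNReal.ofReal (((2:ℝ) ^ j) ^ n) * ‖lpk n ψ 0 ((2:ℝ) ^ j • x)‖ₑ *
          (ENNReal.ofReal ‖(2:ℝ) ^ j • x‖ * ENNReal.ofReal ((2 ^ j * s)⁻¹)) := le_mul_of_one_le_right' h3
      _ = _ := by ring
  · rw [indicator_of_notMem (show x ∉ {x | s < ‖x‖} from hx)]; exact zero_le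

lemma exists_lintegral_lpk_sub_le (hψ : IsLPCutoff ψ) : ∃ C : ℝ≥0, ∀ j, ∀ y : Rn n,
    ∫⁻ x, ‖lpk n ψ j (x - y) - lpk n ψ j x‖ₑ ≤ C * ENNReal.ofReal (2 ^ j * ‖y‖) := by
  obtain ⟨φ, hφ, -⟩ := hψ.exists_schwartz_lpk (n := n) 0
  have hfin : ∫⁻ x : Rn n, ‖fderiv ℝ (lpk n ψ 0) x‖ₑ < ∞ := by
    have := (SchwartzMap.fderivCLM ℝ (Rn n) ℂ φ).integrable (μ := volume).2
    simpa [HasFiniteIntegral, hφ] using this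
  have hdiff : Differentiable ℝ (lpk n ψ 0) := by rw [← hφ]; exact φ.differentiable
  have hcd : Continuous (fderiv ℝ (lpk n ψ 0)) := by
    rw [← hφ]; exact (φ.smooth 1).continuous_fderiv one_ne_zero
  have key : ∀ y : Rn n, ∫⁻ x, ‖lpk n ψ 0 (x - y) - lpk n ψ 0 x‖ₑ ≤
      (∫⁻ x : Rn n, ‖fderiv ℝ (lpk n ψ 0) x‖ₑ) * ENNReal.ofReal ‖y‖ := by
    intro y
    have h1 : ∀ x, ‖lpk n ψ 0 (x - y) - lpk n ψ 0 x‖ₑ ≤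
        ∫⁻ t in Ioc (0:ℝ) 1, ‖fderiv ℝ (lpk n ψ 0) (x - t • y)‖ₑ * ENNReal.ofReal ‖y‖ := by
      intro x
      have hd : ∀ t : ℝ, HasDerivAt (fun t : ℝ => lpk n ψ 0 (x - t • y))
          (fderiv ℝ (lpk n ψ 0) (x - t • y) (-y)) t := fun t => by
        have h5 : HasDerivAt (fun t : ℝ => x - t • y) (-y) t := by
          simpa using ((hasDerivAt_id t).smul_const y).const_sub x
        exact (hdiff (x - t • y)).hasFDerivAt.comp_hasDerivAt t h5
      have h6 := intervalIntegral.integral_eq_sub_of_hasDerivAt (a := 0) (b := 1)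
        (fun t _ => hd t) (by
          apply Continuous.intervalIntegrable
          exact (hcd.comp (by fun_prop)).clm_apply continuous_const)
      rw [one_smul, zero_smul, sub_zero] at h6
      rw [← h6, intervalIntegral.integral_of_le zero_le_one]
      refine (enorm_integral_le_lintegral_enorm _).trans (lintegral_mono fun t => ?_)
      refine (ContinuousLinearMap.le_opENorm _ _).trans ?_
      rw [enorm_neg, ofReal_norm]
    have hm : Measurable fun q : Rn n × ℝ => ‖fderiv ℝ (lpk n ψ 0) (q.1 - q.2 • y)‖ₑ * ENNReal.ofReal ‖y‖ := by
      have : Continuous fun q : Rn n × ℝ => fderiv ℝ (lpk n ψ 0) (q.1 - q.2 • y) := hcd.comp (by fun_prop)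
      exact this.enorm.measurable.mul_const _
    calc _ ≤ ∫⁻ x, ∫⁻ t in Ioc (0:ℝ) 1, ‖fderiv ℝ (lpk n ψ 0) (x - t • y)‖ₑ * ENNReal.ofReal ‖y‖ :=
          lintegral_mono h1
      _ = ∫⁻ t in Ioc (0:ℝ) 1, ∫⁻ x, ‖fderiv ℝ (lpk n ψ 0) (x - t • y)‖ₑ * ENNReal.ofReal ‖y‖ :=
          lintegral_lintegral_swap hm.aemeasurable
      _ = _ := by
          have : ∀ t : ℝ, ∫⁻ x, ‖fderiv ℝ (lpk n ψ 0) (x - t • y)‖ₑ * ENNReal.ofReal ‖y‖ =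
              (∫⁻ x : Rn n, ‖fderiv ℝ (lpk n ψ 0) x‖ₑ) * ENNReal.ofReal ‖y‖ := fun t => by
            rw [lintegral_mul_const' _ _ ENNReal.ofReal_ne_top,
              lintegral_sub_right_eq_self (fun x => ‖fderiv ℝ (lpk n ψ 0) x‖ₑ)]
          simp_rw [this]
          simp
  refine ⟨(∫⁻ x : Rn n, ‖fderiv ℝ (lpk n ψ 0) x‖ₑ).toNNReal, fun j y => ?_⟩
  rw [ENNReal.coe_toNNReal hfin.ne]
  have h2 : (0:ℝ) < 2 ^ j := by positivity
  have h3 := key ((2:ℝ) ^ j • y)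
  rw [norm_smul, Real.norm_of_nonneg h2.le] at h3
  refine le_trans (le_of_eq ?_) h3
  rw [← lintegral_lpk_scale j (fun x => ‖lpk n ψ 0 (x - (2:ℝ) ^ j • y) - lpk n ψ 0 x‖ₑ) (by
    have := (continuous_lpk (n := n) hψ 0).measurable; fun_prop)]
  congr 1; ext x
  rw [lpk_scale j, lpk_scale j, ← mul_sub, enorm_mul, ← ofReal_norm, Complex.norm_real,
    Real.norm_of_nonneg (by positivity), smul_sub]

end LittlewoodPaley

section SquareFunction
variable {n : ℕ} {ψ : ℝ → ℝ}

lemma IsLPCutoff.tsum_sq_le (hψ : IsLPCutoff ψ) (s : ℝ) :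
    ∑' a : ℤ, ENNReal.ofReal (ψ ((2:ℝ) ^ (-a) * s)) ^ 2 ≤ 1 := by
  have h1 : ∀ a : ℤ, ENNReal.ofReal (ψ ((2:ℝ) ^ (-a) * s)) ^ 2 ≤
      ENNReal.ofReal (ψ ((2:ℝ) ^ (-a) * s)) := fun a => by
    rw [pow_two]
    exact mul_le_of_le_one_left' (ENNReal.ofReal_le_one.2 (hψ.2.1 _).2)
  refine (ENNReal.tsum_le_tsum h1).trans ?_
  by_cases hs : s = 0
  · have : ψ 0 = 0 := hψ.eq_zero (by simp)
    simp [hs, this]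
  · have h := hψ.2.2.2 s hs
    rw [← ENNReal.ofReal_tsum_of_nonneg (fun a => (hψ.2.1 _).1) h.summable, h.tsum_eq]
    simp

lemma SchwartzMap.lintegral_enorm_sq_fourier (f : SchwartzMap (Rn n) ℂ) :
    ∫⁻ x, ‖𝓕 f x‖ₑ ^ 2 = ∫⁻ x, ‖f x‖ₑ ^ 2 := by
  have h : ∀ g : SchwartzMap (Rn n) ℂ, ∫⁻ x, ‖g x‖ₑ ^ 2 = ENNReal.ofReal (∫ x, ‖g x‖ ^ 2) := fun g => by
    rw [ofReal_integral_eq_lintegral_ofReal (μ := volume) ((g.memLp 2).integrable_norm_pow two_ne_zero)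
      (ae_of_all _ fun x => by positivity)]
    congr 1; ext x
    rw [← ofReal_norm, ENNReal.ofReal_pow (norm_nonneg _)]
  rw [h, h, SchwartzMap.integral_norm_sq_fourier]

lemma tsum_lintegral_cv_lpk_schwartz_le (hψ : IsLPCutoff ψ) (β : SchwartzMap (Rn n) ℂ) :
    ∑' a : ℤ, ∫⁻ x, ‖cv β (lpk n ψ a) x‖ₑ ^ 2 ≤ ∫⁻ x, ‖β x‖ₑ ^ 2 := by
  have h1 : ∀ a : ℤ, ∫⁻ x, ‖cv β (lpk n ψ a) x‖ₑ ^ 2 =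
      ∫⁻ ξ, ENNReal.ofReal (ψ ((2:ℝ) ^ (-a) * ‖ξ‖)) ^ 2 * ‖𝓕 β ξ‖ₑ ^ 2 := fun a => by
    obtain ⟨φ, hφ, hF⟩ := hψ.exists_schwartz_lpk (n := n) a
    rw [← hφ, cv_eq_convolution, ← SchwartzMap.lintegral_enorm_sq_fourier]
    congr 1; ext ξ
    rw [SchwartzMap.fourier_convolution, SchwartzMap.pairing_apply_apply, hF]
    rw [ContinuousLinearMap.mul_apply', enorm_mul, mul_pow, mul_comm, ← ofReal_norm (Complex.ofReal _),
      Complex.norm_real, Real.norm_of_nonneg (hψ.2.1 _).1]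
  simp_rw [h1]
  have hψm : Measurable ψ := hψ.1.continuous.measurable
  have hβm : Measurable (fun ξ => 𝓕 β ξ) := (𝓕 β : SchwartzMap (Rn n) ℂ).continuous.measurable
  rw [← lintegral_tsum (fun a => by fun_prop), ← SchwartzMap.lintegral_enorm_sq_fourier β]
  refine lintegral_mono fun ξ => ?_
  simp only
  rw [ENNReal.tsum_mul_right]
  exact mul_le_of_le_one_left' (hψ.tsum_sq_le _)

lemma cv_sub {a b κ : Rn n → ℂ} (ha : Integrable a) (hb : Integrable b) (hκ : Measurable κ) {M : ℝ}
    (hM : ∀ x, ‖κ x‖ ≤ M) (x : Rn n) : cv (fun y => a y - b y) κ x = cv a κ x - cv b κ x := by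
  rw [cv, cv, cv, ← integral_sub (integrable_cv_integrand ha hκ hM x)
    (integrable_cv_integrand hb hκ hM x)]
  congr 1; ext t; ring

lemma enorm_sq_add_le_of_sub (z w : ℂ) : ‖z‖ₑ ^ 2 ≤ 2 * ‖w‖ₑ ^ 2 + 2 * ‖z - w‖ₑ ^ 2 := by
  have := enorm_add_sq_le w (z - w)
  rwa [add_sub_cancel] at this

/-- Almost orthogonality of the Littlewood–Paley pieces. -/
theorem tsum_lintegral_cv_lpk_le (hψ : IsLPCutoff ψ) {α : Rn n → ℂ} (hα : Measurable α)
    (hα1 : Integrable α) :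
    ∑' a : ℤ, ∫⁻ x, ‖cv α (lpk n ψ a) x‖ₑ ^ 2 ≤ 4 * ∫⁻ x, ‖α x‖ₑ ^ 2 := by
  by_cases hfin : ∫⁻ x, ‖α x‖ₑ ^ 2 = ∞
  · rw [hfin]; simp
  obtain ⟨C, hC⟩ := exists_lintegral_lpk_le (n := n) hψ
  have hmem : MemLp α 2 volume := by
    refine ⟨hα.aestronglyMeasurable, ?_⟩
    rw [eLpNorm_lt_top_iff_lintegral_rpow_enorm_lt_top (by norm_num) (by norm_num)]
    simpa using lt_top_iff_ne_top.2 hfin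
  rw [ENNReal.tsum_eq_iSup_sum]
  refine iSup_le fun s => ?_
  refine ENNReal.le_of_forall_pos_le_add fun ε hε _ => ?_
  obtain ⟨δ, hδ0, hδ⟩ : ∃ δ : ℝ≥0, 0 < δ ∧ ((4:ℝ≥0∞) + 2 * (s.card * (C:ℝ≥0∞) ^ 2)) * (δ:ℝ≥0∞) ^ 2 ≤ ε := by
    set A : ℝ≥0 := 4 + 2 * (s.card * C ^ 2) with hA
    refine ⟨min 1 (ε / A), by positivity, ?_⟩
    have h1 : A * (min 1 (ε / A)) ^ 2 ≤ ε := by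
      calc A * (min 1 (ε / A)) ^ 2 ≤ A * (1 * (ε / A)) := by
            rw [pow_two]; gcongr
            · exact min_le_left _ _
            · exact min_le_right _ _
        _ = ε := by rw [one_mul, mul_div_cancel₀]; positivity
    have h2 := ENNReal.coe_le_coe.2 h1
    rw [hA] at h2 ⊢
    push_cast at h2 ⊢
    exact h2
  obtain ⟨g, hg1, hg2, hg3⟩ := hmem.exist_eLpNorm_sub_le (by norm_num) (by norm_num)
    (ε := (δ:ℝ)) (by exact_mod_cast hδ0)
  set β := hg1.toSchwartzMap hg2 with hβ
  have hd : ∫⁻ x, ‖α x - β x‖ₑ ^ 2 ≤ (δ:ℝ≥0∞) ^ 2 := by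
    have h1 : eLpNorm (fun x => α x - β x) 2 volume ≤ δ := by
      simpa [ENNReal.ofReal_coe_nnreal] using! hg3
    rw [eLpNorm_eq_lintegral_rpow_enorm_toReal (by norm_num) (by norm_num)] at h1
    have h2 := ENNReal.rpow_le_rpow h1 (show (0:ℝ) ≤ 2 by norm_num)
    rw [← ENNReal.rpow_mul] at h2
    simpa using h2
  have hβm := β.continuous.measurable
  have hβi : Integrable β := β.integrable
  have e1 : ∀ a, ∫⁻ x, ‖cv α (lpk n ψ a) x‖ₑ ^ 2 ≤
      2 * (∫⁻ x, ‖cv β (lpk n ψ a) x‖ₑ ^ 2) + 2 * ((C:ℝ≥0∞) ^ 2 * (δ:ℝ≥0∞) ^ 2) := by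
    intro a
    obtain ⟨M, hM⟩ := exists_norm_lpk_le (n := n) hψ a
    have hm := (continuous_lpk (n := n) hψ a).measurable
    calc _ ≤ ∫⁻ x, (2 * ‖cv β (lpk n ψ a) x‖ₑ ^ 2 + 2 * ‖cv (fun y => α y - β y) (lpk n ψ a) x‖ₑ ^ 2) := by
          refine lintegral_mono fun x => ?_
          simp only
          rw [cv_sub hα1 hβi hm hM]
          exact enorm_sq_add_le_of_sub _ _
      _ = 2 * (∫⁻ x, ‖cv β (lpk n ψ a) x‖ₑ ^ 2) +
            2 * ∫⁻ x, ‖cv (fun y => α y - β y) (lpk n ψ a) x‖ₑ ^ 2 := by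
          have m1 := measurable_cv hβm hm
          have m2 := measurable_cv (hα.sub hβm) hm
          rw [lintegral_add_left (by fun_prop), lintegral_const_mul _ (by fun_prop),
            lintegral_const_mul' _ _ (by norm_num)]
      _ ≤ _ := by
          gcongr
          calc _ ≤ ∫⁻ x, lcv (fun y => ‖α y - β y‖ₑ) (fun y => ‖lpk n ψ a y‖ₑ) x ^ 2 := by
                gcongr with x; exact enorm_cv_le _ _ _
            _ ≤ _ := (lintegral_lcv_sq (by fun_prop) (by fun_prop))
            _ ≤ _ := by gcongr; exact hC a
  calc ∑ a ∈ s, ∫⁻ x, ‖cv α (lpk n ψ a) x‖ₑ ^ 2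
      ≤ ∑ a ∈ s, (2 * (∫⁻ x, ‖cv β (lpk n ψ a) x‖ₑ ^ 2) + 2 * ((C:ℝ≥0∞) ^ 2 * (δ:ℝ≥0∞) ^ 2)) :=
        Finset.sum_le_sum fun a _ => e1 a
    _ = 2 * (∑ a ∈ s, ∫⁻ x, ‖cv β (lpk n ψ a) x‖ₑ ^ 2) + 2 * (s.card * (C:ℝ≥0∞) ^ 2) * (δ:ℝ≥0∞) ^ 2 := by
        rw [Finset.sum_add_distrib, Finset.mul_sum, Finset.sum_const, nsmul_eq_mul]; ring
    _ ≤ 2 * (∫⁻ x, ‖β x‖ₑ ^ 2) + 2 * (s.card * (C:ℝ≥0∞) ^ 2) * (δ:ℝ≥0∞) ^ 2 := by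
        gcongr
        exact (ENNReal.sum_le_tsum s).trans (tsum_lintegral_cv_lpk_schwartz_le hψ β)
    _ ≤ 2 * (2 * (∫⁻ x, ‖α x‖ₑ ^ 2) + 2 * (δ:ℝ≥0∞) ^ 2) + 2 * (s.card * (C:ℝ≥0∞) ^ 2) * (δ:ℝ≥0∞) ^ 2 := by
        gcongr
        calc _ ≤ ∫⁻ x, (2 * ‖α x‖ₑ ^ 2 + 2 * ‖α x - β x‖ₑ ^ 2) := by
              refine lintegral_mono fun x => ?_
              have := enorm_sq_add_le_of_sub (β x) (α x)
              rwa [enorm_sub_rev] at this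
          _ = 2 * (∫⁻ x, ‖α x‖ₑ ^ 2) + 2 * ∫⁻ x, ‖α x - β x‖ₑ ^ 2 := by
              rw [lintegral_add_left (by fun_prop), lintegral_const_mul _ (by fun_prop),
                lintegral_const_mul' _ _ (by norm_num)]
          _ ≤ _ := by gcongr
    _ = 4 * (∫⁻ x, ‖α x‖ₑ ^ 2) + ((4:ℝ≥0∞) + 2 * (s.card * (C:ℝ≥0∞) ^ 2)) * (δ:ℝ≥0∞) ^ 2 := by ring
    _ ≤ _ := by gcongr

end SquareFunction

section Scales
variable {n : ℕ} {Γ : ℝ → ℝ} {K : Rn n → ℝ} {ψ : ℝ → ℝ}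

lemma IsGammaU.exists_scale_bounds (hΓ : IsGammaU Γ) : ∃ D : ℝ, 1 ≤ D ∧ ∀ l m : ℤ, ∀ j ∈ Slm Γ l m,
    (2:ℝ) ^ (m + l) / D ≤ 2 ^ j * Γ (2 ^ (l + kstar Γ j)) ∧
      2 ^ j * Γ (2 ^ (l + kstar Γ j)) ≤ 2 * (2:ℝ) ^ (m + l) := by
  obtain ⟨D, hD1, hD⟩ := hΓ.exists_doubling
  refine ⟨D, hD1, fun l m j hj => ?_⟩
  have h0 : (0:ℝ) < 2 ^ kstar Γ j := by positivity
  have hg := hΓ.pos h0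
  obtain ⟨h1, h2⟩ := hj
  rw [le_div_iff₀ hg] at h1
  rw [div_lt_iff₀ hg] at h2
  obtain ⟨h3, h4⟩ := hΓ.kstar_spec j
  have h5 := hD _ h0
  rw [← zpow_one_add₀ (by norm_num : (2:ℝ) ≠ 0), add_comm] at h5
  have h6 : (1:ℝ) ≤ D * (2 ^ j * Γ (2 ^ kstar Γ j)) := by
    have : (0:ℝ) < 2 ^ j := by positivity
    nlinarith
  have hj0 : (0:ℝ) < 2 ^ j := by positivity
  have hl0 : (0:ℝ) < 2 ^ (m + l) := by positivity
  constructor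
  · rw [div_le_iff₀ (by linarith)]
    have := mul_le_mul_of_nonneg_left h1 hj0.le
    nlinarith
  · have := mul_le_mul_of_nonneg_left h2.le hj0.le
    rw [zpow_add_one₀ (by norm_num)] at this
    nlinarith

lemma exists_cv_hker_sq_scale (hΓ : IsGammaU Γ) (hK : IsHomCZKernel n K) (hψ : IsLPCutoff ψ) :
    ∃ C : ℝ≥0, ∀ l m : ℤ, ∀ j ∈ Slm Γ l m, ∀ u ≥ (1/2 : ℝ), ∀ a : Rn n → ℂ, Measurable a →
      Integrable a → ∫⁻ x, ‖cv a (hker Γ K ψ (2 ^ j * u) (l + kstar Γ j)) x‖ₑ ^ 2 ≤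
        C * ENNReal.ofReal (((2:ℝ) ^ (m + l))⁻¹ ^ n) * ∫⁻ x, ‖a x‖ₑ ^ 2 := by
  obtain ⟨D, hD1, hD⟩ := hΓ.exists_scale_bounds
  obtain ⟨C, hC⟩ := exists_hker_sq_le hΓ hK hψ
  refine ⟨C * ((2 * D) ^ n).toNNReal, fun l m j hj u hu a ha hai => ?_⟩
  refine (hC _ (by positivity) _ a ha hai).trans ?_
  refine mul_le_mul' ?_ le_rfl
  rw [ENNReal.coe_mul, mul_assoc (C : ℝ≥0∞)]
  refine mul_le_mul' le_rfl ?_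
  rw [← ENNReal.ofReal, ← ENNReal.ofReal_mul (by positivity), ← mul_pow]
  have h1 := (hD l m j hj).1
  have h2 : (0:ℝ) < 2 ^ (m + l) := by positivity
  have h3 : (2:ℝ) ^ (m + l) / (2 * D) ≤ 2 ^ j * u * Γ (2 ^ (l + kstar Γ j)) := by
    have h4 : (0:ℝ) < 2 ^ j * Γ (2 ^ (l + kstar Γ j)) := lt_of_lt_of_le (by positivity) h1
    calc (2:ℝ) ^ (m + l) / (2 * D) = (2:ℝ) ^ (m + l) / D * (1/2) := by field_simp
      _ ≤ 2 ^ j * Γ (2 ^ (l + kstar Γ j)) * u := by gcongr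
      _ = _ := by ring
  gcongr
  · have := lt_of_lt_of_le (by positivity) h3
    positivity
  rw [inv_le_comm₀ (lt_of_lt_of_le (by positivity) h3) (by positivity)]
  refine le_trans (le_of_eq ?_) h3
  field_simp

lemma exists_cv_hker_diff_scale (hΓ : IsGammaU Γ) (hK : IsHomCZKernel n K) (hψ : IsLPCutoff ψ) :
    ∃ C : ℝ, 0 ≤ C ∧ ∀ l m k : ℤ, |k - m| ≤ 1 → ∀ j ∈ Slm Γ l m, ∀ (u u' : ℝ) (a : Rn n → ℂ),
      Integrable a → ∀ (c : Rn n) (w : ℝ), 0 ≤ w → w ≤ 2 ^ (l + kstar Γ j) / 8 →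
      (∀ y, a y ≠ 0 → ‖y - c‖ ≤ w) → ∀ x,
      ‖cv a (hker Γ K ψ (2 ^ j * u) (l + kstar Γ j)) x‖ₑ ≤
        ‖cv a (hker Γ K ψ (2 ^ j * u') (l + kstar Γ j)) x‖ₑ +
        ENNReal.ofReal (C * |u - u'| * (w * 2 ^ (k - kstar Γ j))) *
          lcv (fun y => ‖a y‖ₑ) (avgKer n ((2:ℝ) ^ (l + kstar Γ j))) x := by
  obtain ⟨D, hD1, hD⟩ := hΓ.exists_scale_bounds
  obtain ⟨C, hC0, hC⟩ := exists_cv_hker_diff_le hΓ hK hψ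
  refine ⟨C * 4, by positivity, fun l m k hkm j hj u u' a ha c w hw0 hw hs x => ?_⟩
  refine (hC _ (2 ^ j * u') _ a ha c w hw0 hw hs x).trans ?_
  refine add_le_add le_rfl (mul_le_mul' (ENNReal.ofReal_le_ofReal ?_) le_rfl)
  have h1 := (hD l m j hj).2
  have h2 : (0:ℝ) < 2 ^ j := by positivity
  rw [← mul_sub, abs_mul, abs_of_pos h2]
  have h3 : (2:ℝ) ^ (m + l) / 2 ^ (l + kstar Γ j) ≤ 2 * 2 ^ (k - kstar Γ j) := by
    rw [← zpow_sub₀ (by norm_num), ← zpow_one_add₀ (by norm_num)]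
    refine zpow_le_zpow_right₀ (by norm_num) ?_
    have := abs_le.1 hkm
    omega
  calc C * (2 ^ j * |u - u'|) * Γ (2 ^ (l + kstar Γ j)) * (w / 2 ^ (l + kstar Γ j))
      = C * |u - u'| * (2 ^ j * Γ (2 ^ (l + kstar Γ j))) * (w / 2 ^ (l + kstar Γ j)) := by ring
    _ ≤ C * |u - u'| * (2 * (2:ℝ) ^ (m + l)) * (w / 2 ^ (l + kstar Γ j)) := by gcongr
    _ = C * |u - u'| * 2 * w * ((2:ℝ) ^ (m + l) / 2 ^ (l + kstar Γ j)) := by ring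
    _ ≤ C * |u - u'| * 2 * w * (2 * 2 ^ (k - kstar Γ j)) := by gcongr
    _ = _ := by ring

lemma volume_closedBall_eq (c : Rn n) {r : ℝ} (hr : 0 ≤ r) :
    volume (Metric.closedBall c r) = ENNReal.ofReal (r ^ n) * volume (Metric.closedBall (0 : Rn n) 1) := by
  rw [Measure.addHaar_closedBall _ _ hr, Measure.addHaar_unitClosedBall_eq_addHaar_unitBall,
    finrank_euclideanSpace, Fintype.card_fin]

lemma volume_unitBall_ne_top : volume (Metric.closedBall (0 : Rn n) 1) ≠ ∞ :=
  measure_closedBall_lt_top.ne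

/-- Cauchy–Schwarz on a set of finite measure. -/
lemma lintegral_sq_le_of_support {α : Type*} [MeasurableSpace α] {μ : Measure α} {f : α → ℝ≥0∞}
    (hf : AEMeasurable f μ) {s : Set α} (hs : MeasurableSet s) (h : ∀ x ∉ s, f x = 0) :
    (∫⁻ x, f x ∂μ) ^ 2 ≤ μ s * ∫⁻ x, f x ^ 2 ∂μ := by
  have h1 : ∀ x, f x = s.indicator 1 x * f x := fun x => by
    by_cases hx : x ∈ s
    · simp [hx]
    · simp [hx, h x hx]
  have h2 : ∀ x, s.indicator (1 : α → ℝ≥0∞) x ^ 2 = s.indicator 1 x := fun x => by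
    by_cases hx : x ∈ s <;> simp [hx]
  calc _ = (∫⁻ x, s.indicator 1 x * f x ∂μ) ^ 2 := by congr 2; exact funext h1
    _ ≤ (∫⁻ x, s.indicator (1 : α → ℝ≥0∞) x ^ 2 ∂μ) * ∫⁻ x, f x ^ 2 ∂μ :=
        lintegral_mul_sq_le (measurable_one.indicator hs).aemeasurable hf
    _ = _ := by simp_rw [h2]; rw [lintegral_indicator_one hs]

lemma cv_hker_eq_zero (hψ : IsLPCutoff ψ) {a : Rn n → ℂ} {c : Rn n} {w : ℝ}
    (hs : ∀ y, a y ≠ 0 → ‖y - c‖ ≤ w) (u : ℝ) (l : ℤ) {x : Rn n}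
    (hx : w + 2 * 2 ^ l < ‖x - c‖) : cv a (hker Γ K ψ u l) x = 0 := by
  rw [cv, integral_eq_zero_of_ae]
  refine ae_of_all _ fun t => ?_
  by_contra h
  have h1 := hs _ (left_ne_zero_of_mul h)
  have h2 := (hker_ne_zero hψ (right_ne_zero_of_mul h)).2
  have : ‖x - c‖ ≤ ‖x - t - c‖ + ‖t‖ := by
    calc ‖x - c‖ = ‖(x - t - c) + t‖ := by congr 1; abel
      _ ≤ _ := norm_add_le _ _
  linarith

end Scales

section Far
variable {n : ℕ} {Γ : ℝ → ℝ} {K : Rn n → ℝ} {ψ : ℝ → ℝ}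

lemma ENNReal.le_rpow_half_of_sq_le {a b : ℝ≥0∞} (h : a ^ 2 ≤ b) : a ≤ b ^ (1/2 : ℝ) := by
  have := ENNReal.rpow_le_rpow h (show (0:ℝ) ≤ 1/2 by norm_num)
  rw [← ENNReal.rpow_natCast, ← ENNReal.rpow_mul] at this
  simpa using this

lemma ENNReal.rpow_half_sq (a : ℝ≥0∞) : (a ^ (1/2 : ℝ)) ^ 2 = a := by
  rw [← ENNReal.rpow_natCast, ← ENNReal.rpow_mul]; norm_num

/-- Control of all modulations `u ∈ [1/2, 4]` at once for functions supported in a ball that is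
small compared with the scale of the kernel. -/
theorem exists_far_majorant (hn : 2 ≤ n) (hΓ : IsGammaU Γ) (hK : IsHomCZKernel n K)
    (hψ : IsLPCutoff ψ) :
    ∃ C : ℝ≥0, ∀ l m k : ℤ, |k - m| ≤ 1 → ∀ j ∈ Slm Γ l m, ∀ a : Rn n → ℂ, Measurable a →
      Integrable a → ∀ (c : Rn n) (w : ℝ), 0 < w → 1 ≤ w * 2 ^ (k - kstar Γ j) →
      2 * w ≤ 2 ^ (l + kstar Γ j) / 8 → (∀ y, a y ≠ 0 → ‖y - c‖ ≤ 2 * w) →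
      ∃ γ : Rn n → ℝ≥0∞, Measurable γ ∧
        (∀ u ∈ Icc (1/2 : ℝ) 4, ∀ x, ‖cv a (hker Γ K ψ (2 ^ j * u) (l + kstar Γ j)) x‖ₑ ≤ γ x) ∧
        ∫⁻ x, γ x ≤ C * (ENNReal.ofReal ((w * 2 ^ (k - kstar Γ j)) ^ (-(1/2) : ℝ)) * (∫⁻ x, ‖a x‖ₑ) +
          ENNReal.ofReal ((w * 2 ^ (k - kstar Γ j)) ^ (-(1/4) : ℝ)) *
            (ENNReal.ofReal (w ^ n) * ∫⁻ x, ‖a x‖ₑ ^ 2) ^ (1/2 : ℝ)) := by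
  obtain ⟨C2, hC2⟩ := exists_cv_hker_sq_scale hΓ hK hψ
  obtain ⟨C3, hC30, hC3⟩ := exists_cv_hker_diff_scale hΓ hK hψ
  set V := volume (Metric.closedBall (0 : Rn n) 1) with hV
  have hVt : V ≠ ∞ := volume_unitBall_ne_top
  set V2 := volume (Metric.closedBall (0 : Rn n) 2) with hV2
  have hV2t : V2 ≠ ∞ := measure_closedBall_lt_top.ne
  set E1 : ℝ≥0∞ := ENNReal.ofReal (8 * C3) * V2 with hE1
  set E2 : ℝ≥0∞ := ENNReal.ofReal (2 * 6 ^ n) * (V * C2) with hE2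
  have hE1t : E1 ≠ ∞ := ENNReal.mul_ne_top ENNReal.ofReal_ne_top hV2t
  have hE2t : E2 ^ (1/2 : ℝ) ≠ ∞ := ENNReal.rpow_ne_top_of_nonneg (by norm_num)
    (ENNReal.mul_ne_top ENNReal.ofReal_ne_top (ENNReal.mul_ne_top hVt ENNReal.coe_ne_top))
  refine ⟨(E1 + E2 ^ (1/2 : ℝ)).toNNReal, fun l m k hkm j hj a ha hai c w hw hs1 hw2 hsupp => ?_⟩
  rw [ENNReal.coe_toNNReal (ENNReal.add_ne_top.2 ⟨hE1t, hE2t⟩)]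
  set s := w * 2 ^ (k - kstar Γ j) with hs
  set R := (2:ℝ) ^ (l + kstar Γ j) with hR
  have hR0 : 0 < R := by positivity
  have hs0 : 0 < s := by positivity
  set N := ⌈s ^ (3/2 : ℝ)⌉₊ with hN
  have hs32 : 1 ≤ s ^ (3/2 : ℝ) := Real.one_le_rpow hs1 (by norm_num)
  have hN1 : s ^ (3/2 : ℝ) ≤ N := Nat.le_ceil _
  have hN2 : (N:ℝ) ≤ 2 * s ^ (3/2 : ℝ) := by
    have := Nat.ceil_lt_add_one (show 0 ≤ s ^ (3/2 : ℝ) by positivity)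
    linarith
  have hN0 : (0:ℝ) < N := by linarith
  let U : ℕ → ℝ := fun q => 1/2 + 4 * q / N
  let T : ℕ → Rn n → ℂ := fun q => cv a (hker Γ K ψ (2 ^ j * U q) (l + kstar Γ j))
  have hT : ∀ q, Measurable (T q) := fun q => measurable_cv ha (measurable_hker hΓ hK hψ _ _)
  let G : Rn n → ℝ≥0∞ := fun x => (∑ q ∈ Finset.range N, ‖T q x‖ₑ ^ 2) ^ (1/2 : ℝ)
  have hG : Measurable G := by
    have : ∀ q, Measurable fun x => ‖T q x‖ₑ ^ 2 := fun q => (hT q).enorm.pow_const 2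
    exact (Finset.measurable_fun_sum _ fun q _ => this q).pow_const _
  set e : ℝ≥0∞ := ENNReal.ofReal (8 * C3 * s ^ (-(1/2) : ℝ)) with he
  have havg := measurable_avgKer (n := n) R
  have hlm : Measurable (lcv (fun y => ‖a y‖ₑ) (avgKer n R)) := measurable_lcv ha.enorm havg
  refine ⟨fun x => G x + e * lcv (fun y => ‖a y‖ₑ) (avgKer n R) x, hG.add (hlm.const_mul e), ?_, ?_⟩
  · intro u hu x
    set q := ⌊(u - 1/2) * N / 4⌋₊ with hq
    have h0 : 0 ≤ (u - 1/2) * N / 4 := by have := hu.1; have : 0 ≤ u - 1/2 := by linarith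
                                          positivity
    have hq1 : (q:ℝ) ≤ (u - 1/2) * N / 4 := Nat.floor_le h0
    have hq2 : (u - 1/2) * N / 4 < q + 1 := Nat.lt_floor_add_one _
    have hqN : q < N := by
      have : (q:ℝ) < N := by
        have := hu.2
        nlinarith
      exact_mod_cast this
    have hUq : |u - U q| ≤ 4 / N := by
      have e1 : u - U q = ((u - 1/2) * N / 4 - q) * (4 / N) := by
        simp only [U]; field_simp; ring
      rw [e1, abs_of_nonneg (mul_nonneg (by linarith) (by positivity))]
      have : (u - 1/2) * N / 4 - q ≤ 1 := by linarith
      calc _ ≤ 1 * (4 / (N:ℝ)) := by gcongr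
        _ = _ := one_mul _
    refine (hC3 l m k hkm j hj u (U q) a hai c (2 * w) (by positivity) hw2 hsupp x).trans ?_
    refine add_le_add ?_ (mul_le_mul' (ENNReal.ofReal_le_ofReal ?_) le_rfl)
    · refine ENNReal.le_rpow_half_of_sq_le ?_
      exact Finset.single_le_sum (f := fun q => ‖T q x‖ₑ ^ 2) (fun _ _ => zero_le) (Finset.mem_range.2 hqN)
    · have h1 : s / N ≤ s ^ (-(1/2) : ℝ) := by
        rw [div_le_iff₀ hN0]
        calc s = s ^ (-(1/2) : ℝ) * s ^ (3/2 : ℝ) := by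
              rw [← Real.rpow_add hs0]; norm_num
          _ ≤ _ := by gcongr
      calc C3 * |u - U q| * (2 * w * 2 ^ (k - kstar Γ j)) ≤ C3 * (4 / N) * (2 * w * 2 ^ (k - kstar Γ j)) := by
            gcongr
        _ = 8 * C3 * (s / N) := by rw [hs]; ring
        _ ≤ _ := by gcongr
  · have hGs : ∀ x ∉ Metric.closedBall c (3 * R), G x = 0 := by
      intro x hx
      rw [mem_closedBall_iff_norm, not_le] at hx
      have : ∀ q, T q x = 0 := fun q => cv_hker_eq_zero hψ hsupp _ _ (by rw [← hR]; linarith)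
      simp [G, this]
    have hG2 : ∫⁻ x, G x ^ 2 ≤ N * (C2 * ENNReal.ofReal (((2:ℝ) ^ (m + l))⁻¹ ^ n) * ∫⁻ x, ‖a x‖ₑ ^ 2) := by
      simp only [G, ENNReal.rpow_half_sq]
      rw [lintegral_finsetSum _ fun q _ => (hT q).enorm.pow_const 2]
      refine (Finset.sum_le_card_nsmul _ _ (C2 * ENNReal.ofReal (((2:ℝ) ^ (m + l))⁻¹ ^ n) *
        ∫⁻ x, ‖a x‖ₑ ^ 2) fun q _ => hC2 l m j hj (U q) ?_ a ha hai).trans ?_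
      · have : (0:ℝ) ≤ 4 * q / N := by positivity
        simp only [U, ge_iff_le]; linarith
      · simp
    have hreal : (3 * R) ^ n * N * ((2:ℝ) ^ (m + l))⁻¹ ^ n ≤ 2 * 6 ^ n * (s ^ (-(1/2) : ℝ) * w ^ n) := by
      have h1 : R * ((2:ℝ) ^ (m + l))⁻¹ ≤ 2 * (w / s) := by
        have : w / s = 2 ^ (kstar Γ j - k) := by
          rw [hs, ← div_div, div_self hw.ne', one_div, ← zpow_neg]; congr 1; ring
        rw [this, hR, ← zpow_neg, ← zpow_add₀ (by norm_num), ← zpow_one_add₀ (by norm_num)]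
        refine zpow_le_zpow_right₀ (by norm_num) ?_
        have := abs_le.1 hkm
        omega
      calc (3 * R) ^ n * N * ((2:ℝ) ^ (m + l))⁻¹ ^ n = 3 ^ n * (R * ((2:ℝ) ^ (m + l))⁻¹) ^ n * N := by
            rw [mul_pow, mul_pow]; ring
        _ ≤ 3 ^ n * (2 * (w / s)) ^ n * (2 * s ^ (3/2 : ℝ)) := by gcongr
        _ = 2 * 6 ^ n * ((s ^ (3/2 : ℝ) * (s ^ n)⁻¹) * w ^ n) := by
            rw [mul_pow, div_pow, show (6:ℝ) = 3 * 2 by norm_num, mul_pow 3 2]; ring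
        _ ≤ _ := by
            gcongr
            rw [← Real.rpow_natCast, ← Real.rpow_neg hs0.le, ← Real.rpow_add hs0]
            refine Real.rpow_le_rpow_of_exponent_le hs1 ?_
            have : (2:ℝ) ≤ n := by exact_mod_cast hn
            linarith
    have hG1 : ∫⁻ x, G x ≤ E2 ^ (1/2 : ℝ) * (ENNReal.ofReal (s ^ (-(1/4) : ℝ)) *
        (ENNReal.ofReal (w ^ n) * ∫⁻ x, ‖a x‖ₑ ^ 2) ^ (1/2 : ℝ)) := by
      have h1 := lintegral_sq_le_of_support (μ := volume) hG.aemeasurable Metric.isClosed_closedBall.measurableSet hGs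
      have h2 : (∫⁻ x, G x) ^ 2 ≤ E2 * (ENNReal.ofReal (s ^ (-(1/2) : ℝ)) *
          (ENNReal.ofReal (w ^ n) * ∫⁻ x, ‖a x‖ₑ ^ 2)) := by
        refine h1.trans ?_
        rw [volume_closedBall_eq c (by positivity)]
        calc _ ≤ ENNReal.ofReal ((3 * R) ^ n) * V * (N * (C2 * ENNReal.ofReal (((2:ℝ) ^ (m + l))⁻¹ ^ n) *
              ∫⁻ x, ‖a x‖ₑ ^ 2)) := by gcongr
          _ = (ENNReal.ofReal ((3 * R) ^ n) * ENNReal.ofReal N * ENNReal.ofReal (((2:ℝ) ^ (m + l))⁻¹ ^ n)) *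
              (V * C2 * ∫⁻ x, ‖a x‖ₑ ^ 2) := by rw [ENNReal.ofReal_natCast]; ring
          _ ≤ ENNReal.ofReal (2 * 6 ^ n * (s ^ (-(1/2) : ℝ) * w ^ n)) * (V * C2 * ∫⁻ x, ‖a x‖ₑ ^ 2) := by
              rw [← ENNReal.ofReal_mul (by positivity), ← ENNReal.ofReal_mul (by positivity)]
              gcongr
          _ = _ := by
              rw [ENNReal.ofReal_mul (p := 2 * 6 ^ n) (by positivity),
                ENNReal.ofReal_mul (p := s ^ (-(1/2) : ℝ)) (by positivity), hE2]; ring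
      refine (ENNReal.le_rpow_half_of_sq_le h2).trans (le_of_eq ?_)
      rw [ENNReal.mul_rpow_of_nonneg E2 _ (by norm_num),
        ENNReal.mul_rpow_of_nonneg (ENNReal.ofReal (s ^ (-(1/2) : ℝ))) _ (by norm_num),
        ENNReal.ofReal_rpow_of_pos (by positivity), ← Real.rpow_mul hs0.le]
      norm_num
    rw [lintegral_add_left hG, lintegral_const_mul _ hlm, lintegral_lcv ha.enorm havg,
      lintegral_avgKer hR0, he, ENNReal.ofReal_mul (by positivity), add_comm, mul_add]
    refine add_le_add ?_ (hG1.trans (mul_le_mul' le_add_self le_rfl))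
    calc _ = E1 * (ENNReal.ofReal (s ^ (-(1/2) : ℝ)) * ∫⁻ x, ‖a x‖ₑ) := by rw [hE1]; ring
      _ ≤ _ := mul_le_mul' le_self_add le_rfl

end Far

section AtomLP
variable {n : ℕ} {ψ : ℝ → ℝ}

/-- Low frequency pieces of an atom are small by cancellation. -/
lemma exists_lintegral_cv_lpk_cancel_le (hψ : IsLPCutoff ψ) : ∃ C : ℝ≥0, ∀ (a : ℤ) (α : Rn n → ℂ),
    Measurable α → Integrable α → ∫ y, α y = 0 → ∀ (c : Rn n) (w : ℝ),
    (∀ y, α y ≠ 0 → ‖y - c‖ ≤ w) →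
    ∫⁻ x, ‖cv α (lpk n ψ a) x‖ₑ ≤ C * ENNReal.ofReal (2 ^ a * w) * ∫⁻ y, ‖α y‖ₑ := by
  obtain ⟨C, hC⟩ := exists_lintegral_lpk_sub_le (n := n) hψ
  refine ⟨C, fun a α hα hαi h0 c w hs => ?_⟩
  have hκ := (continuous_lpk (n := n) hψ a).measurable
  obtain ⟨M, hM⟩ := exists_norm_lpk_le (n := n) hψ a
  have hp : ∀ x, ‖cv α (lpk n ψ a) x‖ₑ ≤
      ∫⁻ y, ‖α y‖ₑ * ‖lpk n ψ a (x - y) - lpk n ψ a (x - c)‖ₑ := by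
    intro x
    have h1 : cv α (lpk n ψ a) x = ∫ y, α y * (lpk n ψ a (x - y) - lpk n ψ a (x - c)) := by
      simp only [mul_sub]
      rw [integral_sub _ (hαi.mul_const _), integral_mul_const, h0, zero_mul, sub_zero, cv_eq]
      exact hαi.mul_bdd (hκ.comp (by fun_prop)).aestronglyMeasurable (ae_of_all _ fun y => hM _)
    rw [h1]
    refine (enorm_integral_le_lintegral_enorm _).trans (le_of_eq ?_)
    simp [enorm_mul]
  have hm : Measurable fun q : Rn n × Rn n =>
      ‖α q.2‖ₑ * ‖lpk n ψ a (q.1 - q.2) - lpk n ψ a (q.1 - c)‖ₑ := by fun_prop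
  refine (lintegral_mono hp).trans ?_
  rw [lintegral_lintegral_swap hm.aemeasurable, ← lintegral_const_mul _ (by fun_prop)]
  refine lintegral_mono fun y => ?_
  rw [lintegral_const_mul _ (by fun_prop), mul_comm]
  by_cases hy : α y = 0
  · simp [hy]
  refine mul_le_mul' ?_ le_rfl
  have h2 := lintegral_sub_right_eq_self (μ := (volume : Measure (Rn n)))
    (fun x => ‖lpk n ψ a (x - (y - c)) - lpk n ψ a x‖ₑ) c
  have h3 : ∀ x, x - c - (y - c) = x - y := fun x => by abel
  simp only [h3] at h2
  rw [h2]
  refine (hC a _).trans ?_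
  gcongr
  exact hs y hy

/-- High frequency pieces of an atom are concentrated near its support. -/
lemma exists_lintegral_cv_lpk_tail_le (hψ : IsLPCutoff ψ) : ∃ C : ℝ≥0, ∀ (a : ℤ) (α : Rn n → ℂ),
    Measurable α → ∀ (c : Rn n) (w : ℝ), 0 < w → (∀ y, α y ≠ 0 → ‖y - c‖ ≤ w) →
    ∫⁻ x in {x | 2 * w < ‖x - c‖}, ‖cv α (lpk n ψ a) x‖ₑ ≤
      C * ENNReal.ofReal ((2 ^ a * w)⁻¹) * ∫⁻ y, ‖α y‖ₑ := by
  obtain ⟨C, hC⟩ := exists_lintegral_lpk_tail_le (n := n) hψ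
  refine ⟨C, fun a α hα c w hw hs => ?_⟩
  have hκ := (continuous_lpk (n := n) hψ a).measurable
  have hp : ∀ x, ‖cv α (lpk n ψ a) x‖ₑ ≤ ∫⁻ y, ‖α y‖ₑ * ‖lpk n ψ a (x - y)‖ₑ := by
    intro x
    refine (enorm_cv_le _ _ _).trans (le_of_eq ?_)
    rw [lcv_eq]
  have hm : Measurable fun q : Rn n × Rn n => ‖α q.2‖ₑ * ‖lpk n ψ a (q.1 - q.2)‖ₑ := by fun_prop
  refine (lintegral_mono hp).trans ?_
  rw [lintegral_lintegral_swap hm.aemeasurable, ← lintegral_const_mul _ (by fun_prop)]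
  refine lintegral_mono fun y => ?_
  rw [lintegral_const_mul _ (by fun_prop), mul_comm]
  by_cases hy : α y = 0
  · simp [hy]
  refine mul_le_mul' ?_ le_rfl
  have hS : ∀ z : Rn n, ∀ s : ℝ, MeasurableSet {x : Rn n | s < ‖x - z‖} := fun z s =>
    measurableSet_lt measurable_const (by fun_prop)
  have hS0 : ∀ s : ℝ, MeasurableSet {x : Rn n | s < ‖x‖} := fun s =>
    measurableSet_lt measurable_const (by fun_prop)
  calc ∫⁻ x in {x | 2 * w < ‖x - c‖}, ‖lpk n ψ a (x - y)‖ₑ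
      ≤ ∫⁻ x in {x | w < ‖x - y‖}, ‖lpk n ψ a (x - y)‖ₑ := by
        refine lintegral_mono_set fun x hx => ?_
        have h1 := hs y hy
        have h2 := norm_sub_le_norm_sub_add_norm_sub x y c
        simp only [mem_ofPred_eq] at hx ⊢
        linarith
    _ = ∫⁻ x in {x | w < ‖x‖}, ‖lpk n ψ a x‖ₑ := by
        rw [← lintegral_indicator (hS y w), ← lintegral_indicator (hS0 w),
          ← lintegral_sub_right_eq_self ({x | w < ‖x‖}.indicator fun x => ‖lpk n ψ a x‖ₑ) y]
        rfl
    _ ≤ _ := hC a w hw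

/-- The dyadic sum of `min(s, 1/s)^{1/4}`. -/
lemma exists_tsum_min_zpow_le : ∃ C : ℝ≥0, ∀ t : ℝ, 0 < t →
    ∑' a : ℤ, ENNReal.ofReal ((min (2 ^ a * t) (2 ^ a * t)⁻¹) ^ (1/4 : ℝ)) ≤ C := by
  set θ : ℝ := 2 ^ (-(1/4) : ℝ) with hθ
  have hθ0 : 0 < θ := by positivity
  have hθ1 : θ < 1 := Real.rpow_lt_one_of_one_lt_of_neg (by norm_num) (by norm_num)
  have hsum : Summable fun i : ℤ => 2 * θ ^ i.natAbs := by
    refine Summable.mul_left _ (Summable.of_nat_of_neg ?_ ?_) <;>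
    simpa using summable_geometric_of_lt_one hθ0.le hθ1
  refine ⟨(∑' i : ℤ, 2 * θ ^ i.natAbs).toNNReal, fun t ht => ?_⟩
  obtain ⟨b, hb1, hb2⟩ := exists_mem_Ico_zpow ht (show (1:ℝ) < 2 by norm_num)
  have hC : ((∑' i : ℤ, 2 * θ ^ i.natAbs).toNNReal : ℝ≥0∞) =
      ∑' i : ℤ, ENNReal.ofReal (2 * θ ^ i.natAbs) := by
    rw [← ENNReal.ofReal_tsum_of_nonneg (fun i => by positivity) hsum]; rfl
  rw [hC, ← (Equiv.addRight b).tsum_eq fun i : ℤ => ENNReal.ofReal (2 * θ ^ i.natAbs)]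
  refine ENNReal.tsum_le_tsum fun a => ENNReal.ofReal_le_ofReal ?_
  have h2 : (0:ℝ) < 2 ^ a := by positivity
  have hθp : ∀ N : ℕ, θ ^ N = ((2:ℝ)^(-(N:ℤ))) ^ (1/4 : ℝ) := fun N => by
    rw [hθ, ← Real.rpow_natCast, ← Real.rpow_mul (by norm_num), ← Real.rpow_intCast,
      ← Real.rpow_mul (by norm_num)]
    congr 1; push_cast; ring
  have h3 : min (2 ^ a * t) (2 ^ a * t)⁻¹ ≤ 2 * 2 ^ (-((a + b).natAbs : ℤ)) := by
    rcases le_total 0 (a + b) with h | h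
    · refine (min_le_right _ _).trans ?_
      rw [Int.natAbs_of_nonneg h, neg_add, zpow_add₀ (by norm_num), mul_inv, zpow_neg, zpow_neg]
      have : t⁻¹ ≤ (2 ^ b)⁻¹ := by gcongr
      have h5 : (0:ℝ) ≤ ((2:ℝ)^b)⁻¹ := by positivity
      calc _ ≤ ((2:ℝ) ^ a)⁻¹ * (2 ^ b)⁻¹ := by gcongr
        _ ≤ _ := le_mul_of_one_le_left (by positivity) (by norm_num)
    · refine (min_le_left _ _).trans ?_
      rw [Int.ofNat_natAbs_of_nonpos h, neg_neg, zpow_add₀ (by norm_num)]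
      have := zpow_add_one₀ (show (2:ℝ) ≠ 0 by norm_num) b
      nlinarith
  simp only [Equiv.coe_addRight]
  calc (min (2 ^ a * t) (2 ^ a * t)⁻¹) ^ (1/4 : ℝ)
      ≤ (2 * 2 ^ (-((a + b).natAbs : ℤ)) : ℝ) ^ (1/4 : ℝ) :=
        Real.rpow_le_rpow (le_min (by positivity) (by positivity)) h3 (by norm_num)
    _ = 2 ^ (1/4 : ℝ) * θ ^ (a + b).natAbs := by rw [Real.mul_rpow (by norm_num) (by positivity), hθp]
    _ ≤ _ := by
        gcongr
        calc (2:ℝ) ^ (1/4 : ℝ) ≤ 2 ^ (1:ℝ) := Real.rpow_le_rpow_of_exponent_le (by norm_num) (by norm_num)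
          _ = 2 := Real.rpow_one 2

end AtomLP

section AtomScale
variable {n : ℕ} {Γ : ℝ → ℝ} {K : Rn n → ℝ} {ψ : ℝ → ℝ}

lemma lintegral_enorm_pow_le_of_support {α : Rn n → ℂ} {h : ℝ≥0∞} (hh : ∀ y, ‖α y‖ₑ ≤ h) {c : Rn n}
    {w : ℝ} (hw : 0 ≤ w) (hs : ∀ y, α y ≠ 0 → ‖y - c‖ ≤ w) {p : ℕ} (hp : p ≠ 0) :
    ∫⁻ y, ‖α y‖ₑ ^ p ≤
      h ^ p * (ENNReal.ofReal (w ^ n) * volume (Metric.closedBall (0 : Rn n) 1)) := by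
  rw [← volume_closedBall_eq c hw, ← lintegral_indicator_const Metric.isClosed_closedBall.measurableSet]
  refine lintegral_mono fun y => ?_
  by_cases hy : α y = 0
  · simp [hy, hp]
  · rw [indicator_of_mem (by rw [mem_closedBall_iff_norm]; exact hs y hy)]
    gcongr
    exact hh y

lemma integrable_of_support {α : Rn n → ℂ} (hα : Measurable α) {h : ℝ≥0} (hh : ∀ y, ‖α y‖ₑ ≤ h)
    {c : Rn n} {w : ℝ} (hw : 0 ≤ w) (hs : ∀ y, α y ≠ 0 → ‖y - c‖ ≤ w) : Integrable α := by
  refine ⟨hα.aestronglyMeasurable, ?_⟩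
  have := lintegral_enorm_pow_le_of_support hh hw hs one_ne_zero
  simp only [pow_one] at this
  exact this.trans_lt (ENNReal.mul_lt_top ENNReal.coe_lt_top
    (ENNReal.mul_lt_top ENNReal.ofReal_lt_top volume_unitBall_ne_top.lt_top))

lemma integrable_cv_lpk (hψ : IsLPCutoff ψ) {α : Rn n → ℂ} (hα : Measurable α) (hαi : Integrable α)
    (a : ℤ) : Integrable (cv α (lpk n ψ a)) := by
  have hκ := (continuous_lpk (n := n) hψ a).measurable
  refine ⟨(measurable_cv hα hκ).aestronglyMeasurable, ?_⟩
  refine lt_of_le_of_lt (lintegral_mono (enorm_cv_le _ _)) ?_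
  rw [lintegral_lcv hα.enorm hκ.enorm]
  exact ENNReal.mul_lt_top hαi.2 (integrable_lpk hψ a).2

lemma exists_norm_hker_le (hΓ : IsGammaU Γ) (hK : IsHomCZKernel n K) (hψ : IsLPCutoff ψ) (l : ℤ) :
    ∃ M' : ℝ, ∀ u t, ‖hker Γ K ψ u l t‖ ≤ M' := by
  obtain ⟨M, hM⟩ := exists_hker_le hΓ hK hψ
  refine ⟨M * ((2:ℝ) ^ l)⁻¹ ^ n, fun u t => ?_⟩
  have h1 := hM u l t
  have h2 : avgKer n ((2:ℝ) ^ l) t ≤ ENNReal.ofReal (((2:ℝ) ^ l)⁻¹ ^ n) :=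
    indicator_le_self' (fun _ _ => zero_le) t
  have h3 := h1.trans (mul_le_mul' le_rfl h2)
  rw [← ofReal_norm, ← ENNReal.ofReal_coe_nnreal, ← ENNReal.ofReal_mul (by positivity)] at h3
  exact (ENNReal.ofReal_le_ofReal_iff (by positivity)).1 h3

lemma lcv_avgKer_eq_zero {b : Rn n → ℝ≥0∞} {c : Rn n} {w R : ℝ} (hs : ∀ y, b y ≠ 0 → ‖y - c‖ ≤ w)
    {x : Rn n} (hx : w + 2 * R < ‖x - c‖) : lcv b (avgKer n R) x = 0 := by
  rw [lcv]
  refine (lintegral_congr fun t => ?_).trans lintegral_zero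
  by_contra h
  obtain ⟨h1, h2⟩ := mul_ne_zero_iff.1 h
  have h3 := hs _ h1
  have h4 : ‖t‖ ≤ 2 * R := by
    have := mem_of_indicator_ne_zero h2
    rwa [mem_closedBall_zero_iff] at this
  have h5 : ‖x - c‖ ≤ ‖x - t - c‖ + ‖t‖ := by
    have := norm_add_le (x - t - c) t
    rwa [show x - t - c + t = x - c by abel] at this
  linarith

/-- A single scale acting on an atom. -/
theorem exists_atom_scale (hn : 2 ≤ n) (hΓ : IsGammaU Γ) (hK : IsHomCZKernel n K)
    (hψ : IsLPCutoff ψ) :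
    ∃ C : ℝ≥0, ∀ l m k : ℤ, |k - m| ≤ 1 → ∀ j ∈ Slm Γ l m, ∀ α : Rn n → ℂ, Measurable α →
      ∫ y, α y = 0 → ∀ (h : ℝ≥0) (c : Rn n) (w : ℝ), 0 < w → (∀ y, ‖α y‖ₑ ≤ h) →
      (∀ y, α y ≠ 0 → ‖y - c‖ ≤ w) →
      ∃ γ δ : Rn n → ℝ≥0∞, Measurable γ ∧ Measurable δ ∧
        (∀ u ∈ Icc (1/2 : ℝ) 4, ∀ x, ‖cv (cv α (lpk n ψ (k - kstar Γ j)))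
          (hker Γ K ψ (2 ^ j * u) (l + kstar Γ j)) x‖ₑ ≤ γ x + δ x) ∧
        ∫⁻ x, γ x ≤ C * ENNReal.ofReal ((min (2 ^ (k - kstar Γ j) * w)
          (2 ^ (k - kstar Γ j) * w)⁻¹) ^ (1/4 : ℝ)) * (h * ENNReal.ofReal (w ^ n)) ∧
        (∀ x ∉ Metric.closedBall c (34 * w), δ x = 0) ∧
        ∫⁻ x, δ x ^ 2 ≤ C * ∫⁻ x, ‖cv α (lpk n ψ (k - kstar Γ j)) x‖ₑ ^ 2 := by
  obtain ⟨M, hM⟩ := exists_hker_le hΓ hK hψ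
  obtain ⟨C0, hC0⟩ := exists_lintegral_lpk_le (n := n) hψ
  obtain ⟨CA, hCA⟩ := exists_lintegral_cv_lpk_cancel_le (n := n) hψ
  obtain ⟨CB, hCB⟩ := exists_lintegral_cv_lpk_tail_le (n := n) hψ
  obtain ⟨Cf, hCf⟩ := exists_far_majorant hn hΓ hK hψ
  obtain ⟨V, hV⟩ : ∃ V : ℝ≥0, volume (Metric.closedBall (0 : Rn n) 1) = V :=
    ⟨_, (ENNReal.coe_toNNReal volume_unitBall_ne_top).symm⟩
  obtain ⟨V2, hV2⟩ : ∃ V : ℝ≥0, volume (Metric.closedBall (0 : Rn n) 2) = V :=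
    ⟨_, (ENNReal.coe_toNNReal measure_closedBall_lt_top.ne).symm⟩
  refine ⟨M * CA * V * V2 + M * CB * V * V2 + Cf * (C0 * V + C0 * (V + 1)) + (M * V2) ^ 2,
    fun l m k hkm j hj α hα h0 h c w hw hh hs => ?_⟩
  set a := k - kstar Γ j with ha
  set R := (2:ℝ) ^ (l + kstar Γ j) with hR
  have hR0 : 0 < R := by positivity
  have hκ := (continuous_lpk (n := n) hψ a).measurable
  have hαi := integrable_of_support hα hh hw.le hs
  set β := cv α (lpk n ψ a) with hβ
  have hβm : Measurable β := measurable_cv hα hκ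
  have hβi : Integrable β := integrable_cv_lpk hψ hα hαi a
  set X : ℝ≥0∞ := h * ENNReal.ofReal (w ^ n) with hX
  have hA1 : ∫⁻ y, ‖α y‖ₑ ≤ V * X := by
    have := lintegral_enorm_pow_le_of_support hh hw.le hs one_ne_zero
    simp only [pow_one] at this
    rw [hV] at this
    exact this.trans_eq (by rw [hX]; ring)
  have hA2 := lintegral_enorm_pow_le_of_support hh hw.le hs two_ne_zero
  rw [hV] at hA2
  have hβ1 : ∫⁻ y, ‖β y‖ₑ ≤ C0 * V * X := by
    refine (lintegral_mono (enorm_cv_le _ _)).trans ?_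
    rw [lintegral_lcv hα.enorm hκ.enorm]
    calc _ ≤ V * X * C0 := mul_le_mul' hA1 (hC0 a)
      _ = _ := by ring
  have hβ2 : ENNReal.ofReal (w ^ n) * ∫⁻ y, ‖β y‖ₑ ^ 2 ≤ (C0 * (V + 1) * X) ^ 2 := by
    have h1 : ∫⁻ y, ‖β y‖ₑ ^ 2 ≤ C0 ^ 2 * (h ^ 2 * (ENNReal.ofReal (w ^ n) * V)) := by
      calc ∫⁻ y, ‖β y‖ₑ ^ 2 ≤ ∫⁻ x, lcv (fun y => ‖α y‖ₑ) (fun y => ‖lpk n ψ a y‖ₑ) x ^ 2 :=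
            lintegral_mono fun x => pow_le_pow_left' (enorm_cv_le _ _ x) 2
        _ ≤ _ := lintegral_lcv_sq hα.enorm hκ.enorm
        _ ≤ _ := mul_le_mul' (pow_le_pow_left' (hC0 a) 2) hA2
    have h2 : (V:ℝ≥0∞) ≤ (V + 1) ^ 2 := by
      rw [pow_two]
      exact le_self_add.trans (le_mul_of_one_le_right' le_add_self)
    calc _ ≤ ENNReal.ofReal (w ^ n) * (C0 ^ 2 * (h ^ 2 * (ENNReal.ofReal (w ^ n) * (V + 1) ^ 2))) := by
          refine mul_le_mul' le_rfl (h1.trans ?_); gcongr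
      _ = _ := by rw [hX]; ring
  have havg : ∀ b : Rn n → ℂ, Measurable b →
      Measurable (fun x => M * lcv (fun y => ‖b y‖ₑ) (avgKer n R) x) ∧
      ∫⁻ x, M * lcv (fun y => ‖b y‖ₑ) (avgKer n R) x = M * V2 * ∫⁻ y, ‖b y‖ₑ := fun b hb => by
    have h1 := measurable_lcv hb.enorm (measurable_avgKer (n := n) R)
    refine ⟨h1.const_mul _, ?_⟩
    rw [lintegral_const_mul _ h1, lintegral_lcv hb.enorm (measurable_avgKer (n := n) R),
      lintegral_avgKer hR0, hV2]
    ring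
  have hK1 := fun (b : Rn n → ℂ) (u : ℝ) (x : Rn n) => enorm_cv_hker_le hM b (2 ^ j * u) (l + kstar Γ j) x
  set s := (2:ℝ) ^ a * w with hsdef
  have hs0 : 0 < s := by positivity
  rcases le_or_gt s 1 with hs1 | hs1
  · refine ⟨_, fun _ => 0, (havg β hβm).1, measurable_const, fun u _ x => ?_, ?_, fun _ _ => rfl, by simp⟩
    · rw [add_zero]; exact hK1 β u x
    · rw [(havg β hβm).2]
      have h1 : s ≤ (min s s⁻¹) ^ (1/4 : ℝ) := by
        rw [min_eq_left (hs1.trans (one_le_inv_iff₀.2 ⟨hs0, hs1⟩))]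
        exact Real.self_le_rpow_of_le_one hs0.le hs1 (by norm_num)
      calc _ ≤ M * V2 * (CA * ENNReal.ofReal s * (V * X)) := by
            gcongr
            exact (hCA a α hα hαi h0 c w hs).trans (mul_le_mul' le_rfl hA1)
        _ = (M * CA * V * V2) * ENNReal.ofReal s * X := by ring
        _ ≤ _ := by
            refine mul_le_mul' (mul_le_mul' ?_ (ENNReal.ofReal_le_ofReal h1)) le_rfl
            push_cast
            rw [add_assoc, add_assoc]
            exact le_self_add
  have hmin : min s s⁻¹ = s⁻¹ := min_eq_right ((inv_le_one_of_one_le₀ hs1.le).trans hs1.le)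
  rw [hmin]
  have hsi : s⁻¹ ≤ (s⁻¹) ^ (1/4 : ℝ) := Real.self_le_rpow_of_le_one (by positivity)
    (inv_le_one_of_one_le₀ hs1.le) (by norm_num)
  have hB : MeasurableSet (Metric.closedBall c (2 * w)) := Metric.isClosed_closedBall.measurableSet
  set b := (Metric.closedBall c (2 * w)).indicator β with hb
  set t := (Metric.closedBall c (2 * w))ᶜ.indicator β with ht
  have hbm : Measurable b := hβm.indicator hB
  have htm : Measurable t := hβm.indicator hB.compl
  have hbi : Integrable b := hβi.indicator hB
  have hble : ∀ y, ‖b y‖ₑ ≤ ‖β y‖ₑ := fun y => enorm_indicator_le_enorm_self _ _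
  have hbs : ∀ y, b y ≠ 0 → ‖y - c‖ ≤ 2 * w := fun y hy => by
    rw [← mem_closedBall_iff_norm]; exact mem_of_indicator_ne_zero hy
  obtain ⟨M', hM'⟩ := exists_norm_hker_le hΓ hK hψ (l + kstar Γ j)
  have hsplit : ∀ u x, ‖cv β (hker Γ K ψ (2 ^ j * u) (l + kstar Γ j)) x‖ₑ ≤
      ‖cv b (hker Γ K ψ (2 ^ j * u) (l + kstar Γ j)) x‖ₑ +
      M * lcv (fun y => ‖t y‖ₑ) (avgKer n R) x := fun u x => by
    have h1 := cv_sub hβi hbi (measurable_hker hΓ hK hψ (2 ^ j * u) (l + kstar Γ j)) (hM' _) x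
    have h2 : (fun y => β y - b y) = t := by
      ext y
      by_cases hy : y ∈ Metric.closedBall c (2 * w)
      · rw [hb, ht, indicator_of_mem hy, indicator_of_notMem (by simpa using hy), sub_self]
      · rw [hb, ht, indicator_of_notMem hy, indicator_of_mem hy, sub_zero]
    rw [h2] at h1
    rw [show cv β (hker Γ K ψ (2 ^ j * u) (l + kstar Γ j)) x =
      cv b (hker Γ K ψ (2 ^ j * u) (l + kstar Γ j)) x + cv t (hker Γ K ψ (2 ^ j * u) (l + kstar Γ j)) x by
        rw [h1]; ring]
    exact (enorm_add_le _ _).trans (add_le_add le_rfl (hK1 t u x))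
  have htail : ∫⁻ x, M * lcv (fun y => ‖t y‖ₑ) (avgKer n R) x ≤
      (M * CB * V * V2) * ENNReal.ofReal ((s⁻¹) ^ (1/4 : ℝ)) * X := by
    have h1 : ∫⁻ y, ‖t y‖ₑ ≤ CB * ENNReal.ofReal (s⁻¹) * ∫⁻ y, ‖α y‖ₑ := by
      refine le_trans (le_of_eq ?_) (hCB a α hα c w hw hs)
      have hset : {x : Rn n | 2 * w < ‖x - c‖} = (Metric.closedBall c (2 * w))ᶜ := by
        ext x; simp [dist_eq_norm]
      rw [hset, ← lintegral_indicator hB.compl]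
      congr 1; ext x
      exact enorm_indicator_eq_indicator_enorm _ _
    rw [(havg t htm).2]
    calc _ ≤ M * V2 * (CB * ENNReal.ofReal ((s⁻¹) ^ (1/4 : ℝ)) * (V * X)) := by
          gcongr
          exact h1.trans (mul_le_mul' (mul_le_mul' le_rfl (ENNReal.ofReal_le_ofReal hsi)) hA1)
      _ = _ := by ring
  rcases le_or_gt (2 * w) (R / 8) with hwR | hwR
  · obtain ⟨γ, hγm, hγ, hγi⟩ := hCf l m k hkm j hj b hbm hbi c w hw (by rw [mul_comm]; exact hs1.le)
      hwR hbs
    refine ⟨fun x => γ x + M * lcv (fun y => ‖t y‖ₑ) (avgKer n R) x, fun _ => 0,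
      hγm.add (havg t htm).1, measurable_const, fun u hu x => ?_, ?_, fun _ _ => rfl, by simp⟩
    · rw [add_zero]
      exact (hsplit u x).trans (add_le_add (hγ u hu x) le_rfl)
    · rw [lintegral_add_left hγm]
      have e1 : (w * 2 ^ (k - kstar Γ j) : ℝ) = s := by rw [hsdef, mul_comm]
      rw [e1] at hγi
      have e2 : s ^ (-(1/4) : ℝ) = (s⁻¹) ^ (1/4 : ℝ) := by
        rw [Real.rpow_neg hs0.le, Real.inv_rpow hs0.le]
      have e3 : s ^ (-(1/2) : ℝ) ≤ (s⁻¹) ^ (1/4 : ℝ) := by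
        rw [← e2]; exact Real.rpow_le_rpow_of_exponent_le hs1.le (by norm_num)
      have e4 : (ENNReal.ofReal (w ^ n) * ∫⁻ x, ‖b x‖ₑ ^ 2) ^ (1/2 : ℝ) ≤ C0 * (V + 1) * X := by
        have : ENNReal.ofReal (w ^ n) * ∫⁻ x, ‖b x‖ₑ ^ 2 ≤ (C0 * (V + 1) * X) ^ 2 := by
          refine le_trans (mul_le_mul' le_rfl ?_) hβ2
          exact lintegral_mono fun x => pow_le_pow_left' (hble x) 2
        refine (ENNReal.rpow_le_rpow this (by norm_num)).trans_eq ?_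
        rw [← ENNReal.rpow_natCast, ← ENNReal.rpow_mul]; norm_num
      calc _ ≤ Cf * (ENNReal.ofReal ((s⁻¹) ^ (1/4 : ℝ)) * (C0 * V * X) +
            ENNReal.ofReal ((s⁻¹) ^ (1/4 : ℝ)) * (C0 * (V + 1) * X)) +
            (M * CB * V * V2) * ENNReal.ofReal ((s⁻¹) ^ (1/4 : ℝ)) * X := by
            refine add_le_add (hγi.trans (mul_le_mul' le_rfl (add_le_add ?_ ?_))) htail
            · exact mul_le_mul' (ENNReal.ofReal_le_ofReal e3) ((lintegral_mono hble).trans hβ1)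
            · rw [e2]; exact mul_le_mul' le_rfl e4
        _ = (M * CB * V * V2 + Cf * (C0 * V + C0 * (V + 1))) *
            ENNReal.ofReal ((s⁻¹) ^ (1/4 : ℝ)) * X := by ring
        _ ≤ _ := by
            refine mul_le_mul' (mul_le_mul' ?_ le_rfl) le_rfl
            push_cast
            rw [add_assoc (M * CA * V * V2 : ℝ≥0∞)]
            exact le_add_self.trans le_self_add
  · refine ⟨_, fun x => M * lcv (fun y => ‖b y‖ₑ) (avgKer n R) x, (havg t htm).1, (havg b hbm).1,
      fun u hu x => ?_, htail.trans ?_, fun x hx => ?_, ?_⟩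
    · refine ((hsplit u x).trans (add_le_add (hK1 b u x) le_rfl)).trans_eq (add_comm _ _)
    · refine mul_le_mul' (mul_le_mul' ?_ le_rfl) le_rfl
      push_cast
      rw [add_assoc, add_assoc]
      exact le_self_add.trans le_add_self
    · rw [mem_closedBall_iff_norm, not_le] at hx
      have h0 : lcv (fun y => ‖b y‖ₑ) (avgKer n R) x = 0 :=
        lcv_avgKer_eq_zero (c := c) (w := 2 * w) (fun y hy => hbs y (by simpa using hy)) (by linarith)
      simp only [h0, mul_zero]
    · have h1 := measurable_lcv hbm.enorm (measurable_avgKer (n := n) R)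
      simp_rw [mul_pow]
      rw [lintegral_const_mul _ (h1.pow_const 2)]
      calc _ ≤ (M:ℝ≥0∞) ^ 2 * (V2 ^ 2 * ∫⁻ x, ‖b x‖ₑ ^ 2) := by
            refine mul_le_mul' le_rfl ?_
            rw [← hV2, ← lintegral_avgKer hR0]
            exact lintegral_lcv_sq hbm.enorm (measurable_avgKer (n := n) R)
        _ ≤ (M * V2) ^ 2 * ∫⁻ x, ‖β x‖ₑ ^ 2 := by
            rw [← mul_assoc, mul_pow]
            exact mul_le_mul' le_rfl (lintegral_mono fun x => pow_le_pow_left' (hble x) 2)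
        _ ≤ _ := by
            refine mul_le_mul' ?_ le_rfl
            push_cast
            rw [mul_pow]
            exact le_add_self

end AtomScale

section Atom
variable {n : ℕ} {Γ : ℝ → ℝ} {K : Rn n → ℝ} {ψ : ℝ → ℝ}

lemma ENNReal.le_of_sq_le_sq {a b : ℝ≥0∞} (h : a ^ 2 ≤ b ^ 2) : a ≤ b :=
  (ENNReal.pow_right_strictMono two_ne_zero).le_iff_le.1 h

lemma ENNReal.add_sq_le (a b : ℝ≥0∞) : (a + b) ^ 2 ≤ 2 * a ^ 2 + 2 * b ^ 2 := by
  rcases eq_or_ne a ∞ with rfl | ha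
  · simp
  rcases eq_or_ne b ∞ with rfl | hb
  · simp
  lift a to ℝ≥0 using ha
  lift b to ℝ≥0 using hb
  norm_cast
  rw [← NNReal.coe_le_coe]
  push_cast
  nlinarith [sq_nonneg ((a:ℝ) - b)]

lemma ENNReal.tsum_sq_le_sq_tsum {ι : Type*} (f : ι → ℝ≥0∞) : ∑' i, f i ^ 2 ≤ (∑' i, f i) ^ 2 := by
  rw [pow_two, ← ENNReal.tsum_mul_right]
  refine ENNReal.tsum_le_tsum fun i => ?_
  rw [pow_two]
  exact mul_le_mul' le_rfl (ENNReal.le_tsum i)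

/-- All scales acting on an atom. -/
theorem exists_atom_majorant (hn : 2 ≤ n) (hΓ : IsGammaU Γ) (hK : IsHomCZKernel n K)
    (hψ : IsLPCutoff ψ) :
    ∃ C : ℝ≥0, ∀ l m k : ℤ, |k - m| ≤ 1 → ∀ α : Rn n → ℂ, Measurable α →
      ∫ y, α y = 0 → ∀ (h : ℝ≥0) (c : Rn n) (w : ℝ), 0 < w → (∀ y, ‖α y‖ₑ ≤ h) →
      (∀ y, α y ≠ 0 → ‖y - c‖ ≤ w) →
      ∃ (β : ℤ → Rn n → ℝ≥0∞) (b : Rn n → ℝ≥0∞), (∀ j, Measurable (β j)) ∧ Measurable b ∧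
        (∀ j ∈ Slm Γ l m, ∀ u ∈ Icc (1/2 : ℝ) 4, ∀ x, ‖cv (cv α (lpk n ψ (k - kstar Γ j)))
          (hker Γ K ψ (2 ^ j * u) (l + kstar Γ j)) x‖ₑ ≤ β j x) ∧
        (∀ x, ∑' j, β j x ^ 2 ≤ b x ^ 2) ∧
        ∫⁻ x, b x ≤ C * (h * ENNReal.ofReal (w ^ n)) := by
  obtain ⟨C, hC⟩ := exists_atom_scale hn hΓ hK hψ
  obtain ⟨N, hN⟩ := hΓ.exists_tsum_kstar_le
  obtain ⟨Cs, hCs⟩ := exists_tsum_min_zpow_le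
  obtain ⟨V, hV⟩ : ∃ V : ℝ≥0, volume (Metric.closedBall (0 : Rn n) 1) = V :=
    ⟨_, (ENNReal.coe_toNNReal volume_unitBall_ne_top).symm⟩
  set C' : ℝ≥0 := 34 ^ n * V * (C * (N * (4 * V))) + 1 with hC'
  refine ⟨2 * (N * (C * Cs) + C'), fun l m k hkm α hα h0 h c w hw hh hs => ?_⟩
  set X : ℝ≥0∞ := h * ENNReal.ofReal (w ^ n) with hX
  have hαi := integrable_of_support hα hh hw.le hs
  classical
  have hex : ∀ j : ℤ, ∃ γδ : (Rn n → ℝ≥0∞) × (Rn n → ℝ≥0∞), Measurable γδ.1 ∧ Measurable γδ.2 ∧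
      (j ∈ Slm Γ l m → ∀ u ∈ Icc (1/2 : ℝ) 4, ∀ x, ‖cv (cv α (lpk n ψ (k - kstar Γ j)))
          (hker Γ K ψ (2 ^ j * u) (l + kstar Γ j)) x‖ₑ ≤ γδ.1 x + γδ.2 x) ∧
      ∫⁻ x, γδ.1 x ≤ C * ENNReal.ofReal ((min (2 ^ (k - kstar Γ j) * w)
          (2 ^ (k - kstar Γ j) * w)⁻¹) ^ (1/4 : ℝ)) * X ∧
      (∀ x ∉ Metric.closedBall c (34 * w), γδ.2 x = 0) ∧
        ∫⁻ x, γδ.2 x ^ 2 ≤ C * ∫⁻ x, ‖cv α (lpk n ψ (k - kstar Γ j)) x‖ₑ ^ 2 := by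
    intro j
    by_cases hj : j ∈ Slm Γ l m
    · obtain ⟨γ, δ, h1, h2, h3, h4, h5, h6⟩ := hC l m k hkm j hj α hα h0 h c w hw hh hs
      exact ⟨(γ, δ), h1, h2, fun _ => h3, h4, h5, h6⟩
    · exact ⟨(fun _ => 0, fun _ => 0), measurable_const, measurable_const, fun h => absurd h hj,
        by simp, fun _ _ => rfl, by simp⟩
  choose γδ hγm hδm hle hγ hδs hδ using hex
  have hδ2 : ∀ j, Measurable fun x => (γδ j).2 x ^ 2 := fun j => (hδm j).pow_const 2
  have hDm : Measurable fun x => (∑' j, (γδ j).2 x ^ 2) ^ (1/2 : ℝ) :=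
    (Measurable.tsum fun j => hδ2 j).pow_const _
  have hGm : Measurable fun x => ∑' j, (γδ j).1 x := Measurable.tsum fun j => hγm j
  refine ⟨fun j x => (γδ j).1 x + (γδ j).2 x,
    fun x => 2 * (∑' j, (γδ j).1 x + (∑' j, (γδ j).2 x ^ 2) ^ (1/2 : ℝ)),
    fun j => (hγm j).add (hδm j), (hGm.add hDm).const_mul _, hle, fun x => ?_, ?_⟩
  · calc ∑' j, ((γδ j).1 x + (γδ j).2 x) ^ 2 ≤ ∑' j, (2 * (γδ j).1 x ^ 2 + 2 * (γδ j).2 x ^ 2) :=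
          ENNReal.tsum_le_tsum fun j => ENNReal.add_sq_le _ _
      _ = 2 * ∑' j, (γδ j).1 x ^ 2 + 2 * ∑' j, (γδ j).2 x ^ 2 := by
          rw [ENNReal.tsum_add, ENNReal.tsum_mul_left, ENNReal.tsum_mul_left]
      _ ≤ 2 * (∑' j, (γδ j).1 x + (∑' j, (γδ j).2 x ^ 2) ^ (1/2 : ℝ)) ^ 2 +
          2 * (∑' j, (γδ j).1 x + (∑' j, (γδ j).2 x ^ 2) ^ (1/2 : ℝ)) ^ 2 := by
          refine add_le_add (mul_le_mul' le_rfl ?_) (mul_le_mul' le_rfl ?_)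
          · exact (ENNReal.tsum_sq_le_sq_tsum _).trans (pow_le_pow_left' le_self_add 2)
          · conv_lhs => rw [← ENNReal.rpow_half_sq (∑' j, (γδ j).2 x ^ 2)]
            exact pow_le_pow_left' le_add_self 2
      _ = _ := by ring
  have hG : ∫⁻ x, ∑' j, (γδ j).1 x ≤ (N * (C * Cs) : ℝ≥0) * X := by
    rw [lintegral_tsum fun j => (hγm j).aemeasurable]
    calc _ ≤ ∑' j, C * ENNReal.ofReal ((min (2 ^ (k - kstar Γ j) * w)
          (2 ^ (k - kstar Γ j) * w)⁻¹) ^ (1/4 : ℝ)) * X := ENNReal.tsum_le_tsum hγ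
      _ ≤ N * ∑' a : ℤ, C * ENNReal.ofReal ((min (2 ^ (k - a) * w)
          (2 ^ (k - a) * w)⁻¹) ^ (1/4 : ℝ)) * X := hN fun a => C * ENNReal.ofReal ((min (2 ^ (k - a) * w)
          (2 ^ (k - a) * w)⁻¹) ^ (1/4 : ℝ)) * X
      _ = N * (C * (∑' a : ℤ, ENNReal.ofReal ((min (2 ^ (k - a) * w)
          (2 ^ (k - a) * w)⁻¹) ^ (1/4 : ℝ))) * X) := by rw [ENNReal.tsum_mul_right, ENNReal.tsum_mul_left]
      _ ≤ N * (C * Cs * X) := by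
          gcongr
          refine le_trans (le_of_eq ?_) (hCs w hw)
          exact (Equiv.subLeft k).tsum_eq fun a : ℤ => ENNReal.ofReal ((min (2 ^ a * w)
            (2 ^ a * w)⁻¹) ^ (1/4 : ℝ))
      _ = _ := by push_cast; ring
  have hD : ∫⁻ x, (∑' j, (γδ j).2 x ^ 2) ^ (1/2 : ℝ) ≤ C' * X := by
    refine ENNReal.le_of_sq_le_sq ?_
    refine (lintegral_sq_le_of_support (μ := volume) (s := Metric.closedBall c (34 * w)) hDm.aemeasurable
      Metric.isClosed_closedBall.measurableSet fun x hx => ?_).trans ?_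
    · simp [fun j => hδs j x hx]
    · simp only [ENNReal.rpow_half_sq]
      rw [lintegral_tsum fun j => (hδ2 j).aemeasurable, volume_closedBall_eq c (by positivity), hV]
      have hA2 := lintegral_enorm_pow_le_of_support hh hw.le hs two_ne_zero
      rw [hV] at hA2
      have h1 : ∑' j, ∫⁻ x, (γδ j).2 x ^ 2 ≤ C * (N * (4 * (h ^ 2 * (ENNReal.ofReal (w ^ n) * V)))) := by
        calc _ ≤ ∑' j, C * ∫⁻ x, ‖cv α (lpk n ψ (k - kstar Γ j)) x‖ₑ ^ 2 := ENNReal.tsum_le_tsum hδ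
          _ = C * ∑' j, ∫⁻ x, ‖cv α (lpk n ψ (k - kstar Γ j)) x‖ₑ ^ 2 := ENNReal.tsum_mul_left
          _ ≤ C * (N * ∑' a : ℤ, ∫⁻ x, ‖cv α (lpk n ψ (k - a)) x‖ₑ ^ 2) :=
              mul_le_mul' le_rfl (hN fun a => ∫⁻ x, ‖cv α (lpk n ψ (k - a)) x‖ₑ ^ 2)
          _ ≤ _ := by
              refine mul_le_mul' le_rfl (mul_le_mul' le_rfl ?_)
              refine le_trans (le_of_eq ?_) ((tsum_lintegral_cv_lpk_le hψ hα hαi).trans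
                (mul_le_mul' le_rfl hA2))
              exact (Equiv.subLeft k).tsum_eq fun a : ℤ => ∫⁻ x, ‖cv α (lpk n ψ a) x‖ₑ ^ 2
      have h2 : ENNReal.ofReal ((34 * w) ^ n) = 34 ^ n * ENNReal.ofReal (w ^ n) := by
        rw [mul_pow, ENNReal.ofReal_mul (by positivity), ENNReal.ofReal_pow (by positivity)]
        norm_num
      rw [h2]
      have h3 : (34 ^ n * V * (C * (N * (4 * V))) : ℝ≥0∞) ≤ C' ^ 2 := by
        have : C' ≤ C' ^ 2 := by
          rw [pow_two]; exact le_mul_of_one_le_right' le_add_self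
        calc (34 ^ n * V * (C * (N * (4 * V))) : ℝ≥0∞) ≤ C' := by
              rw [hC']; push_cast; exact le_self_add
          _ ≤ _ := by exact_mod_cast this
      calc _ ≤ (34 ^ n * ENNReal.ofReal (w ^ n) * V) *
            (C * (N * (4 * (h ^ 2 * (ENNReal.ofReal (w ^ n) * V))))) := mul_le_mul' le_rfl h1
        _ = (34 ^ n * V * (C * (N * (4 * V)))) * X ^ 2 := by rw [hX]; ring
        _ ≤ C' ^ 2 * X ^ 2 := mul_le_mul' h3 le_rfl
        _ = _ := by ring
  have hGD : Measurable fun x => ∑' j, (γδ j).1 x + (∑' j, (γδ j).2 x ^ 2) ^ (1/2 : ℝ) := hGm.add hDm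
  beta_reduce
  rw [lintegral_const_mul _ hGD, lintegral_add_left hGm]
  calc _ ≤ 2 * ((N * (C * Cs) : ℝ≥0) * X + C' * X) := by gcongr
    _ = _ := by push_cast; ring

end Atom

section Interpolation
variable {Y : Type*} [MeasurableSpace Y] {ν : Measure Y} {p : ℝ}

lemma zpow_rpow_eq (i : ℤ) (θ : ℝ) : ((2:ℝ) ^ i) ^ θ = (2:ℝ) ^ ((i:ℝ) * θ) := by
  rw [← Real.rpow_intCast, ← Real.rpow_mul (by norm_num)]

/-- The `L²` endpoint of the interpolation. -/
lemma lintegral_sq_le_of_decomp (hp1 : 1 < p) (hp2 : p < 2) {X L : ℝ} (hX : 0 < X) (hL : 0 < L) {c : ℝ≥0}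
    {F : Y → ℝ≥0∞} {B V : ℤ → Y → ℝ≥0∞} (hV : ∀ i, Measurable (V i))
    (hF : ∀ i y, F y ≤ B i y + V i y) {b : ℤ → ℝ≥0∞} (hB : ∀ i, ∫⁻ y, B i y ^ 2 ∂ν ≤ c * b i ^ 2)
    (hb : ∀ i, b i ≤ ENNReal.ofReal (2 ^ (-((i:ℝ) * (p - 1))) * X))
    (hA : ∀ i : ℤ, ENNReal.ofReal (2 ^ (-((i:ℝ) * (2 - p)))) * ∫⁻ y, V i y ^ 2 ∂ν ≤ ENNReal.ofReal (X / L)) :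
    ∫⁻ y, F y ^ 2 ∂ν ≤ (8 * c + 2) * ENNReal.ofReal (((X * L ^ (-(p - 1))) ^ (1 / p)) ^ 2) := by
  set Z := (X * L ^ (-(p - 1))) ^ (1 / p) with hZ
  have hZ0 : 0 < Z := by positivity
  have hp0 : 0 < p := by linarith
  set Λ := (X * L) ^ (1 / p) with hΛ
  have hΛ0 : 0 < Λ := by positivity
  obtain ⟨i, hi1, hi2⟩ := exists_mem_Ico_zpow hΛ0 (show (1:ℝ) < 2 by norm_num)
  have h2i : (0:ℝ) < 2 ^ i := by positivity
  have hr1 : (2:ℝ) ^ (-((i:ℝ) * (p - 1))) * X ≤ 2 * Z := by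
    rw [neg_mul_eq_mul_neg, ← zpow_rpow_eq]
    have h1 : Λ / 2 ≤ 2 ^ i := by rw [zpow_add_one₀ (by norm_num)] at hi2; linarith
    have h2 : ((2:ℝ) ^ i) ^ (-(p - 1)) ≤ (Λ / 2) ^ (-(p - 1)) :=
      Real.rpow_le_rpow_of_nonpos (by positivity) h1 (by linarith)
    have h3 : (Λ / 2) ^ (-(p - 1)) * X = 2 ^ (p - 1) * Z := by
      rw [Real.div_rpow hΛ0.le (by norm_num), Real.rpow_neg (by norm_num : (0:ℝ) ≤ 2), hΛ, hZ,
        Real.mul_rpow hX.le hL.le, Real.mul_rpow hX.le (by positivity),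
        Real.mul_rpow (by positivity) (by positivity), ← Real.rpow_mul hX.le, ← Real.rpow_mul hL.le,
        ← Real.rpow_mul hL.le, div_inv_eq_mul]
      have e1 : X ^ (1 / p * -(p - 1)) * X = X ^ (1 / p) := by
        nth_rewrite 2 [← Real.rpow_one X]
        rw [← Real.rpow_add hX]; congr 1; field_simp; ring
      have e2 : 1 / p * -(p - 1) = -(p - 1) * (1 / p) := mul_comm _ _
      rw [← e2, ← e1]; ring
    have h4 : (2:ℝ) ^ (p - 1) ≤ 2 := by
      calc (2:ℝ) ^ (p - 1) ≤ 2 ^ (1:ℝ) := Real.rpow_le_rpow_of_exponent_le (by norm_num) (by linarith)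
        _ = 2 := Real.rpow_one 2
    calc _ ≤ (Λ / 2) ^ (-(p - 1)) * X := by gcongr
      _ = 2 ^ (p - 1) * Z := h3
      _ ≤ _ := by gcongr
  have hr2 : (2:ℝ) ^ ((i:ℝ) * (2 - p)) * (X / L) ≤ Z ^ 2 := by
    rw [← zpow_rpow_eq]
    calc _ ≤ Λ ^ (2 - p) * (X / L) := by gcongr
      _ = Z ^ 2 := by
        rw [← Real.rpow_natCast Z 2, hΛ, hZ, Real.mul_rpow hX.le hL.le, Real.mul_rpow hX.le (by positivity),
          Real.mul_rpow (by positivity) (by positivity), Real.mul_rpow (by positivity) (by positivity),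
          ← Real.rpow_mul hX.le, ← Real.rpow_mul hL.le, ← Real.rpow_mul hX.le, ← Real.rpow_mul hL.le,
          ← Real.rpow_mul hL.le]
        have e1 : X ^ (1 / p * (2 - p)) * X = X ^ (1 / p * ((2:ℕ):ℝ)) := by
          nth_rewrite 2 [← Real.rpow_one X]
          rw [← Real.rpow_add hX]; congr 1; push_cast; field_simp; ring
        have e2 : L ^ (1 / p * (2 - p)) * L⁻¹ = L ^ (-(p - 1) * (1 / p) * ((2:ℕ):ℝ)) := by
          rw [← Real.rpow_neg_one, ← Real.rpow_add hL]; congr 1; push_cast; field_simp; ring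
        rw [← e1, ← e2]; ring
  have hAi : ∫⁻ y, V i y ^ 2 ∂ν ≤ ENNReal.ofReal (Z ^ 2) := by
    have h1 : ENNReal.ofReal (2 ^ ((i:ℝ) * (2 - p))) * ENNReal.ofReal (2 ^ (-((i:ℝ) * (2 - p)))) = 1 := by
      rw [← ENNReal.ofReal_mul (by positivity), ← Real.rpow_add (by norm_num)]; simp
    calc ∫⁻ y, V i y ^ 2 ∂ν = ENNReal.ofReal (2 ^ ((i:ℝ) * (2 - p))) *
          (ENNReal.ofReal (2 ^ (-((i:ℝ) * (2 - p)))) * ∫⁻ y, V i y ^ 2 ∂ν) := by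
          rw [← mul_assoc, h1, one_mul]
      _ ≤ ENNReal.ofReal (2 ^ ((i:ℝ) * (2 - p))) * ENNReal.ofReal (X / L) := mul_le_mul' le_rfl (hA i)
      _ ≤ _ := by
          rw [← ENNReal.ofReal_mul (by positivity)]; exact ENNReal.ofReal_le_ofReal hr2
  have hBi : ∫⁻ y, B i y ^ 2 ∂ν ≤ c * (4 * ENNReal.ofReal (Z ^ 2)) := by
    refine (hB i).trans (mul_le_mul' le_rfl ?_)
    calc b i ^ 2 ≤ ENNReal.ofReal (2 * Z) ^ 2 :=
          pow_le_pow_left' ((hb i).trans (ENNReal.ofReal_le_ofReal hr1)) 2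
      _ = _ := by
          rw [ENNReal.ofReal_mul (by norm_num), mul_pow, ENNReal.ofReal_pow hZ0.le]; norm_num
  calc ∫⁻ y, F y ^ 2 ∂ν ≤ ∫⁻ y, (2 * B i y ^ 2 + 2 * V i y ^ 2) ∂ν :=
        lintegral_mono fun y => (pow_le_pow_left' (hF i y) 2).trans (ENNReal.add_sq_le _ _)
    _ = 2 * ∫⁻ y, B i y ^ 2 ∂ν + 2 * ∫⁻ y, V i y ^ 2 ∂ν := by
        have := (hV i).pow_const 2
        rw [lintegral_add_right _ (this.const_mul 2), lintegral_const_mul' _ _ (by norm_num),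
          lintegral_const_mul' _ _ (by norm_num)]
    _ ≤ 2 * (c * (4 * ENNReal.ofReal (Z ^ 2))) + 2 * ENNReal.ofReal (Z ^ 2) := by gcongr
    _ = _ := by ring

/-- The `L^{p'}` endpoint of the interpolation. -/
lemma lintegral_rpow_le_of_decomp (hp1 : 1 < p) (hp2 : p < 2) {X L : ℝ} (hX : 0 < X) (hL : 0 < L)
    {F : Y → ℝ≥0∞} {B V : ℤ → Y → ℝ≥0∞} (hV : ∀ i, Measurable (V i))
    (hF : ∀ i y, F y ≤ B i y + V i y)
    (hb : ∀ i y, B i y ≤ ENNReal.ofReal (2 ^ (-((i:ℝ) * (p - 1))) * X))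
    (hA : ∑' i : ℤ, ENNReal.ofReal (2 ^ (-((i:ℝ) * (2 - p)))) * ∫⁻ y, V i y ^ 2 ∂ν ≤ ENNReal.ofReal (X / L)) :
    ∫⁻ y, F y ^ (p / (p - 1)) ∂ν ≤ ENNReal.ofReal (4 ^ (p / (p - 1))) *
      ENNReal.ofReal (((X * L ^ (-(p - 1))) ^ (1 / p)) ^ (p / (p - 1))) := by
  have hp0 : 0 < p := by linarith
  have hp10 : 0 < p - 1 := by linarith
  set q := p / (p - 1) with hq
  have hq2 : 2 ≤ q := by rw [hq, le_div_iff₀ hp10]; linarith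
  have hq0 : 0 < q := by linarith
  let τ : ℤ → ℝ := fun i => 2 ^ (-((i:ℝ) * (p - 1))) * X
  have hτ0 : ∀ i, 0 < τ i := fun i => by positivity
  have key : ∀ y, F y ^ q ≤ ∑' i : ℤ, ENNReal.ofReal (4 ^ q * τ i ^ (q - 2)) * V i y ^ 2 := by
    intro y
    have hterm := fun i : ℤ => ENNReal.le_tsum (f := fun i : ℤ =>
      ENNReal.ofReal (4 ^ q * τ i ^ (q - 2)) * V i y ^ 2) i
    rcases eq_or_ne (F y) 0 with h0 | h0
    · rw [h0, ENNReal.zero_rpow_of_pos hq0]; exact zero_le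
    rcases eq_or_ne (F y) ∞ with ht | ht
    · have hV0 : V 0 y = ∞ := by
        have h1 := hF 0 y
        rw [ht, top_le_iff, ENNReal.add_eq_top] at h1
        exact h1.resolve_left ((hb 0 y).trans_lt ENNReal.ofReal_lt_top).ne
      refine le_trans ?_ (hterm 0)
      have h3 : ENNReal.ofReal (4 ^ q * τ 0 ^ (q - 2)) ≠ 0 := by
        have := hτ0 0
        rw [ne_eq, ENNReal.ofReal_eq_zero, not_le]; positivity
      rw [hV0, ENNReal.top_pow two_ne_zero, ENNReal.mul_top h3]; exact le_top
    · obtain ⟨f, hf⟩ : ∃ f : ℝ, F y = ENNReal.ofReal f := ⟨_, (ENNReal.ofReal_toReal ht).symm⟩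
      have hf0 : 0 < f := by
        rw [hf, ne_eq, ENNReal.ofReal_eq_zero, not_le] at h0; exact h0
      obtain ⟨a, ha1, ha2⟩ := exists_mem_Ico_zpow (show 0 < (2 * X / f) ^ (1 / (p - 1)) by positivity)
        (show (1:ℝ) < 2 by norm_num)
      have hpow : ((2 * X / f) ^ (1 / (p - 1))) ^ (p - 1) = 2 * X / f := by
        rw [← Real.rpow_mul (by positivity), one_div_mul_cancel hp10.ne', Real.rpow_one]
      have h1 : ((2:ℝ) ^ a) ^ (p - 1) ≤ 2 * X / f := by
        rw [← hpow]; gcongr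
      have h2 : 2 * X / f < ((2:ℝ) ^ (a + 1)) ^ (p - 1) := by
        rw [← hpow]; gcongr
      have hτ : ∀ i : ℤ, τ i = X / ((2:ℝ) ^ i) ^ (p - 1) := fun i => by
        simp only [τ]
        rw [neg_mul_eq_mul_neg, ← zpow_rpow_eq, Real.rpow_neg (by positivity)]; ring
      have h3 : 2 * τ (a + 1) < f := by
        rw [hτ, ← mul_div_assoc, div_lt_iff₀ (by positivity)]
        rw [div_lt_iff₀ hf0] at h2; linarith
      have h4 : f ≤ 4 * τ (a + 1) := by
        rw [le_div_iff₀ hf0] at h1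
        have h5 : ((2:ℝ) ^ (a + 1)) ^ (p - 1) ≤ 2 * ((2:ℝ) ^ a) ^ (p - 1) := by
          rw [zpow_add_one₀ (by norm_num), Real.mul_rpow (by positivity) (by norm_num), mul_comm]
          gcongr
          calc (2:ℝ) ^ (p - 1) ≤ 2 ^ (1:ℝ) := Real.rpow_le_rpow_of_exponent_le (by norm_num) (by linarith)
            _ = 2 := Real.rpow_one 2
        rw [hτ, ← mul_div_assoc, le_div_iff₀ (by positivity)]
        nlinarith
      have h6 : F y ≤ 2 * V (a + 1) y := by
        have h7 := (hF (a + 1) y).trans (add_le_add (hb (a + 1) y) le_rfl)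
        have h8 : ENNReal.ofReal (τ (a + 1)) + ENNReal.ofReal (τ (a + 1)) ≤ F y := by
          rw [← ENNReal.ofReal_add (hτ0 _).le (hτ0 _).le, hf]
          exact ENNReal.ofReal_le_ofReal (by linarith)
        rcases eq_or_ne (V (a + 1) y) ∞ with hVt | hVt
        · rw [hVt]; simp
        have h9 : ENNReal.ofReal (τ (a + 1)) ≤ V (a + 1) y := by
          have := h8.trans h7
          exact (ENNReal.add_le_add_iff_left ENNReal.ofReal_ne_top).1 this
        calc F y ≤ _ := h7
          _ ≤ V (a + 1) y + V (a + 1) y := add_le_add h9 le_rfl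
          _ = _ := (two_mul _).symm
      refine le_trans ?_ (hterm (a + 1))
      have h10 : F y ^ q = F y ^ (q - 2) * F y ^ 2 := by
        rw [← ENNReal.rpow_natCast, ← ENNReal.rpow_add _ _ h0 ht]; congr 1; push_cast; ring
      rw [h10]
      calc F y ^ (q - 2) * F y ^ 2 ≤ ENNReal.ofReal ((4 * τ (a + 1)) ^ (q - 2)) * (2 * V (a + 1) y) ^ 2 := by
            refine mul_le_mul' ?_ (pow_le_pow_left' h6 2)
            rw [hf, ENNReal.ofReal_rpow_of_pos hf0]
            exact ENNReal.ofReal_le_ofReal (Real.rpow_le_rpow hf0.le h4 (by linarith))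
        _ = ENNReal.ofReal ((4 * τ (a + 1)) ^ (q - 2) * 4) * V (a + 1) y ^ 2 := by
            rw [ENNReal.ofReal_mul (q := 4) (Real.rpow_nonneg (by have := hτ0 (a + 1); positivity) _), mul_pow]
            norm_num; ring
        _ ≤ _ := by
            refine mul_le_mul' (ENNReal.ofReal_le_ofReal ?_) le_rfl
            rw [Real.mul_rpow (by norm_num) (hτ0 _).le]
            have h11 : (4:ℝ) ^ (q - 2) * 4 ≤ 4 ^ q := by
              calc (4:ℝ) ^ (q - 2) * 4 = 4 ^ (q - 2 + 1) := (Real.rpow_add_one (by norm_num) _).symm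
                _ ≤ _ := Real.rpow_le_rpow_of_exponent_le (by norm_num) (by linarith)
            have h12 : 0 ≤ τ (a + 1) ^ (q - 2) := Real.rpow_nonneg (hτ0 _).le _
            nlinarith
  have hτq : ∀ i : ℤ, 4 ^ q * τ i ^ (q - 2) = 4 ^ q * X ^ (q - 2) * 2 ^ (-((i:ℝ) * (2 - p))) := fun i => by
    simp only [τ]
    rw [Real.mul_rpow (by positivity) hX.le, ← Real.rpow_mul (by norm_num)]
    have : -((i:ℝ) * (p - 1)) * (q - 2) = -((i:ℝ) * (2 - p)) := by rw [hq]; field_simp; ring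
    rw [this]; ring
  calc ∫⁻ y, F y ^ q ∂ν ≤ ∫⁻ y, ∑' i : ℤ, ENNReal.ofReal (4 ^ q * τ i ^ (q - 2)) * V i y ^ 2 ∂ν :=
        lintegral_mono key
    _ = ∑' i : ℤ, ENNReal.ofReal (4 ^ q * X ^ (q - 2)) *
          (ENNReal.ofReal (2 ^ (-((i:ℝ) * (2 - p)))) * ∫⁻ y, V i y ^ 2 ∂ν) := by
        rw [lintegral_tsum fun i => (((hV i).pow_const 2).const_mul _).aemeasurable]
        congr 1; ext i
        rw [lintegral_const_mul' _ _ ENNReal.ofReal_ne_top, hτq,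
          ENNReal.ofReal_mul (by positivity), mul_assoc]
    _ ≤ ENNReal.ofReal (4 ^ q * X ^ (q - 2)) * ENNReal.ofReal (X / L) := by
        rw [ENNReal.tsum_mul_left]; exact mul_le_mul' le_rfl hA
    _ = _ := by
        rw [← ENNReal.ofReal_mul (by positivity), ← ENNReal.ofReal_mul (by positivity)]
        congr 1
        have e0 : 1 / p * q = q - 1 := by rw [hq]; field_simp; ring
        have e3 : -(p - 1) * (q - 1) = -1 := by rw [hq]; field_simp; ring
        rw [← Real.rpow_mul (by positivity), e0, Real.mul_rpow hX.le (by positivity), ← Real.rpow_mul hL.le,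
          e3, Real.rpow_neg_one]
        have e4 : X ^ (q - 1) = X ^ (q - 2) * X := by
          rw [← Real.rpow_add_one hX.ne']; congr 1; ring
        rw [e4]; ring

/-- Interpolation between the endpoints `L²` and `L^{p'}`. -/
theorem lintegral_rpow_le_of_decomp_aux (hp1 : 1 < p) (hp2 : p < 2) {r : ℝ} (hr1 : 2 ≤ r)
    (hr2 : r ≤ p / (p - 1)) {X L : ℝ} (hX : 0 < X) (hL : 0 < L) {c : ℝ≥0}
    {F : Y → ℝ≥0∞} (hFm : Measurable F) {B V : ℤ → Y → ℝ≥0∞} (hV : ∀ i, Measurable (V i))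
    (hF : ∀ i y, F y ≤ B i y + V i y) {b : ℤ → ℝ≥0∞} (hB : ∀ i, ∫⁻ y, B i y ^ 2 ∂ν ≤ c * b i ^ 2)
    (hBb : ∀ i y, B i y ≤ b i)
    (hb : ∀ i : ℤ, b i ≤ ENNReal.ofReal (2 ^ (-((i:ℝ) * (p - 1))) * X))
    (hA : ∑' i : ℤ, ENNReal.ofReal (2 ^ (-((i:ℝ) * (2 - p)))) * ∫⁻ y, V i y ^ 2 ∂ν ≤ ENNReal.ofReal (X / L)) :
    (∫⁻ y, F y ^ r ∂ν) ^ (p / r) ≤ (8 * c + 2 + ENNReal.ofReal (4 ^ (p / (p - 1)))) *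
      ENNReal.ofReal (L ^ (-(p - 1)) * X) := by
  have h1 := lintegral_sq_le_of_decomp hp1 hp2 hX hL hV hF hB hb (fun i =>
    (ENNReal.le_tsum (f := fun i : ℤ => ENNReal.ofReal (2 ^ (-((i:ℝ) * (2 - p)))) * ∫⁻ y, V i y ^ 2 ∂ν) i).trans hA)
  have h2 := lintegral_rpow_le_of_decomp hp1 hp2 hX hL hV hF (fun i y => (hBb i y).trans (hb i)) hA
  set q := p / (p - 1) with hq
  set Z := (X * L ^ (-(p - 1))) ^ (1 / p) with hZ
  have hZ0 : 0 < Z := by positivity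
  have hp0 : 0 < p := by linarith
  have hr0 : 0 < r := by linarith
  have hpt : ∀ y, F y ^ r ≤ ENNReal.ofReal (Z ^ (r - 2)) * F y ^ 2 + ENNReal.ofReal (Z ^ (r - q)) * F y ^ q := by
    intro y
    rcases eq_or_ne (F y) 0 with h0 | h0
    · rw [h0, ENNReal.zero_rpow_of_pos hr0]; exact zero_le
    rcases eq_or_ne (F y) ∞ with ht | ht
    · have h3 : ENNReal.ofReal (Z ^ (r - 2)) ≠ 0 := by
        rw [ne_eq, ENNReal.ofReal_eq_zero, not_le]; positivity
      rw [ht, ENNReal.top_pow two_ne_zero, ENNReal.mul_top h3, top_add]; exact le_top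
    obtain ⟨f, hf⟩ : ∃ f : ℝ, F y = ENNReal.ofReal f := ⟨_, (ENNReal.ofReal_toReal ht).symm⟩
    have hf0 : 0 < f := by
      rw [hf, ne_eq, ENNReal.ofReal_eq_zero, not_le] at h0; exact h0
    rw [hf, ← ENNReal.rpow_natCast, ENNReal.ofReal_rpow_of_pos hf0, ENNReal.ofReal_rpow_of_pos hf0,
      ENNReal.ofReal_rpow_of_pos hf0, ← ENNReal.ofReal_mul (by positivity), ← ENNReal.ofReal_mul (by positivity)]
    rcases le_total f Z with h | h
    · refine le_trans (ENNReal.ofReal_le_ofReal ?_) le_self_add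
      calc f ^ r = f ^ (r - 2) * f ^ ((2:ℕ):ℝ) := by
            rw [← Real.rpow_add hf0]; congr 1; push_cast; ring
        _ ≤ _ := by gcongr
    · refine le_trans (ENNReal.ofReal_le_ofReal ?_) le_add_self
      calc f ^ r = f ^ (r - q) * f ^ q := by
            rw [← Real.rpow_add hf0]; congr 1; ring
        _ ≤ _ := by
            refine mul_le_mul_of_nonneg_right ?_ (by positivity)
            exact Real.rpow_le_rpow_of_nonpos hZ0 h (by linarith)
  have h3 : ∫⁻ y, F y ^ r ∂ν ≤ (8 * c + 2 + ENNReal.ofReal (4 ^ q)) * ENNReal.ofReal (Z ^ r) := by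
    calc _ ≤ ∫⁻ y, (ENNReal.ofReal (Z ^ (r - 2)) * F y ^ 2 + ENNReal.ofReal (Z ^ (r - q)) * F y ^ q) ∂ν :=
          lintegral_mono hpt
      _ = ENNReal.ofReal (Z ^ (r - 2)) * ∫⁻ y, F y ^ 2 ∂ν + ENNReal.ofReal (Z ^ (r - q)) * ∫⁻ y, F y ^ q ∂ν := by
          rw [lintegral_add_left ((hFm.pow_const 2).const_mul _), lintegral_const_mul' _ _ ENNReal.ofReal_ne_top,
            lintegral_const_mul' _ _ ENNReal.ofReal_ne_top]
      _ ≤ ENNReal.ofReal (Z ^ (r - 2)) * ((8 * c + 2) * ENNReal.ofReal (Z ^ 2)) +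
          ENNReal.ofReal (Z ^ (r - q)) * (ENNReal.ofReal (4 ^ q) * ENNReal.ofReal (Z ^ q)) := by gcongr
      _ = (8 * c + 2) * (ENNReal.ofReal (Z ^ (r - 2)) * ENNReal.ofReal (Z ^ 2)) +
          ENNReal.ofReal (4 ^ q) * (ENNReal.ofReal (Z ^ (r - q)) * ENNReal.ofReal (Z ^ q)) := by ring
      _ = _ := by
          rw [← ENNReal.ofReal_mul (by positivity), ← ENNReal.ofReal_mul (by positivity),
            ← Real.rpow_natCast Z 2, ← Real.rpow_add hZ0, ← Real.rpow_add hZ0]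
          rw [show r - 2 + ((2:ℕ):ℝ) = r by push_cast; ring, show r - q + q = r by ring]
          ring
  have hpr : p / r ≤ 1 := by rw [div_le_one hr0]; linarith
  have hpr0 : 0 ≤ p / r := by positivity
  calc _ ≤ ((8 * c + 2 + ENNReal.ofReal (4 ^ q)) * ENNReal.ofReal (Z ^ r)) ^ (p / r) :=
        ENNReal.rpow_le_rpow h3 hpr0
    _ = (8 * c + 2 + ENNReal.ofReal (4 ^ q)) ^ (p / r) * ENNReal.ofReal (L ^ (-(p - 1)) * X) := by
        rw [ENNReal.mul_rpow_of_nonneg _ _ hpr0, ENNReal.ofReal_rpow_of_pos (by positivity),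
          ← Real.rpow_mul hZ0.le, mul_div_cancel₀ _ hr0.ne', hZ, ← Real.rpow_mul (by positivity),
          one_div_mul_cancel hp0.ne', Real.rpow_one, mul_comm X]
    _ ≤ _ := by
        refine mul_le_mul' ?_ le_rfl
        refine (ENNReal.rpow_le_rpow_of_exponent_le ?_ hpr).trans_eq (ENNReal.rpow_one _)
        calc (1:ℝ≥0∞) ≤ 2 := one_le_two
          _ ≤ 8 * c + 2 := le_add_self
          _ ≤ _ := le_self_add

/-- Interpolation between the endpoints `L²` and `L^{p'}`, with an extended-real bound. -/
theorem lintegral_rpow_le_of_decomp' (hp1 : 1 < p) (hp2 : p < 2) {r : ℝ} (hr1 : 2 ≤ r)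
    (hr2 : r ≤ p / (p - 1)) {L : ℝ} (hL : 0 < L) {c : ℝ≥0} {X : ℝ≥0∞}
    {F : Y → ℝ≥0∞} (hFm : Measurable F) {B V : ℤ → Y → ℝ≥0∞} (hV : ∀ i, Measurable (V i))
    (hF : ∀ i y, F y ≤ B i y + V i y) {b : ℤ → ℝ≥0∞} (hB : ∀ i, ∫⁻ y, B i y ^ 2 ∂ν ≤ c * b i ^ 2)
    (hBb : ∀ i y, B i y ≤ b i)
    (hb : ∀ i : ℤ, ENNReal.ofReal (2 ^ ((i:ℝ) * (p - 1))) * b i ≤ X)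
    (hA : ENNReal.ofReal L *
      ∑' i : ℤ, ENNReal.ofReal (2 ^ (-((i:ℝ) * (2 - p)))) * ∫⁻ y, V i y ^ 2 ∂ν ≤ X) :
    (∫⁻ y, F y ^ r ∂ν) ^ (p / r) ≤ (8 * c + 2 + ENNReal.ofReal (4 ^ (p / (p - 1)))) *
      (ENNReal.ofReal (L ^ (-(p - 1))) * X) := by
  rcases eq_or_ne X ∞ with hXt | hXt
  · have h1 : ENNReal.ofReal (L ^ (-(p - 1))) ≠ 0 := by
      rw [ne_eq, ENNReal.ofReal_eq_zero, not_le]; positivity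
    rw [hXt, ENNReal.mul_top h1, ENNReal.mul_top (by positivity)]
    exact le_top
  obtain ⟨x, hx0, rfl⟩ : ∃ x : ℝ, 0 ≤ x ∧ X = ENNReal.ofReal x :=
    ⟨_, ENNReal.toReal_nonneg, (ENNReal.ofReal_toReal hXt).symm⟩
  have hlim : Tendsto (fun ε : ℝ => (8 * c + 2 + ENNReal.ofReal (4 ^ (p / (p - 1)))) *
      ENNReal.ofReal (L ^ (-(p - 1)) * (x + ε))) (𝓝[>] 0)
      (𝓝 ((8 * c + 2 + ENNReal.ofReal (4 ^ (p / (p - 1)))) * ENNReal.ofReal (L ^ (-(p - 1)) * (x + 0)))) := by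
    refine ENNReal.Tendsto.const_mul (tendsto_nhdsWithin_of_tendsto_nhds ?_) (Or.inr ?_)
    · exact (ENNReal.continuous_ofReal.comp (by fun_prop)).tendsto _
    · finiteness
  rw [← ENNReal.ofReal_mul (by positivity)]
  rw [add_zero] at hlim
  refine ge_of_tendsto hlim ?_
  filter_upwards [self_mem_nhdsWithin] with ε hε
  have hε0 : 0 < ε := hε
  have hxε : 0 < x + ε := by linarith
  refine lintegral_rpow_le_of_decomp_aux hp1 hp2 hr1 hr2 hxε hL hFm hV hF hB hBb (fun i => ?_) ?_
  · have h1 : ENNReal.ofReal (2 ^ (-((i:ℝ) * (p - 1)))) * ENNReal.ofReal (2 ^ ((i:ℝ) * (p - 1))) = 1 := by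
      rw [← ENNReal.ofReal_mul (by positivity), ← Real.rpow_add (by norm_num)]; simp
    calc b i = ENNReal.ofReal (2 ^ (-((i:ℝ) * (p - 1)))) * (ENNReal.ofReal (2 ^ ((i:ℝ) * (p - 1))) * b i) := by
          rw [← mul_assoc, h1, one_mul]
      _ ≤ ENNReal.ofReal (2 ^ (-((i:ℝ) * (p - 1)))) * ENNReal.ofReal (x + ε) :=
          mul_le_mul' le_rfl ((hb i).trans (ENNReal.ofReal_le_ofReal (by linarith)))
      _ = _ := (ENNReal.ofReal_mul (by positivity)).symm
  · have h1 : ENNReal.ofReal L⁻¹ * ENNReal.ofReal L = 1 := by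
      rw [← ENNReal.ofReal_mul (by positivity), inv_mul_cancel₀ hL.ne']; simp
    rw [← one_mul (∑' i : ℤ, _), ← h1, mul_assoc, div_eq_inv_mul, ENNReal.ofReal_mul (by positivity)]
    exact mul_le_mul' le_rfl (hA.trans (ENNReal.ofReal_le_ofReal (by linarith)))

end Interpolation

variable {n : ℕ} {Γ : ℝ → ℝ} {K : Rn n → ℝ} {ψ χ : ℝ → ℝ}

/-- The absolute value of `χ(u) H_{l+j_*}^{(2^j u)} P_{k-j_*} G (x)` for `j ∈ S_{l,m}`, as a function
of `y = (j, u)`, extended by zero to all `j ∈ ℤ`. -/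
def vec (Γ : ℝ → ℝ) (K : Rn n → ℝ) (ψ χ : ℝ → ℝ) (l m k : ℤ) (G : Rn n → ℂ) (x : Rn n)
    (y : ℤ × ℝ) : ℝ≥0∞ :=
  (Slm Γ l m).indicator (fun j => ‖Complex.ofReal (χ y.2) *
    cv (cv G (lpk n ψ (k - kstar Γ j))) (hker Γ K ψ (2 ^ j * y.2) (l + kstar Γ j)) x‖ₑ) y.1

lemma measurable_vec (hΓ : IsGammaU Γ) (hK : IsHomCZKernel n K) (hψ : IsLPCutoff ψ)
    (hχ : IsChiCutoff χ) (l m k : ℤ) {G : Rn n → ℂ} (hG : Measurable G) :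
    Measurable fun q : Rn n × (ℤ × ℝ) => vec Γ K ψ χ l m k G q.1 q.2 := by
  have h : Measurable fun q : ℤ × (ℝ × Rn n) => vec Γ K ψ χ l m k G q.2.2 (q.1, q.2.1) := by
    refine measurable_from_prod_countable_right fun j => ?_
    unfold vec
    by_cases hj : j ∈ Slm Γ l m
    · simp only [indicator_of_mem hj]
      have h1 : Measurable (cv G (lpk n ψ (k - kstar Γ j))) :=
        measurable_cv hG (continuous_lpk hψ _).measurable
      have h2 := (continuous_hker hΓ hK hψ (l + kstar Γ j)).measurable
      have h3 : StronglyMeasurable fun q : (ℝ × Rn n) × Rn n =>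
          cv G (lpk n ψ (k - kstar Γ j)) (q.1.2 - q.2) *
            hker Γ K ψ (2 ^ j * q.1.1) (l + kstar Γ j) q.2 := by
        apply Measurable.stronglyMeasurable
        refine (h1.comp (by fun_prop)).mul (h2.comp (by fun_prop :
          Measurable fun q : (ℝ × Rn n) × Rn n => ((2 ^ j * q.1.1 : ℝ), q.2)))
      have h4 := hχ.1.continuous.measurable
      have h5 : Measurable fun q : ℝ × Rn n => Complex.ofReal (χ q.1) := by fun_prop
      have h6 : Measurable fun q : ℝ × Rn n => cv (cv G (lpk n ψ (k - kstar Γ j)))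
          (hker Γ K ψ (2 ^ j * q.1) (l + kstar Γ j)) q.2 := h3.integral_prod_right.measurable
      exact (h5.mul h6).enorm
    · simp only [indicator_of_notMem hj]; exact measurable_const
  have h7 : Measurable fun q : Rn n × (ℤ × ℝ) => (q.2.1, (q.2.2, q.1)) := by fun_prop
  have := h.comp h7
  simpa only [Function.comp_def] using this

lemma IsChiCutoff.enorm_le (hχ : IsChiCutoff χ) (u : ℝ) :
    ‖Complex.ofReal (χ u)‖ₑ ≤ (Icc (1/2:ℝ) 4).indicator 1 u := by
  by_cases hu : u ∈ Icc (1/2:ℝ) 4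
  · rw [indicator_of_mem hu, Pi.one_apply, ← ofReal_norm, Complex.norm_real,
      Real.norm_of_nonneg (hχ.2.1 u).1, ENNReal.ofReal_le_one]
    exact (hχ.2.1 u).2
  · have : χ u = 0 := by by_contra h; exact hu (hχ.2.2.1 u h)
    rw [this]; simp

/-- The `L²` bound for the vector-valued operator. -/
theorem exists_lintegral_vec_sq_le (hΓ : IsGammaU Γ) (hK : IsHomCZKernel n K) (hψ : IsLPCutoff ψ)
    (hχ : IsChiCutoff χ) :
    ∃ C : ℝ≥0, ∀ l m k : ℤ, ∀ G : Rn n → ℂ, Measurable G → Integrable G →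
      ∫⁻ x, ∫⁻ y, vec Γ K ψ χ l m k G x y ^ 2 ∂(Measure.count.prod volume) ≤
        C * ENNReal.ofReal (((2:ℝ) ^ (m + l))⁻¹ ^ n) * ∫⁻ x, ‖G x‖ₑ ^ 2 := by
  obtain ⟨C, hC⟩ := exists_cv_hker_sq_scale hΓ hK hψ
  obtain ⟨N, hN⟩ := hΓ.exists_tsum_kstar_le
  obtain ⟨V, hV⟩ : ∃ V : ℝ≥0, volume (Icc (1/2:ℝ) 4) = V :=
    ⟨_, (ENNReal.coe_toNNReal (by simp)).symm⟩
  refine ⟨C * V * N * 4, fun l m k G hG hGi => ?_⟩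
  have hm := measurable_vec hΓ hK hψ hχ l m k hG
  set D := ENNReal.ofReal (((2:ℝ) ^ (m + l))⁻¹ ^ n) with hD
  have hcol : ∀ j : ℤ, ∫⁻ u, ∫⁻ x, vec Γ K ψ χ l m k G x (j, u) ^ 2 ≤
      V * (C * D * ∫⁻ x, ‖cv G (lpk n ψ (k - kstar Γ j)) x‖ₑ ^ 2) := by
    intro j
    have h1 : ∀ u : ℝ, ∫⁻ x, vec Γ K ψ χ l m k G x (j, u) ^ 2 ≤ (Icc (1/2:ℝ) 4).indicator
        (fun _ => C * D * ∫⁻ x, ‖cv G (lpk n ψ (k - kstar Γ j)) x‖ₑ ^ 2) u := by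
      intro u
      unfold vec
      by_cases hj : j ∈ Slm Γ l m
      · simp only [indicator_of_mem hj, enorm_mul, mul_pow]
        rw [lintegral_const_mul' _ _ (by finiteness)]
        by_cases hu : u ∈ Icc (1/2:ℝ) 4
        · rw [indicator_of_mem hu]
          have h2 : ‖Complex.ofReal (χ u)‖ₑ ^ 2 ≤ 1 := by
            refine pow_le_one₀ zero_le ((hχ.enorm_le u).trans ?_)
            rw [indicator_of_mem hu]; rfl
          refine (mul_le_mul' h2 (hC l m j hj u hu.1 _
            (measurable_cv hG (continuous_lpk hψ _).measurable) (integrable_cv_lpk hψ hG hGi _))).trans ?_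
          rw [one_mul]
        · rw [indicator_of_notMem hu]
          have h2 := hχ.enorm_le u
          rw [indicator_of_notMem hu, nonpos_iff_eq_zero] at h2
          rw [h2]; simp
      · simp [indicator_of_notMem hj]
    refine (lintegral_mono h1).trans ?_
    rw [lintegral_indicator_const measurableSet_Icc, hV, mul_comm]
  calc ∫⁻ x, ∫⁻ y, vec Γ K ψ χ l m k G x y ^ 2 ∂(Measure.count.prod volume)
      = ∫⁻ y, ∫⁻ x, vec Γ K ψ χ l m k G x y ^ 2 ∂volume ∂(Measure.count.prod volume) :=
        lintegral_lintegral_swap (hm.pow_const 2).aemeasurable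
    _ = ∑' j : ℤ, ∫⁻ u, ∫⁻ x, vec Γ K ψ χ l m k G x (j, u) ^ 2 := by
        rw [lintegral_prod, lintegral_count]
        exact ((hm.pow_const 2).lintegral_prod_left').aemeasurable
    _ ≤ ∑' j : ℤ, V * (C * D * ∫⁻ x, ‖cv G (lpk n ψ (k - kstar Γ j)) x‖ₑ ^ 2) :=
        ENNReal.tsum_le_tsum hcol
    _ = V * (C * D * ∑' j : ℤ, ∫⁻ x, ‖cv G (lpk n ψ (k - kstar Γ j)) x‖ₑ ^ 2) := by
        rw [ENNReal.tsum_mul_left, ENNReal.tsum_mul_left]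
    _ ≤ V * (C * D * (N * ∑' a : ℤ, ∫⁻ x, ‖cv G (lpk n ψ (k - a)) x‖ₑ ^ 2)) := by
        gcongr; exact hN fun a => ∫⁻ x, ‖cv G (lpk n ψ (k - a)) x‖ₑ ^ 2
    _ ≤ V * (C * D * (N * (4 * ∫⁻ x, ‖G x‖ₑ ^ 2))) := by
        gcongr
        refine le_trans (le_of_eq ?_) (tsum_lintegral_cv_lpk_le hψ hG hGi)
        exact (Equiv.subLeft k).tsum_eq fun a => ∫⁻ x, ‖cv G (lpk n ψ a) x‖ₑ ^ 2
    _ = _ := by push_cast; ring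

/-- The left-hand side of the main estimate in terms of `vec`. -/
lemma tsum_eLpNorm_eq_lintegral_vec (hΓ : IsGammaU Γ) (hK : IsHomCZKernel n K) (hψ : IsLPCutoff ψ)
    (hχ : IsChiCutoff χ) (l m k : ℤ) (f : SchwartzMap (Rn n) ℂ) {r : ℝ} (hr : 0 < r) (x : Rn n) :
    ∑' j : Slm Γ l m, eLpNorm (fun u : ℝ => Complex.ofReal (χ u) *
        Hloc Γ K ψ ((2 : ℝ) ^ (j : ℤ) * u) (l + kstar Γ (j : ℤ))
          (LPproj ψ (k - kstar Γ (j : ℤ)) (⇑f)) x) (ENNReal.ofReal r) volume ^ r =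
      ∫⁻ y, vec Γ K ψ χ l m k f x y ^ r ∂(Measure.count.prod volume) := by
  have hm := measurable_vec hΓ hK hψ hχ l m k f.continuous.measurable
  have hm' : Measurable (vec Γ K ψ χ l m k f x) := by
    have := hm.comp (measurable_prodMk_left (x := x))
    simpa only [Function.comp_def] using this
  rw [lintegral_prod _ (hm'.pow_const r).aemeasurable, lintegral_count,
    tsum_subtype (Slm Γ l m) fun j : ℤ => eLpNorm (fun u : ℝ => Complex.ofReal (χ u) *
        Hloc Γ K ψ ((2 : ℝ) ^ j * u) (l + kstar Γ j)
          (LPproj ψ (k - kstar Γ j) (⇑f)) x) (ENNReal.ofReal r) volume ^ r]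
  congr 1; ext j
  unfold vec
  by_cases hj : j ∈ Slm Γ l m
  · simp only [indicator_of_mem hj, LPproj_eq_cv hψ, Hloc_eq_cv]
    rw [eLpNorm_eq_lintegral_rpow_enorm_toReal (by simpa using hr) ENNReal.ofReal_ne_top,
      ENNReal.toReal_ofReal hr.le, ← ENNReal.rpow_mul, one_div_mul_cancel hr.ne', ENNReal.rpow_one]
  · simp [indicator_of_notMem hj, ENNReal.zero_rpow_of_pos hr]

section GeometricSums

/-- One-sided geometric sums over the integers. -/
lemma exists_tsum_le_zpow_rpow {θ : ℝ} (hθ : 0 < θ) : ∃ C : ℝ≥0, ∀ N : ℤ,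
    ∑' i : ℤ, (if i ≤ N then ENNReal.ofReal (2 ^ ((i:ℝ) * θ)) else 0) ≤
      C * ENNReal.ofReal (2 ^ ((N:ℝ) * θ)) := by
  have hlt : ENNReal.ofReal (2 ^ (-θ)) < 1 := by
    rw [ENNReal.ofReal_lt_one]
    exact Real.rpow_lt_one_of_one_lt_of_neg (by norm_num) (by linarith)
  refine ⟨(∑' k : ℕ, ENNReal.ofReal (2 ^ (-θ)) ^ k).toNNReal, fun N => ?_⟩
  rw [ENNReal.coe_toNNReal (by rw [ENNReal.tsum_geometric]; exact ENNReal.inv_ne_top.2 (tsub_pos_of_lt hlt).ne')]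
  rw [← (Equiv.subLeft N).tsum_eq]
  have hsupp : Function.support (fun k : ℤ => if Equiv.subLeft N k ≤ N then
      ENNReal.ofReal (2 ^ (((Equiv.subLeft N k : ℤ) : ℝ) * θ)) else 0) ⊆ range ((↑) : ℕ → ℤ) := by
    intro k hk
    rw [Function.mem_support] at hk
    have : 0 ≤ k := by
      by_contra h
      refine hk (if_neg ?_)
      rw [Equiv.subLeft_apply]; omega
    exact ⟨k.toNat, by omega⟩
  rw [← Nat.cast_injective.tsum_eq hsupp, ← ENNReal.tsum_mul_right]
  refine ENNReal.tsum_le_tsum fun k => ?_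
  rw [if_pos (by rw [Equiv.subLeft_apply]; omega), ← ENNReal.ofReal_pow (by positivity),
    ← ENNReal.ofReal_mul (by positivity), ← Real.rpow_natCast, ← Real.rpow_mul (by norm_num),
    ← Real.rpow_add (by norm_num)]
  refine le_of_eq ?_
  congr 2
  rw [Equiv.subLeft_apply]; push_cast; ring

lemma exists_tsum_zpow_lt_le {θ : ℝ} (hθ : 0 < θ) : ∃ C : ℝ≥0, ∀ t : ℝ, 0 ≤ t →
    ∑' i : ℤ, (if (2:ℝ) ^ (i - 1) < t then ENNReal.ofReal (2 ^ ((i:ℝ) * θ)) else 0) ≤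
      C * ENNReal.ofReal (t ^ θ) := by
  obtain ⟨C, hC⟩ := exists_tsum_le_zpow_rpow hθ
  refine ⟨C * ((2:ℝ) ^ θ).toNNReal, fun t ht => ?_⟩
  rcases ht.eq_or_lt with rfl | ht
  · have : ∀ i : ℤ, ¬ (2:ℝ) ^ (i - 1) < 0 := fun i => not_lt.2 (by positivity)
    simp [this]
  obtain ⟨N, hN1, hN2⟩ := exists_mem_Ico_zpow (show 0 < 2 * t by positivity) (show (1:ℝ) < 2 by norm_num)
  calc _ ≤ ∑' i : ℤ, (if i ≤ N then ENNReal.ofReal (2 ^ ((i:ℝ) * θ)) else 0) := by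
        refine ENNReal.tsum_le_tsum fun i => ?_
        split_ifs with h1 h2
        · exact le_rfl
        · exfalso
          rw [zpow_sub_one₀ (by norm_num)] at h1
          have h3 : (2:ℝ) ^ i < 2 ^ (N + 1) := by linarith
          rw [zpow_lt_zpow_iff_right₀ (by norm_num)] at h3
          omega
        · exact zero_le
        · exact zero_le
    _ ≤ C * ENNReal.ofReal (2 ^ ((N:ℝ) * θ)) := hC N
    _ ≤ C * ENNReal.ofReal (2 ^ θ * t ^ θ) := by
        refine mul_le_mul' le_rfl (ENNReal.ofReal_le_ofReal ?_)
        rw [← zpow_rpow_eq, ← Real.mul_rpow (by norm_num) ht.le]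
        gcongr
    _ = _ := by
        rw [ENNReal.ofReal_mul (by positivity), ENNReal.coe_mul, mul_assoc]; rfl

lemma exists_tsum_le_zpow_le {θ : ℝ} (hθ : 0 < θ) : ∃ C : ℝ≥0, ∀ t : ℝ, 0 < t →
    ∑' i : ℤ, (if t ≤ (2:ℝ) ^ i then ENNReal.ofReal (2 ^ (-((i:ℝ) * θ))) else 0) ≤
      C * ENNReal.ofReal (t ^ (-θ)) := by
  obtain ⟨C, hC⟩ := exists_tsum_le_zpow_rpow hθ
  refine ⟨C, fun t ht => ?_⟩
  obtain ⟨N, hN1, hN2⟩ := exists_mem_Ioc_zpow ht (show (1:ℝ) < 2 by norm_num)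
  calc _ ≤ ∑' i : ℤ, (if -i ≤ -(N + 1) then ENNReal.ofReal (2 ^ (((-i : ℤ):ℝ) * θ)) else 0) := by
        refine ENNReal.tsum_le_tsum fun i => ?_
        split_ifs with h1 h2
        · refine le_of_eq ?_
          push_cast; rw [neg_mul]
        · exfalso
          have h3 : (2:ℝ) ^ N < 2 ^ i := by linarith
          rw [zpow_lt_zpow_iff_right₀ (by norm_num)] at h3
          omega
        · exact zero_le
        · exact zero_le
    _ = ∑' i : ℤ, (if i ≤ -(N + 1) then ENNReal.ofReal (2 ^ ((i:ℝ) * θ)) else 0) :=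
        (Equiv.neg ℤ).tsum_eq fun i : ℤ => if i ≤ -(N + 1) then ENNReal.ofReal (2 ^ ((i:ℝ) * θ)) else 0
    _ ≤ C * ENNReal.ofReal (2 ^ (((-(N + 1) : ℤ):ℝ) * θ)) := hC _
    _ ≤ _ := by
        refine mul_le_mul' le_rfl (ENNReal.ofReal_le_ofReal ?_)
        have : ((-(N + 1) : ℤ):ℝ) * θ = ((N + 1 : ℤ) : ℝ) * (-θ) := by push_cast; ring
        rw [this, ← zpow_rpow_eq]
        exact Real.rpow_le_rpow_of_nonpos ht hN2 (by linarith)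

end GeometricSums

section Cells
variable {n : ℕ}

/-- The index of the dyadic cell of side `2^a` containing `z`. -/
def cellIdx (a : ℤ) (z : Rn n) : Fin n → ℤ := fun i => ⌊(2:ℝ) ^ (-a) * z i⌋

/-- The half-open dyadic cell of side `2^q.1` with index `q.2`. -/
def cell (q : ℤ × (Fin n → ℤ)) : Set (Rn n) := {z | cellIdx q.1 z = q.2}

lemma measurable_cellIdx (a : ℤ) : Measurable (cellIdx (n := n) a) := by
  refine measurable_pi_lambda _ fun i => ?_
  have : Measurable fun z : Rn n => (2:ℝ) ^ (-a) * z i := by fun_prop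
  exact Int.measurable_floor.comp this

lemma measurableSet_cell (q : ℤ × (Fin n → ℤ)) : MeasurableSet (cell q) :=
  measurable_cellIdx q.1 (measurableSet_singleton q.2)

lemma cellIdx_mono {a a' : ℤ} (h : a ≤ a') {y z : Rn n} (hyz : cellIdx a y = cellIdx a z) :
    cellIdx a' y = cellIdx a' z := by
  have hstep : ∀ b : ℤ, cellIdx b y = cellIdx b z → cellIdx (b + 1) y = cellIdx (b + 1) z := by
    intro b hb
    have key : ∀ x : Rn n, ∀ i, cellIdx (b + 1) x i = cellIdx b x i / 2 := fun x i => by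
      have := Int.floor_div_natCast ((2:ℝ) ^ (-b) * x i) 2
      simp only [cellIdx]
      push_cast at this
      rw [← this]; congr 1
      rw [neg_add, zpow_add₀ (by norm_num)]; norm_num; ring
    ext i
    rw [key, key, hb]
  exact Int.leInduction (motive := fun b _ => cellIdx b y = cellIdx b z) hyz (fun b _ => hstep b) a' h

lemma volume_cell (q : ℤ × (Fin n → ℤ)) : volume (cell q) = ENNReal.ofReal (((2:ℝ) ^ q.1) ^ n) := by
  have h2 : (0:ℝ) < 2 ^ q.1 := by positivity
  have h1 : cell q = (MeasurableEquiv.toLp 2 (Fin n → ℝ)).symm ⁻¹'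
      (Set.pi univ fun i => Ico ((2:ℝ) ^ q.1 * q.2 i) (2 ^ q.1 * (q.2 i + 1))) := by
    ext z
    simp only [cell, Set.mem_ofPred_eq, mem_preimage, Set.mem_pi, mem_univ, true_imp_iff, funext_iff, cellIdx,
      Int.floor_eq_iff, mem_Ico, zpow_neg, inv_mul_eq_div, le_div_iff₀ h2, div_lt_iff₀ h2]
    simp only [mul_comm, MeasurableEquiv.coe_toLp_symm]
  rw [h1, (EuclideanSpace.volume_preserving_symm_measurableEquiv_toLp (Fin n)).measure_preimage
    (MeasurableSet.univ_pi fun i => measurableSet_Ico).nullMeasurableSet, volume_pi_pi]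
  simp only [Real.volume_Ico]
  have : ∀ i, (2:ℝ) ^ q.1 * (q.2 i + 1) - 2 ^ q.1 * q.2 i = 2 ^ q.1 := fun i => by ring
  simp only [this, Finset.prod_const, Finset.card_univ, Fintype.card_fin]
  rw [ENNReal.ofReal_pow h2.le]

/-- The corner of a cell. -/
def cellCorner (q : ℤ × (Fin n → ℤ)) : Rn n := WithLp.toLp 2 fun i => (2:ℝ) ^ q.1 * q.2 i

lemma norm_sub_le_of_coord {y z : Rn n} {s : ℝ} (hs : 0 ≤ s) (h : ∀ i, |y i - z i| ≤ s) :
    ‖y - z‖ ≤ (n + 1) * s := by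
  have h1 : ‖y - z‖ ^ 2 ≤ n * s ^ 2 := by
    rw [EuclideanSpace.norm_sq_eq]
    calc _ ≤ ∑ i : Fin n, s ^ 2 := by
          refine Finset.sum_le_sum fun i _ => ?_
          rw [PiLp.sub_apply, Real.norm_eq_abs]
          exact pow_le_pow_left₀ (abs_nonneg _) (h i) 2
      _ = _ := by simp
  refine le_of_sq_le_sq (h1.trans ?_) (by positivity)
  rw [mul_pow]
  gcongr
  nlinarith [(Nat.cast_nonneg n : (0:ℝ) ≤ n)]

lemma norm_sub_cellCorner_le {q : ℤ × (Fin n → ℤ)} {z : Rn n} (hz : z ∈ cell q) :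
    ‖z - cellCorner q‖ ≤ (n + 1) * 2 ^ q.1 := by
  have h2 : (0:ℝ) < 2 ^ q.1 := by positivity
  refine norm_sub_le_of_coord h2.le fun i => ?_
  have h1 : ⌊(2:ℝ) ^ (-q.1) * z i⌋ = q.2 i := congrFun hz i
  rw [Int.floor_eq_iff, zpow_neg, inv_mul_eq_div, le_div_iff₀ h2, div_lt_iff₀ h2] at h1
  simp only [cellCorner]
  rw [abs_le]; constructor <;> linarith [h1.1, h1.2]

lemma norm_sub_le_of_cellIdx_eq {a : ℤ} {y z : Rn n} (h : cellIdx a y = cellIdx a z) :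
    ‖y - z‖ ≤ (n + 1) * 2 ^ a := by
  have h2 : (0:ℝ) < 2 ^ a := by positivity
  refine norm_sub_le_of_coord h2.le fun i => ?_
  have h1 := (Int.abs_sub_lt_one_of_floor_eq_floor (congrFun h i)).le
  rw [← mul_sub, abs_mul, abs_of_pos (by positivity), zpow_neg, inv_mul_le_iff₀ h2] at h1
  linarith

end Cells

section Stopping
variable {n : ℕ} {f : Rn n → ℂ} {i : ℤ} {y z : Rn n}

/-- The scales at which the average of `|f|` over the dyadic cell of `y` exceeds `2^i`. -/
def heavySet (f : Rn n → ℂ) (i : ℤ) (y : Rn n) : Set ℤ :=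
  {a | ENNReal.ofReal (2 ^ i * ((2:ℝ) ^ a) ^ n) < ∫⁻ z in cell (a, cellIdx a y), ‖f z‖ₑ}

/-- The set where the dyadic maximal function of `f` exceeds `2^i`. -/
def badSet (f : Rn n → ℂ) (i : ℤ) : Set (Rn n) := {y | (heavySet f i y).Nonempty}

/-- The maximal cell containing `y` on which the average of `|f|` exceeds `2^i`. -/
def stopCell (f : Rn n → ℂ) (i : ℤ) (y : Rn n) : ℤ × (Fin n → ℤ) :=
  (sSup (heavySet f i y), cellIdx (sSup (heavySet f i y)) y)

/-- The average of `f` over a cell. -/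
def cellAvg (f : Rn n → ℂ) (q : ℤ × (Fin n → ℤ)) : ℂ :=
  (((((2:ℝ) ^ q.1) ^ n)⁻¹ : ℝ) : ℂ) * ∫ z in cell q, f z

open Classical in
/-- The good part of the Calderón–Zygmund decomposition at height `2^i`. -/
def goodPart (f : Rn n → ℂ) (i : ℤ) (y : Rn n) : ℂ :=
  if y ∈ badSet f i then cellAvg f (stopCell f i y) else f y

lemma bddAbove_heavySet (hn : n ≠ 0) (hf : Integrable f) : BddAbove (heavySet f i y) := by
  obtain ⟨I, hI⟩ : ∃ I : ℝ≥0, ∫⁻ z, ‖f z‖ₑ = I := ⟨_, (ENNReal.coe_toNNReal hf.2.ne).symm⟩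
  refine ⟨max 0 ⌈(I:ℝ) / 2 ^ i⌉, fun a ha => ?_⟩
  by_contra hcon
  rw [not_le, max_lt_iff] at hcon
  obtain ⟨h0, h1⟩ := hcon
  have h2 : ENNReal.ofReal (2 ^ i * ((2:ℝ) ^ a) ^ n) < I :=
    lt_of_lt_of_le ha ((setLIntegral_le_lintegral _ _).trans hI.le)
  rw [ENNReal.ofReal_lt_coe_iff (by positivity)] at h2
  have h3 : (I:ℝ) / 2 ^ i < a := (Int.le_ceil _).trans_lt (by exact_mod_cast h1)
  rw [div_lt_iff₀ (by positivity)] at h3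
  obtain ⟨b, rfl⟩ : ∃ b : ℕ, a = b := ⟨a.toNat, by omega⟩
  have h4 : ((b:ℤ):ℝ) ≤ (2:ℝ) ^ (b:ℤ) := by
    rw [zpow_natCast]; exact_mod_cast (Nat.lt_two_pow_self (n := b)).le
  have h5 : (2:ℝ) ^ (b:ℤ) ≤ ((2:ℝ) ^ (b:ℤ)) ^ n := by
    refine le_self_pow₀ ?_ hn
    rw [zpow_natCast]; exact one_le_pow₀ (by norm_num)
  have h6 : (0:ℝ) < 2 ^ i := by positivity
  nlinarith

lemma isGreatest_stopCell (hn : n ≠ 0) (hf : Integrable f) (hy : y ∈ badSet f i) :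
    IsGreatest (heavySet f i y) (stopCell f i y).1 :=
  ⟨Int.csSup_mem hy (bddAbove_heavySet hn hf), fun _ ha => le_csSup (bddAbove_heavySet hn hf) ha⟩

lemma mem_cell_stopCell : y ∈ cell (stopCell f i y) := rfl

lemma stopCell_eq (hn : n ≠ 0) (hf : Integrable f) (hy : y ∈ badSet f i)
    (hz : z ∈ cell (stopCell f i y)) : z ∈ badSet f i ∧ stopCell f i z = stopCell f i y := by
  have hg := isGreatest_stopCell hn hf hy
  have hz' : cellIdx (stopCell f i y).1 z = cellIdx (stopCell f i y).1 y := hz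
  have hiff : ∀ a, (stopCell f i y).1 ≤ a → (a ∈ heavySet f i z ↔ a ∈ heavySet f i y) := by
    intro a ha
    simp only [heavySet, Set.mem_ofPred_eq, cellIdx_mono ha hz']
  have hmem : (stopCell f i y).1 ∈ heavySet f i z := (hiff _ le_rfl).2 hg.1
  have hzb : z ∈ badSet f i := ⟨_, hmem⟩
  have hgz := isGreatest_stopCell hn hf hzb
  have heq : (stopCell f i z).1 = (stopCell f i y).1 := by
    refine le_antisymm (hg.2 ((hiff _ ?_).1 hgz.1)) (hgz.2 hmem)
    exact hgz.2 hmem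
  refine ⟨hzb, Prod.ext heq ?_⟩
  change cellIdx (stopCell f i z).1 z = cellIdx (stopCell f i y).1 y
  rw [heq, hz']

lemma measurableSet_badSet : MeasurableSet (badSet f i) := by
  have : badSet f i = ⋃ a : ℤ, cellIdx a ⁻¹' {v | ENNReal.ofReal (2 ^ i * ((2:ℝ) ^ a) ^ n) <
      ∫⁻ z in cell (a, v), ‖f z‖ₑ} := by
    ext y; simp [badSet, heavySet, Set.Nonempty]
  rw [this]
  exact MeasurableSet.iUnion fun a => measurable_cellIdx a (Set.to_countable _).measurableSet

/-- The part of `badSet f i` on which the stopping cell is `q`: all of the cell `q`, or nothing. -/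
def stopPiece (f : Rn n → ℂ) (i : ℤ) (q : ℤ × (Fin n → ℤ)) : Set (Rn n) :=
  {y | y ∈ badSet f i ∧ stopCell f i y = q}

lemma stopPiece_eq (hn : n ≠ 0) (hf : Integrable f) {q : ℤ × (Fin n → ℤ)}
    (hy : y ∈ stopPiece f i q) : stopPiece f i q = cell q := by
  obtain ⟨hy, rfl⟩ := hy
  ext z
  refine ⟨fun hz => ?_, fun hz => stopCell_eq hn hf hy hz⟩
  have : z ∈ cell (stopCell f i z) := mem_cell_stopCell
  rwa [hz.2] at this

lemma stopPiece_eq_empty_or (hn : n ≠ 0) (hf : Integrable f) (i : ℤ) (q : ℤ × (Fin n → ℤ)) :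
    stopPiece f i q = ∅ ∨ stopPiece f i q = cell q := by
  rcases (stopPiece f i q).eq_empty_or_nonempty with h | ⟨y, hy⟩
  · exact Or.inl h
  · exact Or.inr (stopPiece_eq hn hf hy)

lemma measurableSet_stopPiece (hn : n ≠ 0) (hf : Integrable f) (i : ℤ) (q : ℤ × (Fin n → ℤ)) :
    MeasurableSet (stopPiece f i q) := by
  rcases stopPiece_eq_empty_or hn hf i q with h | h <;> rw [h]
  · exact MeasurableSet.empty
  · exact measurableSet_cell q

lemma pairwise_disjoint_stopPiece : Pairwise (Function.onFun Disjoint (stopPiece f i)) :=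
  fun _ _ hq => Set.disjoint_left.2 fun _ h1 h2 => hq (h1.2.symm.trans h2.2)

lemma iUnion_stopPiece : ⋃ q, stopPiece f i q = badSet f i := by
  ext y; simp [stopPiece]

lemma measurable_goodPart (hn : n ≠ 0) (hf : Integrable f) (hfm : Measurable f) (i : ℤ) :
    Measurable (goodPart f i) := by
  classical
  have hst : Measurable (stopCell f i) := by
    refine measurable_to_countable' fun q => ?_
    have : stopCell f i ⁻¹' {q} = stopPiece f i q ∪ ((badSet f i)ᶜ ∩
        {y | ((0:ℤ), cellIdx 0 y) = q}) := by
      ext y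
      by_cases hy : y ∈ badSet f i
      · simp [stopPiece, hy]
      · have : heavySet f i y = ∅ := not_nonempty_iff_eq_empty.1 hy
        have h0 : stopCell f i y = (0, cellIdx 0 y) := by
          unfold stopCell
          rw [this, Int.csSup_empty]
        simp [stopPiece, hy, h0]
    rw [this]
    refine (measurableSet_stopPiece hn hf i q).union (measurableSet_badSet.compl.inter ?_)
    exact (measurable_const.prodMk (measurable_cellIdx 0)) (measurableSet_singleton q)
  exact Measurable.ite measurableSet_badSet ((measurable_of_countable (cellAvg f)).comp hst) hfm

lemma badSet_anti (f : Rn n → ℂ) {i i' : ℤ} (h : i ≤ i') (y : Rn n) :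
    heavySet f i' y ⊆ heavySet f i y := fun a ha => by
  refine lt_of_le_of_lt (ENNReal.ofReal_le_ofReal ?_) ha
  gcongr
  norm_num

lemma goodPart_of_notMem (hy : y ∉ badSet f i) : goodPart f i y = f y := if_neg hy

lemma norm_le_of_notMem_badSet (hf : Continuous f) (hy : y ∉ badSet f i) : ‖f y‖ ≤ 2 ^ i := by
  by_contra hcon
  rw [not_le] at hcon
  obtain ⟨s, hs1, hs2⟩ := exists_between hcon
  have hev : ∀ᶠ z in 𝓝 y, s < ‖f z‖ := (hf.norm.tendsto y).eventually (lt_mem_nhds hs2)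
  obtain ⟨ε, hε, hball⟩ := Metric.eventually_nhds_iff.1 hev
  obtain ⟨k, hk⟩ := exists_pow_lt_of_lt_one (show 0 < ε / (n + 1) by positivity) (show (1/2:ℝ) < 1 by norm_num)
  refine hy ⟨-(k:ℤ), ?_⟩
  have hk' : (n + 1) * (2:ℝ) ^ (-(k:ℤ)) < ε := by
    rw [lt_div_iff₀ (by positivity)] at hk
    rw [zpow_neg, zpow_natCast]
    rw [one_div, inv_pow] at hk
    linarith
  have hs0 : 0 < s := lt_trans (by positivity) hs1
  calc ENNReal.ofReal (2 ^ i * ((2:ℝ) ^ (-(k:ℤ))) ^ n)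
      < ENNReal.ofReal s * volume (cell (-(k:ℤ), cellIdx (-(k:ℤ)) y)) := by
        rw [volume_cell, ← ENNReal.ofReal_mul hs0.le, ENNReal.ofReal_lt_ofReal_iff (by positivity)]
        gcongr
    _ = ∫⁻ z in cell (-(k:ℤ), cellIdx (-(k:ℤ)) y), ENNReal.ofReal s := (setLIntegral_const _ _).symm
    _ ≤ _ := by
        refine setLIntegral_mono' (measurableSet_cell _) fun z hz => ?_
        rw [← ofReal_norm]
        refine ENNReal.ofReal_le_ofReal (hball ?_).le
        rw [dist_eq_norm]
        exact (norm_sub_le_of_cellIdx_eq hz).trans_lt hk'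

lemma enorm_goodPart_le (hn : n ≠ 0) (hf : Integrable f) (hfc : Continuous f) (i : ℤ) (y : Rn n) :
    ‖goodPart f i y‖ₑ ≤ ENNReal.ofReal (2 ^ n * 2 ^ i) := by
  by_cases hy : y ∈ badSet f i
  · rw [goodPart, if_pos hy, cellAvg, enorm_mul]
    have hg := isGreatest_stopCell hn hf hy
    set a := (stopCell f i y).1 with ha
    have h2 : (0:ℝ) < 2 ^ a := by positivity
    have h1 : a + 1 ∉ heavySet f i y := fun h => by have := hg.2 h; omega
    have h3 : ‖∫ z in cell (stopCell f i y), f z‖ₑ ≤ ENNReal.ofReal (2 ^ i * ((2:ℝ) ^ (a + 1)) ^ n) := by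
      refine (enorm_integral_le_lintegral_enorm _).trans (le_trans (lintegral_mono_set ?_) (not_lt.1 h1))
      intro z hz
      exact cellIdx_mono (by omega : a ≤ a + 1) hz
    calc _ ≤ ENNReal.ofReal ((((2:ℝ) ^ a) ^ n)⁻¹) * ENNReal.ofReal (2 ^ i * ((2:ℝ) ^ (a + 1)) ^ n) := by
          refine mul_le_mul' (le_of_eq ?_) h3
          rw [← ofReal_norm, Complex.norm_real, Real.norm_of_nonneg (by positivity)]
      _ = _ := by
          rw [← ENNReal.ofReal_mul (by positivity), zpow_add_one₀ (by norm_num), mul_pow]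
          congr 1
          field_simp
  · rw [goodPart_of_notMem hy, ← ofReal_norm]
    refine ENNReal.ofReal_le_ofReal ((norm_le_of_notMem_badSet hfc hy).trans ?_)
    exact le_mul_of_one_le_left (by positivity) (one_le_pow₀ (by norm_num))

lemma volume_badSet_eq (hn : n ≠ 0) (hf : Integrable f) (i : ℤ) :
    volume (badSet f i) = ∑' q, volume (stopPiece f i q) := by
  rw [← iUnion_stopPiece, measure_iUnion pairwise_disjoint_stopPiece (measurableSet_stopPiece hn hf i)]

lemma volume_badSet_le (hn : n ≠ 0) (hf : Integrable f) (hfm : Measurable f) (i : ℤ) :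
    ENNReal.ofReal (2 ^ (i - 1)) * volume (badSet f i) ≤
      ∫⁻ y, if (2:ℝ) ^ (i - 1) < ‖f y‖ then ‖f y‖ₑ else 0 := by
  set g : Rn n → ℝ≥0∞ := fun y => if (2:ℝ) ^ (i - 1) < ‖f y‖ then ‖f y‖ₑ else 0 with hg
  have hgm : Measurable g := Measurable.ite (measurableSet_lt measurable_const hfm.norm) hfm.enorm measurable_const
  have h1 : ∀ q, ENNReal.ofReal (2 ^ (i - 1)) * volume (stopPiece f i q) ≤ ∫⁻ y in stopPiece f i q, g y := by
    intro q
    rcases (stopPiece f i q).eq_empty_or_nonempty with h | ⟨y, hy⟩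
    · simp [h]
    have hq := stopPiece_eq hn hf hy
    have hheavy := (isGreatest_stopCell hn hf hy.1).1
    obtain ⟨hyb, rfl⟩ := hy
    rw [hq]
    have h2 : ENNReal.ofReal (2 ^ i) * volume (cell (stopCell f i y)) ≤
        ∫⁻ z in cell (stopCell f i y), ‖f z‖ₑ := by
      rw [volume_cell, ← ENNReal.ofReal_mul (by positivity)]
      exact le_of_lt hheavy
    have h3 : ∫⁻ z in cell (stopCell f i y), ‖f z‖ₑ ≤ (∫⁻ z in cell (stopCell f i y), g z) +
        ENNReal.ofReal (2 ^ (i - 1)) * volume (cell (stopCell f i y)) := by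
      rw [← setLIntegral_const, ← lintegral_add_left hgm]
      refine lintegral_mono fun z => ?_
      simp only [hg]
      split_ifs with h
      · exact le_self_add
      · rw [zero_add, ← ofReal_norm]; exact ENNReal.ofReal_le_ofReal (not_lt.1 h)
    have h4 : ENNReal.ofReal (2 ^ i) = ENNReal.ofReal (2 ^ (i - 1)) + ENNReal.ofReal (2 ^ (i - 1)) := by
      rw [← ENNReal.ofReal_add (by positivity) (by positivity), zpow_sub_one₀ (by norm_num)]
      congr 1; ring
    rw [h4, add_mul] at h2
    have h5 : ENNReal.ofReal (2 ^ (i - 1)) * volume (cell (stopCell f i y)) ≠ ∞ := by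
      rw [volume_cell]; finiteness
    exact (ENNReal.add_le_add_iff_right h5).1 (h2.trans h3)
  calc _ = ∑' q, ENNReal.ofReal (2 ^ (i - 1)) * volume (stopPiece f i q) := by
        rw [volume_badSet_eq hn hf, ENNReal.tsum_mul_left]
    _ ≤ ∑' q, ∫⁻ y in stopPiece f i q, g y := ENNReal.tsum_le_tsum h1
    _ = ∫⁻ y in badSet f i, g y := by
        rw [← iUnion_stopPiece, lintegral_iUnion (measurableSet_stopPiece hn hf i) pairwise_disjoint_stopPiece]
    _ ≤ _ := setLIntegral_le_lintegral _ _

lemma volume_badSet_ne_top (hn : n ≠ 0) (hf : Integrable f) (hfm : Measurable f) (i : ℤ) :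
    volume (badSet f i) ≠ ∞ := by
  intro h
  have h1 := volume_badSet_le hn hf hfm i
  rw [h, ENNReal.mul_top (by rw [ne_eq, ENNReal.ofReal_eq_zero, not_le]; positivity), top_le_iff] at h1
  refine (lt_of_le_of_lt (lintegral_mono fun y => ?_) hf.2).ne h1
  split_ifs
  · exact le_rfl
  · exact zero_le

lemma integrable_goodPart (hn : n ≠ 0) (hf : Integrable f) (hfc : Continuous f) (i : ℤ) :
    Integrable (goodPart f i) := by
  refine ⟨(measurable_goodPart hn hf hfc.measurable i).aestronglyMeasurable, ?_⟩
  have hV := volume_badSet_ne_top hn hf hfc.measurable i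
  calc ∫⁻ y, ‖goodPart f i y‖ₑ ≤ ∫⁻ y, (‖f y‖ₑ + (badSet f i).indicator
        (fun _ => ENNReal.ofReal (2 ^ n * 2 ^ i)) y) := by
        refine lintegral_mono fun y => ?_
        by_cases hy : y ∈ badSet f i
        · rw [indicator_of_mem hy]
          exact (enorm_goodPart_le hn hf hfc i y).trans le_add_self
        · rw [goodPart_of_notMem hy]; exact le_self_add
    _ = (∫⁻ y, ‖f y‖ₑ) + ENNReal.ofReal (2 ^ n * 2 ^ i) * volume (badSet f i) := by
        rw [lintegral_add_left hfc.measurable.enorm, lintegral_indicator_const measurableSet_badSet]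
    _ < ∞ := ENNReal.add_lt_top.2 ⟨hf.2, ENNReal.mul_lt_top ENNReal.ofReal_lt_top hV.lt_top⟩

/-- The good part has the same integral as `f` over sets made of whole stopping cells. -/
lemma setIntegral_goodPart (hn : n ≠ 0) (hf : Integrable f) (hfc : Continuous f) (i : ℤ) {W : Set (Rn n)}
    (hW : MeasurableSet W) (hWs : ∀ y ∈ W, y ∈ badSet f i → cell (stopCell f i y) ⊆ W) :
    ∫ y in W, goodPart f i y = ∫ y in W, f y := by
  have hG := integrable_goodPart hn hf hfc i
  have hGf : Integrable fun y => goodPart f i y - f y := hG.sub hf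
  have hpiece : ∀ q, ∫ y in W ∩ stopPiece f i q, (goodPart f i y - f y) = 0 := by
    intro q
    rcases (W ∩ stopPiece f i q).eq_empty_or_nonempty with h | ⟨y, hyW, hy⟩
    · simp [h]
    have h1 : W ∩ stopPiece f i q = cell q := by
      rw [stopPiece_eq hn hf hy]
      refine inter_eq_right.2 ?_
      rw [← hy.2]; exact hWs y hyW hy.1
    rw [h1, integral_sub hG.integrableOn hf.integrableOn]
    have h2 : ∀ z ∈ cell q, goodPart f i z = cellAvg f q := by
      intro z hz
      rw [← stopPiece_eq hn hf hy] at hz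
      rw [goodPart, if_pos hz.1, hz.2]
    rw [setIntegral_congr_fun (measurableSet_cell q) h2, setIntegral_const, measureReal_def, volume_cell,
      ENNReal.toReal_ofReal (by positivity), cellAvg, Complex.real_smul, ← mul_assoc, ← Complex.ofReal_mul,
      mul_inv_cancel₀ (by positivity), Complex.ofReal_one, one_mul, sub_self]
  have hbad : ∫ y in W ∩ badSet f i, (goodPart f i y - f y) = 0 := by
    rw [← iUnion_stopPiece, inter_iUnion, integral_iUnion
      (fun q => hW.inter (measurableSet_stopPiece hn hf i q))
      (fun q q' h => (pairwise_disjoint_stopPiece h).mono inter_subset_right inter_subset_right)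
      hGf.integrableOn]
    simp [hpiece]
  have hgood : ∫ y in W \ badSet f i, (goodPart f i y - f y) = 0 := by
    rw [← integral_zero (Rn n) ℂ (μ := volume.restrict (W \ badSet f i))]
    refine setIntegral_congr_fun (hW.diff measurableSet_badSet) fun y hy => ?_
    simp [goodPart_of_notMem hy.2]
  have := integral_inter_add_sdiff (s := W) measurableSet_badSet hGf.integrableOn (t := badSet f i)
  rw [hbad, hgood, add_zero, integral_sub hG.integrableOn hf.integrableOn] at this
  exact sub_eq_zero.1 this.symm

lemma badSet_eq_empty {M : ℤ} (hM : ∀ y, ‖f y‖ ≤ 2 ^ M) (h : M ≤ i) : badSet f i = ∅ := by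
  refine eq_empty_of_forall_notMem fun y ⟨a, ha⟩ => ?_
  refine absurd (show ENNReal.ofReal _ < _ from ha) (not_lt.2 ?_)
  calc ∫⁻ z in cell (a, cellIdx a y), ‖f z‖ₑ ≤ ∫⁻ z in cell (a, cellIdx a y), ENNReal.ofReal (2 ^ i) := by
        refine lintegral_mono fun z => ?_
        rw [← ofReal_norm]
        refine ENNReal.ofReal_le_ofReal ((hM z).trans ?_)
        gcongr
        norm_num
    _ = _ := by
        rw [setLIntegral_const, volume_cell, ← ENNReal.ofReal_mul (by positivity)]

end Stopping

section CalderonZygmund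
variable {n : ℕ} {p : ℝ}

lemma exists_tsum_volume_badSet_le (hn : n ≠ 0) (hp1 : 1 < p) : ∃ C : ℝ≥0, ∀ f : Rn n → ℂ,
    Integrable f → Measurable f →
    ∑' i : ℤ, ENNReal.ofReal (2 ^ ((i:ℝ) * p)) * volume (badSet f i) ≤ C * ∫⁻ y, ‖f y‖ₑ ^ p := by
  obtain ⟨C, hC⟩ := exists_tsum_zpow_lt_le (show 0 < p - 1 by linarith)
  refine ⟨2 * C, fun f hf hfm => ?_⟩
  have hm : ∀ i : ℤ, Measurable fun y => if (2:ℝ) ^ (i - 1) < ‖f y‖ then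
      ENNReal.ofReal (2 ^ ((i:ℝ) * (p - 1))) else 0 := fun i =>
    Measurable.ite (measurableSet_lt measurable_const hfm.norm) measurable_const measurable_const
  calc _ ≤ ∑' i : ℤ, 2 * ∫⁻ y, ‖f y‖ₑ * (if (2:ℝ) ^ (i - 1) < ‖f y‖ then
        ENNReal.ofReal (2 ^ ((i:ℝ) * (p - 1))) else 0) := by
        refine ENNReal.tsum_le_tsum fun i => ?_
        have h1 : ENNReal.ofReal (2 ^ ((i:ℝ) * p)) =
            2 * (ENNReal.ofReal (2 ^ ((i:ℝ) * (p - 1))) * ENNReal.ofReal (2 ^ (i - 1))) := by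
          rw [← ENNReal.ofReal_mul (by positivity), ← ENNReal.ofReal_ofNat 2, ← ENNReal.ofReal_mul (by norm_num),
            ← Real.rpow_intCast, ← Real.rpow_add (by norm_num)]
          nth_rewrite 2 [← Real.rpow_one 2]
          rw [← Real.rpow_add (by norm_num)]
          congr 2; push_cast; ring
        rw [h1, mul_assoc, mul_assoc]
        refine mul_le_mul' le_rfl ((mul_le_mul' le_rfl (volume_badSet_le hn hf hfm i)).trans (le_of_eq ?_))
        rw [← lintegral_const_mul' _ _ ENNReal.ofReal_ne_top]
        congr 1; ext y
        split_ifs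
        · rw [mul_comm]
        · simp
    _ = 2 * ∫⁻ y, ‖f y‖ₑ * ∑' i : ℤ, (if (2:ℝ) ^ (i - 1) < ‖f y‖ then
        ENNReal.ofReal (2 ^ ((i:ℝ) * (p - 1))) else 0) := by
        have hm' : ∀ i : ℤ, AEMeasurable (fun y => ‖f y‖ₑ * if (2:ℝ) ^ (i - 1) < ‖f y‖ then
            ENNReal.ofReal (2 ^ ((i:ℝ) * (p - 1))) else 0) volume :=
          fun i => (hfm.enorm.mul (hm i)).aemeasurable
        rw [ENNReal.tsum_mul_left, ← lintegral_tsum hm']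
        simp_rw [ENNReal.tsum_mul_left]
    _ ≤ 2 * ∫⁻ y, C * ‖f y‖ₑ ^ p := by
        refine mul_le_mul' le_rfl (lintegral_mono fun y => ?_)
        refine (mul_le_mul' le_rfl (hC _ (norm_nonneg (f y)))).trans (le_of_eq ?_)
        rw [← ENNReal.ofReal_rpow_of_nonneg (norm_nonneg _) (by linarith), ofReal_norm, mul_left_comm]
        congr 1
        nth_rewrite 1 [← ENNReal.rpow_one ‖f y‖ₑ]
        rw [← ENNReal.rpow_add_of_nonneg _ _ zero_le_one (by linarith)]
        congr 1; ring
    _ = _ := by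
        rw [lintegral_const_mul' _ _ ENNReal.coe_ne_top, ENNReal.coe_mul, mul_assoc]; rfl

lemma exists_tsum_tail_volume_badSet_le (hn : n ≠ 0) (hp1 : 1 < p) : ∃ C : ℝ≥0, ∀ f : Rn n → ℂ,
    Integrable f → Measurable f →
    ∑' i : ℤ, ENNReal.ofReal (2 ^ ((i:ℝ) * (p - 1))) *
      ∑' i' : ℤ, (if i ≤ i' then ENNReal.ofReal (2 ^ i') * volume (badSet f i') else 0) ≤
      C * ∫⁻ y, ‖f y‖ₑ ^ p := by
  obtain ⟨C, hC⟩ := exists_tsum_volume_badSet_le hn hp1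
  obtain ⟨C', hC'⟩ := exists_tsum_le_zpow_rpow (show 0 < p - 1 by linarith)
  refine ⟨C' * C, fun f hf hfm => ?_⟩
  calc _ = ∑' i' : ℤ, (∑' i : ℤ, (if i ≤ i' then ENNReal.ofReal (2 ^ ((i:ℝ) * (p - 1))) else 0)) *
        (ENNReal.ofReal (2 ^ i') * volume (badSet f i')) := by
        simp_rw [← ENNReal.tsum_mul_left, ← ENNReal.tsum_mul_right]
        rw [ENNReal.tsum_comm]
        congr 1; ext i'; congr 1; ext i
        split_ifs <;> simp
    _ ≤ ∑' i' : ℤ, C' * (ENNReal.ofReal (2 ^ ((i':ℝ) * p)) * volume (badSet f i')) := by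
        refine ENNReal.tsum_le_tsum fun i' => (mul_le_mul' (hC' i') le_rfl).trans (le_of_eq ?_)
        rw [mul_assoc, ← mul_assoc (ENNReal.ofReal _), ← ENNReal.ofReal_mul (by positivity),
          ← Real.rpow_intCast, ← Real.rpow_add (by norm_num)]
        congr 4; ring
    _ ≤ _ := by
        rw [ENNReal.tsum_mul_left, ENNReal.coe_mul, mul_assoc]
        exact mul_le_mul' le_rfl (hC f hf hfm)

lemma exists_tsum_goodPart_sq_le (hn : n ≠ 0) (hp1 : 1 < p) (hp2 : p < 2) : ∃ C : ℝ≥0, ∀ f : Rn n → ℂ,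
    Integrable f → Continuous f →
    ∑' i : ℤ, ENNReal.ofReal (2 ^ (-((i:ℝ) * (2 - p)))) * ∫⁻ y, ‖goodPart f i y‖ₑ ^ 2 ≤
      C * ∫⁻ y, ‖f y‖ₑ ^ p := by
  obtain ⟨C, hC⟩ := exists_tsum_volume_badSet_le hn hp1
  obtain ⟨C', hC'⟩ := exists_tsum_le_zpow_le (show 0 < 2 - p by linarith)
  refine ⟨4 ^ n * C + C', fun f hf hfc => ?_⟩
  have hfm := hfc.measurable
  have hm : ∀ i : ℤ, Measurable fun y => if ‖f y‖ ≤ (2:ℝ) ^ i then ‖f y‖ₑ ^ 2 else 0 := fun i =>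
    Measurable.ite (measurableSet_le hfm.norm measurable_const) (hfm.enorm.pow_const 2) measurable_const
  have h1 : ∀ i : ℤ, ∫⁻ y, ‖goodPart f i y‖ₑ ^ 2 ≤
      ENNReal.ofReal (2 ^ n * 2 ^ i) ^ 2 * volume (badSet f i) +
        ∫⁻ y, if ‖f y‖ ≤ (2:ℝ) ^ i then ‖f y‖ₑ ^ 2 else 0 := by
    intro i
    rw [← lintegral_indicator_const measurableSet_badSet, ← lintegral_add_right _ (hm i)]
    refine lintegral_mono fun y => ?_
    by_cases hy : y ∈ badSet f i
    · rw [indicator_of_mem hy]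
      exact (pow_le_pow_left' (enorm_goodPart_le hn hf hfc i y) 2).trans le_self_add
    · rw [indicator_of_notMem hy, zero_add, if_pos (norm_le_of_notMem_badSet hfc hy), goodPart_of_notMem hy]
  calc _ ≤ ∑' i : ℤ, (4 ^ n * (ENNReal.ofReal (2 ^ ((i:ℝ) * p)) * volume (badSet f i)) +
        ∫⁻ y, (if ‖f y‖ ≤ (2:ℝ) ^ i then ENNReal.ofReal (2 ^ (-((i:ℝ) * (2 - p)))) else 0) * ‖f y‖ₑ ^ 2) := by
        refine ENNReal.tsum_le_tsum fun i => (mul_le_mul' le_rfl (h1 i)).trans (le_of_eq ?_)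
        rw [mul_add]
        congr 1
        · rw [← mul_assoc, ← mul_assoc]
          congr 1
          rw [← ENNReal.ofReal_pow (by positivity), ← ENNReal.ofReal_mul (by positivity)]
          have : (4:ℝ≥0∞) ^ n = ENNReal.ofReal (4 ^ n) := by
            rw [ENNReal.ofReal_pow (by norm_num)]; norm_num
          rw [this, ← ENNReal.ofReal_mul (by positivity)]
          congr 1
          have h4 : ((2:ℝ) ^ n * 2 ^ i) ^ 2 = 4 ^ n * 2 ^ ((i:ℝ) * 2) := by
            rw [← zpow_rpow_eq, mul_pow, ← pow_mul, mul_comm n 2, pow_mul]; norm_num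
          rw [h4, mul_left_comm, ← Real.rpow_add (by norm_num)]
          congr 2; ring
        · rw [← lintegral_const_mul' _ _ ENNReal.ofReal_ne_top]
          congr 1; ext y
          split_ifs <;> simp
    _ = 4 ^ n * (∑' i : ℤ, ENNReal.ofReal (2 ^ ((i:ℝ) * p)) * volume (badSet f i)) +
        ∫⁻ y, (∑' i : ℤ, if ‖f y‖ ≤ (2:ℝ) ^ i then ENNReal.ofReal (2 ^ (-((i:ℝ) * (2 - p)))) else 0) *
          ‖f y‖ₑ ^ 2 := by
        rw [ENNReal.tsum_add, ENNReal.tsum_mul_left]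
        simp_rw [← ENNReal.tsum_mul_right]
        rw [lintegral_tsum fun i => ?_]
        exact ((Measurable.ite (measurableSet_le hfm.norm measurable_const) measurable_const
          measurable_const).mul (hfm.enorm.pow_const 2)).aemeasurable
    _ ≤ 4 ^ n * (C * ∫⁻ y, ‖f y‖ₑ ^ p) + ∫⁻ y, C' * ‖f y‖ₑ ^ p := by
        refine add_le_add (mul_le_mul' le_rfl (hC f hf hfm)) (lintegral_mono fun y => ?_)
        rcases (norm_nonneg (f y)).eq_or_lt with h | h
        · have : f y = 0 := norm_eq_zero.1 h.symm
          simp [this]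
        · refine (mul_le_mul' (hC' _ h) le_rfl).trans (le_of_eq ?_)
          rw [← ofReal_norm, mul_assoc, ENNReal.ofReal_rpow_of_pos h, ← ENNReal.ofReal_pow h.le,
            ← ENNReal.ofReal_mul (by positivity), ← Real.rpow_natCast, ← Real.rpow_add h]
          congr 3; push_cast; ring
    _ = _ := by
        rw [lintegral_const_mul' _ _ ENNReal.coe_ne_top]; push_cast; ring

/-- A simultaneous Calderón–Zygmund decomposition at all heights `2^i`, with atoms
`α (i, q)` adapted to dyadic cells. -/
theorem exists_calderon_zygmund (hn : n ≠ 0) (hp1 : 1 < p) (hp2 : p < 2) : ∃ C : ℝ≥0, ∀ f : Rn n → ℂ,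
    Continuous f → Integrable f → (∃ M : ℝ, ∀ y, ‖f y‖ ≤ M) →
    ∃ (G : ℤ → Rn n → ℂ) (α : ℤ × (ℤ × (Fin n → ℤ)) → Rn n → ℂ)
      (W : ℤ × (ℤ × (Fin n → ℤ)) → ℝ≥0∞) (c : ℤ × (Fin n → ℤ) → Rn n) (w : ℤ × (Fin n → ℤ) → ℝ),
      (∀ q, 0 < w q) ∧ (∀ i, Measurable (G i)) ∧ (∀ i, Integrable (G i)) ∧ (∀ e, Measurable (α e)) ∧
      (∀ e, ∫ y, α e y = 0) ∧ (∀ e y, ‖α e y‖ₑ ≤ C * ENNReal.ofReal (2 ^ e.1)) ∧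
      (∀ e y, α e y ≠ 0 → ‖y - c e.2‖ ≤ w e.2) ∧
      (∀ e, α e = 0 ∨ ENNReal.ofReal (w e.2 ^ n) ≤ C * W e) ∧
      (∀ i y, f y = G i y + ∑' e, if i ≤ e.1 then α e y else 0) ∧
      (∑' i : ℤ, ENNReal.ofReal (2 ^ ((i:ℝ) * (p - 1))) *
        ∑' e, (if i ≤ e.1 then ENNReal.ofReal (2 ^ e.1) * W e else 0) ≤ C * ∫⁻ y, ‖f y‖ₑ ^ p) ∧
      ∑' i : ℤ, ENNReal.ofReal (2 ^ (-((i:ℝ) * (2 - p)))) * ∫⁻ y, ‖G i y‖ₑ ^ 2 ≤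
        C * ∫⁻ y, ‖f y‖ₑ ^ p := by
  obtain ⟨C₁, hC₁⟩ := exists_tsum_tail_volume_badSet_le hn hp1
  obtain ⟨C₂, hC₂⟩ := exists_tsum_goodPart_sq_le hn hp1 hp2
  set C : ℝ≥0 := C₁ + C₂ + 3 * 2 ^ n + (n + 1) ^ n with hCdef
  have hle₁ : (C₁ : ℝ≥0∞) ≤ C := by
    rw [ENNReal.coe_le_coe, hCdef, add_assoc, add_assoc]; exact le_self_add
  have hle₂ : (C₂ : ℝ≥0∞) ≤ C := by
    rw [ENNReal.coe_le_coe, hCdef, add_comm C₁, add_assoc, add_assoc]; exact le_self_add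
  have hle₃ : ((3 * 2 ^ n : ℝ≥0) : ℝ≥0∞) ≤ C := by
    rw [ENNReal.coe_le_coe, hCdef]; exact le_add_self.trans le_self_add
  have hle₄ : (((n + 1) ^ n : ℝ≥0) : ℝ≥0∞) ≤ C := by
    rw [ENNReal.coe_le_coe, hCdef]; exact le_add_self
  refine ⟨C, fun f hfc hf ⟨M, hM⟩ => ?_⟩
  have hfm := hfc.measurable
  obtain ⟨N, hN⟩ : ∃ N : ℤ, ∀ y, ‖f y‖ ≤ 2 ^ N := by
    obtain ⟨N, hN⟩ := pow_unbounded_of_one_lt M (show (1:ℝ) < 2 by norm_num)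
    exact ⟨N, fun y => (hM y).trans (by rw [zpow_natCast]; exact hN.le)⟩
  have hGm := measurable_goodPart hn hf hfm
  have hGi := integrable_goodPart hn hf hfc
  refine ⟨goodPart f, fun e => (stopPiece f e.1 e.2).indicator fun y => goodPart f (e.1 + 1) y - goodPart f e.1 y,
    fun e => volume (stopPiece f e.1 e.2), cellCorner, fun q => (n + 1) * 2 ^ q.1, fun q => by positivity,
    hGm, hGi, fun e => ((hGm _).sub (hGm _)).indicator (measurableSet_stopPiece hn hf _ _), ?_, ?_, ?_, ?_, ?_, ?_,
    (hC₂ f hf hfc).trans (mul_le_mul' hle₂ le_rfl)⟩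
  · rintro ⟨i, q⟩
    rw [integral_indicator (measurableSet_stopPiece hn hf _ _)]
    rcases (stopPiece f i q).eq_empty_or_nonempty with h | ⟨y, hy⟩
    · simp [h]
    dsimp only
    rw [stopPiece_eq hn hf hy, integral_sub (hGi _).integrableOn (hGi _).integrableOn]
    have hmem : ∀ z ∈ cell q, z ∈ badSet f i ∧ stopCell f i z = q := by
      rw [← stopPiece_eq hn hf hy]; exact fun z hz => hz
    rw [setIntegral_goodPart hn hf hfc i (measurableSet_cell q),
      setIntegral_goodPart hn hf hfc (i + 1) (measurableSet_cell q), sub_self]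
    · intro z hz hzb z' hz'
      obtain ⟨hzi, hzq⟩ := hmem z hz
      have h1 := isGreatest_stopCell hn hf hzb
      have h2 := isGreatest_stopCell hn hf hzi
      have h3 : (stopCell f (i + 1) z).1 ≤ (stopCell f i z).1 := h2.2 (badSet_anti f (by omega) z h1.1)
      have h4 : cellIdx (stopCell f i z).1 z' = cellIdx (stopCell f i z).1 z := cellIdx_mono h3 hz'
      rw [hzq] at h4
      exact h4.trans hz
    · intro z hz hzb
      rw [(hmem z hz).2]
  · rintro ⟨i, q⟩ y
    refine (enorm_indicator_le_enorm_self _ _).trans ((enorm_sub_le).trans ?_)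
    refine (add_le_add (enorm_goodPart_le hn hf hfc _ y) (enorm_goodPart_le hn hf hfc _ y)).trans ?_
    refine le_trans (le_of_eq ?_) (mul_le_mul' hle₃ le_rfl)
    have : ((3 * 2 ^ n : ℝ≥0) : ℝ≥0∞) = ENNReal.ofReal (3 * 2 ^ n) := by
      rw [ENNReal.ofReal_mul (by norm_num), ENNReal.ofReal_pow (by norm_num)]; norm_num
    rw [this, ← ENNReal.ofReal_mul (by positivity), ← ENNReal.ofReal_add (by positivity) (by positivity),
      zpow_add_one₀ (by norm_num)]
    congr 1; ring
  · rintro ⟨i, q⟩ y hy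
    have h1 : y ∈ stopPiece f i q := mem_of_indicator_ne_zero hy
    rw [stopPiece_eq hn hf h1] at h1
    exact norm_sub_cellCorner_le h1
  · rintro ⟨i, q⟩
    rcases (stopPiece f i q).eq_empty_or_nonempty with h | ⟨y, hy⟩
    · left; ext y; simp [h]
    · right
      dsimp only
      rw [stopPiece_eq hn hf hy, volume_cell]
      refine le_trans (le_of_eq ?_) (mul_le_mul' hle₄ le_rfl)
      have : (((n + 1) ^ n : ℝ≥0) : ℝ≥0∞) = ENNReal.ofReal ((n + 1) ^ n) := by
        rw [ENNReal.ofReal_pow (by positivity), ENNReal.ofReal_add (by positivity) (by norm_num)]; simp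
      rw [this, ← ENNReal.ofReal_mul (by positivity), mul_pow]
  · intro i y
    have hstep : ∀ i' : ℤ, ∑' q, (stopPiece f i' q).indicator (fun y => goodPart f (i' + 1) y - goodPart f i' y) y =
        goodPart f (i' + 1) y - goodPart f i' y := by
      intro i'
      by_cases hy : y ∈ badSet f i'
      · rw [tsum_eq_single (stopCell f i' y), indicator_of_mem (show y ∈ stopPiece f i' (stopCell f i' y) from ⟨hy, rfl⟩)]
        intro q hq
        exact indicator_of_notMem (fun h => hq h.2.symm) _
      · have h1 : y ∉ badSet f (i' + 1) := fun ⟨a, ha⟩ => hy ⟨a, badSet_anti f (by omega) y ha⟩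
        rw [goodPart_of_notMem hy, goodPart_of_notMem h1, sub_self]
        convert tsum_zero with q
        exact indicator_of_notMem (fun h => hy h.1) _
    have hbig : ∀ i', N ≤ i' → goodPart f i' y = f y := fun i' h =>
      goodPart_of_notMem (by rw [badSet_eq_empty hN h]; exact notMem_empty y)
    set s : Finset (ℤ × (ℤ × (Fin n → ℤ))) := (Finset.Ico i N).image fun i' => (i', stopCell f i' y) with hs
    have hsum : ∑' e : ℤ × (ℤ × (Fin n → ℤ)), (if i ≤ e.1 then (stopPiece f e.1 e.2).indicator
        (fun y => goodPart f (e.1 + 1) y - goodPart f e.1 y) y else 0) =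
        ∑ i' ∈ Finset.Ico i N, (goodPart f (i' + 1) y - goodPart f i' y) := by
      rw [tsum_eq_sum (s := s), hs, Finset.sum_image]
      · refine Finset.sum_congr rfl fun i' hi' => ?_
        rw [if_pos (Finset.mem_Ico.1 hi').1, ← hstep i']
        by_cases hy : y ∈ badSet f i'
        · rw [tsum_eq_single (stopCell f i' y)]
          intro q hq
          exact indicator_of_notMem (fun h => hq h.2.symm) _
        · rw [indicator_of_notMem (fun h => hy h.1)]
          symm
          convert tsum_zero with q
          exact indicator_of_notMem (fun h => hy h.1) _
      · intro a _ b _ hab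
        exact (Prod.ext_iff.1 hab).1
      · rintro ⟨i', q⟩ he
        split_ifs with h
        · by_contra hne
          have hmem : y ∈ stopPiece f i' q := mem_of_indicator_ne_zero hne
          refine he (Finset.mem_image.2 ⟨i', Finset.mem_Ico.2 ⟨h, ?_⟩, by rw [hmem.2]⟩)
          by_contra hcon
          have := hmem.1
          rw [badSet_eq_empty hN (not_lt.1 hcon)] at this
          exact this
        · rfl
    rw [hsum]
    rcases le_or_gt N i with h | h
    · rw [Finset.Ico_eq_empty (by omega), Finset.sum_empty, add_zero, hbig i h]
    · have htel : ∀ k : ℕ, ∑ i' ∈ Finset.Ico i (i + k), (goodPart f (i' + 1) y - goodPart f i' y) =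
          goodPart f (i + k) y - goodPart f i y := by
        intro k
        induction k with
        | zero => simp
        | succ k ih =>
          have h1 : Finset.Ico i (i + ((k + 1 : ℕ) : ℤ)) = insert (i + (k:ℤ)) (Finset.Ico i (i + k)) := by
            ext z; simp only [Finset.mem_Ico, Finset.mem_insert]; push_cast; omega
          rw [h1, Finset.sum_insert (by simp), ih]
          push_cast; rw [← add_assoc]; ring
      obtain ⟨k, hk⟩ : ∃ k : ℕ, N = i + k := ⟨(N - i).toNat, by omega⟩
      rw [hk, htel k, hbig _ hk.le]; ring
  · refine le_trans (le_of_eq ?_) ((hC₁ f hf hfm).trans (mul_le_mul' hle₁ le_rfl))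
    congr 1; ext i; congr 1
    rw [ENNReal.tsum_prod']
    congr 1; ext i'
    split_ifs
    · dsimp only
      rw [ENNReal.tsum_mul_left, volume_badSet_eq hn hf]
    · simp

end CalderonZygmund

section Superposition
variable {ι : Type*}

/-- Minkowski's inequality for a superposition of sequences. -/
lemma tsum_tsum_sq_le {β : ι → ℤ → ℝ≥0∞} {b : ι → ℝ≥0∞} (h : ∀ e, ∑' j, β e j ^ 2 ≤ b e ^ 2) :
    ∑' j, (∑' e, β e j) ^ 2 ≤ (∑' e, b e) ^ 2 := by
  have h1 : ∀ e e', ∑' j, β e j * β e' j ≤ b e * b e' := fun e e' => by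
    refine ENNReal.le_of_sq_le_sq ?_
    rw [← lintegral_count]
    refine (lintegral_mul_sq_le (by fun_prop) (by fun_prop)).trans ?_
    rw [lintegral_count, lintegral_count, mul_pow]
    exact mul_le_mul' (h e) (h e')
  have h2 : ∀ a : ι → ℝ≥0∞, (∑' e, a e) ^ 2 = ∑' e, ∑' e', a e * a e' := fun a => by
    simp_rw [ENNReal.tsum_mul_left, ENNReal.tsum_mul_right, sq]
  simp_rw [h2]
  rw [ENNReal.tsum_comm]
  refine ENNReal.tsum_le_tsum fun e => ?_
  rw [ENNReal.tsum_comm]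
  exact ENNReal.tsum_le_tsum fun e' => h1 e e'

lemma lintegral_superposition_sq_le {β : ι → ℤ → ℝ≥0∞} {b : ι → ℝ≥0∞}
    (h : ∀ e, ∑' j, β e j ^ 2 ≤ b e ^ 2) :
    ∫⁻ y : ℤ × ℝ, ((∑' e, β e y.1) * (Icc (1/2 : ℝ) 4).indicator 1 y.2) ^ 2 ∂(Measure.count.prod volume) ≤
      (4 : ℝ≥0) * (∑' e, b e) ^ 2 := by
  have h1 : ∀ u : ℝ, ((Icc (1/2 : ℝ) 4).indicator (1 : ℝ → ℝ≥0∞) u) ^ 2 = (Icc (1/2 : ℝ) 4).indicator 1 u := by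
    intro u
    by_cases hu : u ∈ Icc (1/2 : ℝ) 4
    · rw [indicator_of_mem hu]; simp
    · rw [indicator_of_notMem hu]; simp
  simp_rw [mul_pow, h1]
  rw [lintegral_prod_mul (f := fun j : ℤ => (∑' e, β e j) ^ 2) Measurable.of_discrete.aemeasurable
    (measurable_one.indicator measurableSet_Icc).aemeasurable, lintegral_count, lintegral_indicator_one measurableSet_Icc,
    mul_comm]
  refine mul_le_mul' ?_ (tsum_tsum_sq_le h)
  rw [Real.volume_Icc]
  refine ENNReal.ofReal_le_coe.2 ?_
  norm_num

variable {n : ℕ} [Countable ι] {Γ : ℝ → ℝ} {K : Rn n → ℝ} {ψ χ : ℝ → ℝ}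

lemma cv_tsum {α : ι → Rn n → ℂ} (hα : ∀ e, Measurable (α e)) (hs : ∑' e, ∫⁻ y, ‖α e y‖ₑ ≠ ∞)
    {κ : Rn n → ℂ} (hκ : Measurable κ) {M : ℝ} (hM : ∀ x, ‖κ x‖ ≤ M) (x : Rn n) :
    cv (fun y => ∑' e, α e y) κ x = ∑' e, cv (α e) κ x := by
  unfold cv
  rw [← integral_tsum]
  · congr 1; ext t; rw [tsum_mul_right]
  · intro e
    have : Measurable fun t => α e (x - t) * κ t := ((hα e).comp (by fun_prop)).mul hκ
    exact this.aestronglyMeasurable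
  · have h1 : ∀ e, ∫⁻ t, ‖α e (x - t) * κ t‖ₑ ≤ ENNReal.ofReal M * ∫⁻ y, ‖α e y‖ₑ := fun e => by
      rw [← lintegral_sub_left_eq_self (fun y => ‖α e y‖ₑ) x, ← lintegral_const_mul' _ _ ENNReal.ofReal_ne_top]
      refine lintegral_mono fun t => ?_
      rw [enorm_mul, mul_comm]
      refine mul_le_mul' ?_ le_rfl
      rw [← ofReal_norm]
      exact ENNReal.ofReal_le_ofReal (hM t)
    refine ne_top_of_le_ne_top ?_ (ENNReal.tsum_le_tsum h1)
    rw [ENNReal.tsum_mul_left]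
    exact ENNReal.mul_ne_top ENNReal.ofReal_ne_top hs

lemma enorm_cv_cv_le_of_decomp (hψ : IsLPCutoff ψ) {f G : Rn n → ℂ} (hf : Integrable f)
    (hfm : Measurable f) (hG : Integrable G) (hGm : Measurable G) {α : ι → Rn n → ℂ}
    (hα : ∀ e, Measurable (α e)) (hs : ∑' e, ∫⁻ y, ‖α e y‖ₑ ≠ ∞)
    (hdec : ∀ y, f y = G y + ∑' e, α e y) (a : ℤ) {κ : Rn n → ℂ} (hκ : Measurable κ) {M : ℝ}
    (hM : ∀ x, ‖κ x‖ ≤ M) (x : Rn n) :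
    ‖cv (cv f (lpk n ψ a)) κ x‖ₑ ≤
      ∑' e, ‖cv (cv (α e) (lpk n ψ a)) κ x‖ₑ + ‖cv (cv G (lpk n ψ a)) κ x‖ₑ := by
  have hl := (continuous_lpk (n := n) hψ a).measurable
  obtain ⟨M', hM'⟩ := exists_norm_lpk_le (n := n) hψ a
  have h1 : (fun y => ∑' e, α e y) = fun y => f y - G y := by ext y; rw [hdec y]; ring
  have h2 : (fun y => ∑' e, cv (α e) (lpk n ψ a) y) = fun y => cv f (lpk n ψ a) y - cv G (lpk n ψ a) y := by
    ext y
    rw [← cv_tsum hα hs hl hM', h1, cv_sub hf hG hl hM']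
  have hs' : ∑' e, ∫⁻ y, ‖cv (α e) (lpk n ψ a) y‖ₑ ≠ ∞ := by
    have h3 : ∀ e, ∫⁻ y, ‖cv (α e) (lpk n ψ a) y‖ₑ ≤ (∫⁻ y, ‖α e y‖ₑ) * ∫⁻ y, ‖lpk n ψ a y‖ₑ := fun e => by
      rw [← lintegral_lcv (hα e).enorm hl.enorm]
      exact lintegral_mono (enorm_cv_le _ _)
    refine ne_top_of_le_ne_top ?_ (ENNReal.tsum_le_tsum h3)
    rw [ENNReal.tsum_mul_right]
    exact ENNReal.mul_ne_top hs (integrable_lpk hψ a).2.ne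
  have h4 := cv_tsum (fun e => measurable_cv (hα e) hl) hs' hκ hM x
  rw [h2, cv_sub (integrable_cv_lpk hψ hfm hf a) (integrable_cv_lpk hψ hGm hG a) hκ hM] at h4
  rw [sub_eq_iff_eq_add.1 h4]
  exact (enorm_add_le _ _).trans (add_le_add enorm_tsum_le_tsum_enorm le_rfl)

lemma vec_le_of_decomp (hΓ : IsGammaU Γ) (hK : IsHomCZKernel n K) (hψ : IsLPCutoff ψ)
    (hχ : IsChiCutoff χ) {l m k : ℤ} {f G : Rn n → ℂ} (hf : Integrable f)
    (hfm : Measurable f) (hG : Integrable G) (hGm : Measurable G) {α : ι → Rn n → ℂ}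
    (hα : ∀ e, Measurable (α e)) (hs : ∑' e, ∫⁻ y, ‖α e y‖ₑ ≠ ∞)
    (hdec : ∀ y, f y = G y + ∑' e, α e y) (x : Rn n) {β : ι → ℤ → ℝ≥0∞}
    (hβ : ∀ e, ∀ j ∈ Slm Γ l m, ∀ u ∈ Icc (1/2 : ℝ) 4, ‖cv (cv (α e) (lpk n ψ (k - kstar Γ j)))
      (hker Γ K ψ (2 ^ j * u) (l + kstar Γ j)) x‖ₑ ≤ β e j) (y : ℤ × ℝ) :
    vec Γ K ψ χ l m k f x y ≤
      (∑' e, β e y.1) * (Icc (1/2 : ℝ) 4).indicator 1 y.2 + vec Γ K ψ χ l m k G x y := by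
  obtain ⟨j, u⟩ := y
  unfold vec
  by_cases hj : j ∈ Slm Γ l m
  · rw [indicator_of_mem hj, indicator_of_mem hj]
    dsimp only
    rw [enorm_mul, enorm_mul]
    obtain ⟨M, hM⟩ := exists_norm_hker_le hΓ hK hψ (l + kstar Γ j)
    refine (mul_le_mul' le_rfl (enorm_cv_cv_le_of_decomp hψ hf hfm hG hGm hα hs hdec _
      (measurable_hker hΓ hK hψ _ _) (hM _) x)).trans ?_
    rw [mul_add]
    refine add_le_add ?_ le_rfl
    refine (mul_le_mul' (hχ.enorm_le u) le_rfl).trans ?_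
    by_cases hu : u ∈ Icc (1/2 : ℝ) 4
    · rw [indicator_of_mem hu, Pi.one_apply, one_mul, mul_one]
      exact ENNReal.tsum_le_tsum fun e => hβ e j hj u hu
    · rw [indicator_of_notMem hu, zero_mul]; exact zero_le
  · rw [indicator_of_notMem hj]; exact zero_le

end Superposition

section Assembly
variable {n : ℕ} {Γ : ℝ → ℝ} {K : Rn n → ℝ} {ψ χ : ℝ → ℝ} {p r : ℝ}

lemma exists_atom_family (hn : 2 ≤ n) (hΓ : IsGammaU Γ) (hK : IsHomCZKernel n K)
    (hψ : IsLPCutoff ψ) :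
    ∃ C : ℝ≥0, ∀ l m k : ℤ, |k - m| ≤ 1 → ∀ α : Rn n → ℂ, Measurable α →
      ∫ y, α y = 0 → ∀ (h : ℝ≥0) (W : ℝ≥0∞) (c : Rn n) (w : ℝ), 0 < w → (∀ y, ‖α y‖ₑ ≤ h) →
      (∀ y, α y ≠ 0 → ‖y - c‖ ≤ w) → (α = 0 ∨ ENNReal.ofReal (w ^ n) ≤ W) →
      ∫⁻ y, ‖α y‖ₑ ≤ C * (h * W) ∧
      ∃ (β : ℤ → Rn n → ℝ≥0∞) (b : Rn n → ℝ≥0∞), Measurable b ∧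
        (∀ j ∈ Slm Γ l m, ∀ u ∈ Icc (1/2 : ℝ) 4, ∀ x, ‖cv (cv α (lpk n ψ (k - kstar Γ j)))
          (hker Γ K ψ (2 ^ j * u) (l + kstar Γ j)) x‖ₑ ≤ β j x) ∧
        (∀ x, ∑' j, β j x ^ 2 ≤ b x ^ 2) ∧ ∫⁻ x, b x ≤ C * (h * W) := by
  obtain ⟨C, hC⟩ := exists_atom_majorant hn hΓ hK hψ
  obtain ⟨V, hV⟩ : ∃ V : ℝ≥0, volume (Metric.closedBall (0 : Rn n) 1) = V :=
    ⟨_, (ENNReal.coe_toNNReal volume_unitBall_ne_top).symm⟩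
  refine ⟨C + V, fun l m k hk α hα hα0 h W c w hw hh hs hW => ?_⟩
  rcases hW with rfl | hW
  · refine ⟨by simp, 0, 0, measurable_const, fun j _ u _ x => ?_, fun x => by simp, by simp⟩
    simp [cv]
  · obtain ⟨β, b, -, hb, h1, h2, h3⟩ := hC l m k hk α hα hα0 h c w hw hh hs
    refine ⟨?_, β, b, hb, h1, h2, h3.trans (mul_le_mul' (by exact_mod_cast le_self_add) (mul_le_mul' le_rfl hW))⟩
    have h4 := lintegral_enorm_pow_le_of_support hh hw.le hs one_ne_zero
    simp only [pow_one] at h4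
    rw [hV, ← mul_assoc, mul_comm _ (V : ℝ≥0∞)] at h4
    exact h4.trans (mul_le_mul' (by exact_mod_cast le_add_self) (mul_le_mul' le_rfl hW))

theorem exists_lintegral_vec_rpow_le (hn : 2 ≤ n) (hΓ : IsGammaU Γ) (hK : IsHomCZKernel n K)
    (hψ : IsLPCutoff ψ) (hχ : IsChiCutoff χ) (hp1 : 1 < p) (hp2 : p < 2) (hr1 : 2 ≤ r)
    (hr2 : r ≤ p / (p - 1)) :
    ∃ C : ℝ≥0, ∀ l m k : ℤ, |k - m| ≤ 1 → ∀ f : Rn n → ℂ, Continuous f → Integrable f →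
      (∃ M : ℝ, ∀ y, ‖f y‖ ≤ M) → ∫⁻ y, ‖f y‖ₑ ^ p ≠ ∞ →
      ∫⁻ x, (∫⁻ y, vec Γ K ψ χ l m k f x y ^ r ∂(Measure.count.prod volume)) ^ (p / r) ≤
        C * ENNReal.ofReal ((((2:ℝ) ^ (m + l)) ^ n) ^ (-(p - 1))) * ∫⁻ y, ‖f y‖ₑ ^ p := by
  obtain ⟨C₁, hC₁⟩ := exists_atom_family hn hΓ hK hψ
  obtain ⟨C₂, hC₂⟩ := exists_calderon_zygmund (n := n) (by omega) hp1 hp2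
  obtain ⟨C₃, hC₃⟩ := exists_lintegral_vec_sq_le hΓ hK hψ hχ
  obtain ⟨C₄, hC₄⟩ : ∃ C₄ : ℝ≥0, 8 * ((4 : ℝ≥0) : ℝ≥0∞) + 2 + ENNReal.ofReal (4 ^ (p / (p - 1))) = C₄ :=
    ⟨8 * 4 + 2 + (4 ^ (p / (p - 1)) : ℝ).toNNReal, by push_cast; rfl⟩
  refine ⟨C₄ * (C₁ * C₂ * C₂ * C₂ + C₃ * C₂), fun l m k hk f hfc hfi hM hfp => ?_⟩
  obtain ⟨G, α, W, c, w, hw, hGm, hGi, hαm, hα0, hαh, hαs, hαW, hdec, hsum, hG2⟩ := hC₂ f hfc hfi hM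
  set L : ℝ := ((2:ℝ) ^ (m + l)) ^ n with hLdef
  have hL : 0 < L := by positivity
  have hfam := fun e => hC₁ l m k hk (α e) (hαm e) (hα0 e) (C₂ * ((2:ℝ) ^ e.1).toNNReal) (C₂ * W e)
    (c e.2) (w e.2) (hw e.2) (fun y => by rw [ENNReal.coe_mul]; exact hαh e y) (hαs e) (hαW e)
  choose hα1 β b hbm hβ hβb hb1 using hfam
  have hconst : ∀ e, (C₁ : ℝ≥0∞) * ((C₂ * ((2:ℝ) ^ e.1).toNNReal : ℝ≥0) * (C₂ * W e)) =
      C₁ * C₂ * C₂ * (ENNReal.ofReal (2 ^ e.1) * W e) := fun e => by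
    rw [ENNReal.coe_mul]
    change (C₁ : ℝ≥0∞) * (C₂ * ENNReal.ofReal (2 ^ e.1) * (C₂ * W e)) = _
    ring
  simp only [hconst] at hα1 hb1
  set S : ℤ → ℝ≥0∞ := fun i => ∑' e : ℤ × (ℤ × (Fin n → ℤ)),
    (if i ≤ e.1 then ENNReal.ofReal (2 ^ e.1) * W e else 0) with hSdef
  have hSfin : ∀ i, S i ≠ ∞ := fun i hi => by
    have h1 := (ENNReal.le_tsum i).trans hsum
    rw [show ∑' e, (if i ≤ e.1 then ENNReal.ofReal (2 ^ e.1) * W e else 0) = S i from rfl, hi,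
      ENNReal.mul_top (by rw [ne_eq, ENNReal.ofReal_eq_zero, not_le]; positivity)] at h1
    exact ENNReal.mul_ne_top ENNReal.coe_ne_top hfp (top_le_iff.1 h1)
  have hite : ∀ (i : ℤ) (a : ℤ × (ℤ × (Fin n → ℤ)) → ℝ≥0∞),
      (∀ e, a e ≤ C₁ * C₂ * C₂ * (ENNReal.ofReal (2 ^ e.1) * W e)) →
      ∑' e, (if i ≤ e.1 then a e else 0) ≤ C₁ * C₂ * C₂ * S i := fun i a ha => by
    rw [hSdef, ← ENNReal.tsum_mul_left]
    refine ENNReal.tsum_le_tsum fun e => ?_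
    split_ifs
    · exact ha e
    · exact zero_le
  set bb : ℤ → Rn n → ℝ≥0∞ := fun i x => ∑' e, if i ≤ e.1 then b e x else 0 with hbb
  have hbbm : ∀ i, Measurable (bb i) := fun i => Measurable.tsum fun e => by
    split_ifs
    · exact hbm e
    · exact measurable_const
  have hbb1 : ∀ i, ∫⁻ x, bb i x ≤ C₁ * C₂ * C₂ * S i := fun i => by
    rw [hbb]
    dsimp only
    rw [lintegral_tsum]
    · refine le_trans (le_of_eq ?_) (hite i (fun e => ∫⁻ x, b e x) hb1)
      congr 1; ext e; split_ifs <;> simp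
    · intro e
      split_ifs
      · exact (hbm e).aemeasurable
      · exact aemeasurable_const
  have hvm : ∀ i, Measurable fun q : Rn n × (ℤ × ℝ) => vec Γ K ψ χ l m k (G i) q.1 q.2 :=
    fun i => measurable_vec hΓ hK hψ hχ l m k (hGm i)
  set V : ℤ → Rn n → ℝ≥0∞ := fun i x =>
    ∫⁻ y, vec Γ K ψ χ l m k (G i) x y ^ 2 ∂(Measure.count.prod volume) with hV
  have hVm : ∀ i, Measurable (V i) := fun i => ((hvm i).pow_const 2).lintegral_prod_right'
  set X : Rn n → ℝ≥0∞ := fun x => (∑' i : ℤ, ENNReal.ofReal (2 ^ ((i:ℝ) * (p - 1))) * bb i x) +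
    ENNReal.ofReal L * ∑' i : ℤ, ENNReal.ofReal (2 ^ (-((i:ℝ) * (2 - p)))) * V i x with hX
  have hpt : ∀ x, (∫⁻ y, vec Γ K ψ χ l m k f x y ^ r ∂(Measure.count.prod volume)) ^ (p / r) ≤
      C₄ * (ENNReal.ofReal (L ^ (-(p - 1))) * X x) := fun x => by
    rw [← hC₄]
    have hsec : ∀ g : Rn n → ℂ, Measurable g → Measurable (vec Γ K ψ χ l m k g x) := fun g hg => by
      have := (measurable_vec hΓ hK hψ hχ l m k hg).comp (measurable_prodMk_left (x := x))
      simpa only [Function.comp_def] using this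
    set βi : ℤ → ℤ × (ℤ × (Fin n → ℤ)) → ℤ → ℝ≥0∞ := fun i e j => if i ≤ e.1 then β e j x else 0 with hβi
    have hβib : ∀ i e, ∑' j, βi i e j ^ 2 ≤ (if i ≤ e.1 then b e x else 0) ^ 2 := fun i e => by
      simp only [hβi]
      split_ifs
      · exact hβb e x
      · simp
    refine lintegral_rpow_le_of_decomp' hp1 hp2 hr1 hr2 hL (hsec f hfc.measurable)
      (B := fun i y => (∑' e, βi i e y.1) * (Icc (1/2 : ℝ) 4).indicator 1 y.2)
      (V := fun i => vec Γ K ψ χ l m k (G i) x) (fun i => hsec _ (hGm i)) (fun i y => ?_)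
      (b := fun i => bb i x) (fun i => ?_) (fun i y => ?_) (fun i => ?_) le_add_self
    · refine vec_le_of_decomp hΓ hK hψ hχ hfi hfc.measurable (hGi i) (hGm i)
        (α := fun e => if i ≤ e.1 then α e else 0) (fun e => ?_) ?_ (fun y => ?_) x (fun e j hj u hu => ?_) y
      · split_ifs
        · exact hαm e
        · exact measurable_const
      · have h1 := hite i (fun e => ∫⁻ y, ‖α e y‖ₑ) hα1
        refine ne_top_of_le_ne_top ?_ (le_trans (le_of_eq ?_) h1)
        · exact ENNReal.mul_ne_top (by simp [ENNReal.mul_eq_top]) (hSfin i)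
        · congr 1; ext e; split_ifs <;> simp
      · rw [hdec i y]
        congr 2; ext e; split_ifs <;> simp
      · simp only [hβi]
        split_ifs
        · exact hβ e j hj u hu x
        · simp [cv]
    · exact lintegral_superposition_sq_le (hβib i)
    · have h1 : ∑' e, βi i e y.1 ≤ bb i x := ENNReal.tsum_le_tsum fun e =>
        ENNReal.le_of_sq_le_sq ((ENNReal.le_tsum y.1).trans (hβib i e))
      refine (mul_le_mul' h1 ?_).trans (mul_one _).le
      exact indicator_le_self' (fun _ _ => zero_le) _
    · exact (ENNReal.le_tsum (f := fun i : ℤ => ENNReal.ofReal (2 ^ ((i:ℝ) * (p - 1))) * bb i x) i).trans le_self_add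
  have hX1 : ∫⁻ x, X x ≤ (C₁ * C₂ * C₂ * C₂ + C₃ * C₂) * ∫⁻ y, ‖f y‖ₑ ^ p := by
    rw [hX]
    dsimp only
    rw [lintegral_add_left (Measurable.tsum fun i => (hbbm i).const_mul _), add_mul]
    refine add_le_add ?_ ?_
    · rw [lintegral_tsum fun i => ((hbbm i).const_mul _).aemeasurable]
      simp_rw [lintegral_const_mul' _ _ ENNReal.ofReal_ne_top]
      refine (ENNReal.tsum_le_tsum fun i => mul_le_mul' le_rfl (hbb1 i)).trans ?_
      simp_rw [mul_left_comm (ENNReal.ofReal _)]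
      rw [ENNReal.tsum_mul_left]
      refine (mul_le_mul' le_rfl hsum).trans (le_of_eq ?_)
      ring
    · rw [lintegral_const_mul' _ _ ENNReal.ofReal_ne_top,
        lintegral_tsum fun i => ((hVm i).const_mul _).aemeasurable]
      simp_rw [lintegral_const_mul' _ _ ENNReal.ofReal_ne_top]
      refine (mul_le_mul' le_rfl (ENNReal.tsum_le_tsum fun i => mul_le_mul' le_rfl
        (hC₃ l m k (G i) (hGm i) (hGi i)))).trans ?_
      rw [tsum_congr fun i => mul_left_comm _ _ _, ENNReal.tsum_mul_left]
      refine (mul_le_mul' le_rfl (mul_le_mul' le_rfl hG2)).trans (le_of_eq ?_)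
      have h1 : ENNReal.ofReal L * ENNReal.ofReal (((2:ℝ) ^ (m + l))⁻¹ ^ n) = 1 := by
        rw [← ENNReal.ofReal_mul hL.le, hLdef, ← mul_pow, mul_inv_cancel₀ (by positivity), one_pow,
          ENNReal.ofReal_one]
      calc _ = (ENNReal.ofReal L * ENNReal.ofReal (((2:ℝ) ^ (m + l))⁻¹ ^ n)) *
            (C₃ * C₂ * ∫⁻ y, ‖f y‖ₑ ^ p) := by ring
        _ = _ := by rw [h1, one_mul]
  refine (lintegral_mono hpt).trans ?_
  rw [lintegral_const_mul' _ _ ENNReal.coe_ne_top, lintegral_const_mul' _ _ ENNReal.ofReal_ne_top]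
  refine (mul_le_mul' le_rfl (mul_le_mul' le_rfl hX1)).trans (le_of_eq ?_)
  push_cast; ring

end Assembly

/-- Lemma 6.6 (a building block for Proposition 6.1): the `w_{r,p}` estimate in the
degenerate frequency range `|k − m| ≤ 𝒞`. -/
theorem wrp_estimate_small_p (n : ℕ) (hn : 2 ≤ n) (Γ : ℝ → ℝ) (hΓ : IsGammaU Γ)
    (K : Rn n → ℝ) (hK : IsHomCZKernel n K) (ψ : ℝ → ℝ) (hψ : IsLPCutoff ψ)
    (χ : ℝ → ℝ) (hχ : IsChiCutoff χ) (p r : ℝ) (hp1 : 1 < p) (hp2 : p ≤ 2)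
    (hr1 : 2 ≤ r) (hr2 : r ≤ p / (p - 1)) :
    ∃ 𝒞 : ℕ, 1 ≤ 𝒞 ∧ ∃ C > (0 : ℝ), ∀ l m k : ℤ, 1 ≤ l → |k - m| ≤ (𝒞 : ℤ) →
      ∀ f : SchwartzMap (Rn n) ℂ,
      lpNormENN p
          (fun x => (∑' j : Slm Γ l m,
            eLpNorm (fun u : ℝ =>
                Complex.ofReal (χ u) *
                  Hloc Γ K ψ ((2 : ℝ) ^ (j : ℤ) * u) (l + kstar Γ (j : ℤ))
                    (LPproj ψ (k - kstar Γ (j : ℤ)) (⇑f)) x)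
              (ENNReal.ofReal r) volume ^ r) ^ (1 / r)) volume
        ≤ ENNReal.ofReal (C * (2 : ℝ) ^ (-((n : ℝ) * ((m : ℝ) + (l : ℝ)) / (p / (p - 1))))) *
            eLpNorm (⇑f) (ENNReal.ofReal p) volume := by
  have hp0 : 0 < p := by linarith
  have hr0 : 0 < r := by linarith
  obtain ⟨C, hC⟩ : ∃ C : ℝ≥0, ∀ l m k : ℤ, |k - m| ≤ 1 → ∀ f : SchwartzMap (Rn n) ℂ,
      ∫⁻ x, (∫⁻ y, vec Γ K ψ χ l m k f x y ^ r ∂(Measure.count.prod volume)) ^ (p / r) ≤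
        C * ENNReal.ofReal ((((2:ℝ) ^ (m + l)) ^ n) ^ (-(p - 1))) * ∫⁻ y, ‖f y‖ₑ ^ p := by
    rcases hp2.lt_or_eq with h2 | rfl
    · obtain ⟨C, hC⟩ := exists_lintegral_vec_rpow_le hn hΓ hK hψ hχ hp1 h2 hr1 hr2
      refine ⟨C, fun l m k hk f => hC l m k hk f f.continuous f.integrable
        ⟨_, f.norm_le_seminorm ℝ⟩ ?_⟩
      have h3 := (f.memLp (ENNReal.ofReal p) volume).2
      have h4 := lintegral_rpow_enorm_lt_top_of_eLpNorm_lt_top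
        (by simpa using hp0) ENNReal.ofReal_ne_top h3
      rw [ENNReal.toReal_ofReal hp0.le] at h4
      exact h4.ne
    · obtain rfl : r = 2 := le_antisymm (by norm_num at hr2; exact hr2) hr1
      obtain ⟨C, hC⟩ := exists_lintegral_vec_sq_le hΓ hK hψ hχ
      refine ⟨C, fun l m k _ f => ?_⟩
      have h3 := hC l m k f f.continuous.measurable f.integrable
      have h4 : (((2:ℝ) ^ (m + l)) ^ n) ^ (-((2:ℝ) - 1)) = ((2:ℝ) ^ (m + l))⁻¹ ^ n := by
        rw [show -((2:ℝ) - 1) = -1 by norm_num, Real.rpow_neg_one, inv_pow]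
      rw [h4, div_self two_ne_zero]
      simpa only [ENNReal.rpow_one, ENNReal.rpow_two] using h3
  refine ⟨1, le_rfl, ((C : ℝ) + 1) ^ (1 / p), by positivity, fun l m k _ hk f => ?_⟩
  have h1 := hC l m k (by exact_mod_cast hk) f
  simp_rw [tsum_eLpNorm_eq_lintegral_vec hΓ hK hψ hχ l m k f hr0]
  rw [lpNormENN, eLpNorm_eq_lintegral_rpow_enorm_toReal (by simpa using hp0) ENNReal.ofReal_ne_top,
    ENNReal.toReal_ofReal hp0.le]
  simp_rw [← ENNReal.rpow_mul, one_div_mul_eq_div]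
  refine (ENNReal.rpow_le_rpow h1 (by positivity)).trans ?_
  rw [ENNReal.mul_rpow_of_nonneg _ _ (by positivity)]
  refine mul_le_mul' ?_ le_rfl
  have h5 : (C : ℝ≥0∞) ≤ ENNReal.ofReal (C + 1) := by
    rw [ENNReal.ofReal_add (by positivity) zero_le_one, ENNReal.ofReal_coe_nnreal]
    exact le_self_add
  refine (ENNReal.rpow_le_rpow (mul_le_mul' h5 le_rfl) (by positivity)).trans (le_of_eq ?_)
  rw [← ENNReal.ofReal_mul (by positivity), ENNReal.ofReal_rpow_of_nonneg (by positivity) (by positivity),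
    Real.mul_rpow (by positivity) (by positivity)]
  congr 2
  rw [← Real.rpow_intCast, ← Real.rpow_natCast, ← Real.rpow_mul (by positivity), ← Real.rpow_mul (by positivity),
    ← Real.rpow_mul (by positivity)]
  congr 1
  push_cast
  have : p - 1 ≠ 0 := by linarith
  field_simp
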